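/- Let N ≥ 2, let Ω ⊂ ℝ^N be a bounded domain with C³ boundary and unit volume, and let p ∈ [1, p_N). For any λ̄ > 0 there exist r ∈ (0,1), ᾱ > −∞ and C < +∞ such that every solution (α, ψ) of problem (P)_λ on Ω with λ ∈ [0, λ̄] satisfies: α ≥ ᾱ, and for all x, y ∈ Ω̄, |ψ(x)| ≤ C, ‖∇ψ(x)‖ ≤ C, ‖∇²ψ(x)‖ ≤ C, and ‖∇²ψ(x) − ∇²ψ(y)‖ ≤ C |x − y|^r. -/

import Mathlib

open MeasureTheory Metric Set

noncomputable section

/-- The Laplacian of a function on Euclidean space. -/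
def lapl {N : ℕ} (f : EuclideanSpace ℝ (Fin N) → ℝ) (x : EuclideanSpace ℝ (Fin N)) : ℝ :=
  ∑ i : Fin N,
    fderiv ℝ (fun y => fderiv ℝ f y (EuclideanSpace.single i (1 : ℝ))) x
      (EuclideanSpace.single i (1 : ℝ))

/-- `(α, ψ)` is a solution of problem `(P)_λ` on `Ω`:
`ψ ∈ C²`, `-Δψ = (max (α + λψ) 0)^p` in `Ω`, `ψ = 0` on `∂Ω`, and
`∫_Ω (max (α + λψ) 0)^p = 1`. -/
def IsSol {N : ℕ} (Ω : Set (EuclideanSpace ℝ (Fin N))) (p lam α : ℝ)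
    (ψ : EuclideanSpace ℝ (Fin N) → ℝ) : Prop :=
  ContDiff ℝ 2 ψ ∧
  (∀ x ∈ Ω, -lapl ψ x = (max (α + lam * ψ x) 0) ^ p) ∧
  (∀ x ∈ frontier Ω, ψ x = 0) ∧
  (∫ x in Ω, (max (α + lam * ψ x) 0) ^ p) = 1

/-- `Ω` is a bounded domain of class `C³`: open, connected, bounded, and near every
boundary point `Ω` is the sublevel set of a `C³` function with nonvanishing gradient. -/
def IsC3Domain {N : ℕ} (Ω : Set (EuclideanSpace ℝ (Fin N))) : Prop :=
  IsOpen Ω ∧ IsConnected Ω ∧ Bornology.IsBounded Ω ∧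
  ∀ x ∈ frontier Ω, ∃ (U : Set (EuclideanSpace ℝ (Fin N)))
      (f : EuclideanSpace ℝ (Fin N) → ℝ),
    IsOpen U ∧ x ∈ U ∧ ContDiff ℝ 3 f ∧ (∀ y ∈ U, fderiv ℝ f y ≠ 0) ∧
    Ω ∩ U = {y ∈ U | f y < 0}

namespace PlasmaRegularity

open scoped InnerProductSpace ContDiff NNReal Topology
open Filter Asymptotics

/-- Euclidean space of dimension `N`. -/
abbrev Euc (N : ℕ) := EuclideanSpace ℝ (Fin N)

/-- A smooth compactly supported probability density `η` on `ℝ^N` together with a potential `K`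
satisfying `∇K(y) = -η(y) y`. -/
structure RadialKernel (N : ℕ) where
  K : Euc N → ℝ
  η : Euc N → ℝ
  contDiff_K : ContDiff ℝ ∞ K
  contDiff_η : ContDiff ℝ ∞ η
  K_eq_zero : ∀ y, 1 ≤ ‖y‖ → K y = 0
  η_eq_zero : ∀ y, 1 ≤ ‖y‖ → η y = 0
  K_nonneg : ∀ y, 0 ≤ K y
  η_nonneg : ∀ y, 0 ≤ η y
  fderiv_K : ∀ y h, fderiv ℝ K y h = -η y * ⟪y, h⟫_ℝ
  integral_η : ∫ y, η y = 1

theorem hasCompactSupport_of_eq_zero {N : ℕ} {F : Type*} [Zero F] {g : Euc N → F} (r : ℝ)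
    (hg : ∀ y, r ≤ ‖y‖ → g y = 0) : HasCompactSupport g :=
  HasCompactSupport.intro (isCompact_closedBall (0 : Euc N) r) fun x hx =>
    hg x (by simpa using (not_le.1 (by simpa using hx)).le)

theorem nonempty_radialKernel (N : ℕ) [NeZero N] : Nonempty (RadialKernel N) := by
  set φ := Real.smoothTransition with hφ
  have hφs : ContDiff ℝ ∞ φ := Real.smoothTransition.contDiff
  have hφ' : ContDiff ℝ ∞ (deriv φ) := by
    have := (contDiff_succ_iff_deriv (n := ∞) (f := φ)).1 (by simpa using hφs)
    exact this.2.2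
  have hsq : ContDiff ℝ ∞ (fun y : Euc N => 1 - ‖y‖ ^ 2) := contDiff_const.sub (contDiff_norm_sq ℝ)
  set η₀ : Euc N → ℝ := fun y => 2 * deriv φ (1 - ‖y‖ ^ 2) with hη₀
  have hη₀s : ContDiff ℝ ∞ η₀ := contDiff_const.mul (hφ'.comp hsq)
  have hφ0 : ∀ s ≤ 0, φ s = 0 := fun s hs => Real.smoothTransition.zero_of_nonpos hs
  have hdnn : ∀ s, 0 ≤ deriv φ s := fun s => Real.smoothTransition.monotone.deriv_nonneg
  have hd0 : ∀ s ≤ 0, deriv φ s = 0 := by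
    have hlt : ∀ s < 0, deriv φ s = 0 := by
      intro s hs
      have : φ =ᶠ[nhds s] fun _ => 0 := by
        filter_upwards [Iio_mem_nhds hs] with t ht using hφ0 t (le_of_lt ht)
      rw [this.deriv_eq]; simp
    intro s hs
    have hcl : IsClosed {s | deriv φ s = 0} := isClosed_eq hφ'.continuous continuous_const
    have : closure (Iio (0 : ℝ)) ⊆ {s | deriv φ s = 0} := hcl.closure_subset_iff.2 hlt
    rw [closure_Iio] at this
    exact this hs
  have hη₀z : ∀ y, 1 ≤ ‖y‖ → η₀ y = 0 := by
    intro y hy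
    simp only [hη₀]
    rw [hd0 _ (by nlinarith [norm_nonneg y])]; simp
  have hpos : 0 < ∫ y, η₀ y := by
    obtain ⟨s, hs, hs'⟩ := exists_deriv_eq_slope φ (zero_lt_one)
      hφs.continuous.continuousOn (hφs.differentiable (by simp)).differentiableOn
    obtain ⟨y, hy⟩ := exists_norm_eq (Euc N) (c := √(1 - s)) (Real.sqrt_nonneg _)
    refine hη₀s.continuous.integral_pos_of_hasCompactSupport_nonneg_nonzero
      (hasCompactSupport_of_eq_zero 1 hη₀z)
      (fun y => mul_nonneg zero_le_two (hdnn _)) (x := y) ?_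
    simp only [hη₀, hy]
    rw [Real.sq_sqrt (by linarith [hs.2])]
    rw [sub_sub_cancel, hs']
    simp [hφ]
  set c := ∫ y, η₀ y
  refine ⟨⟨fun y => c⁻¹ * φ (1 - ‖y‖ ^ 2), fun y => c⁻¹ * η₀ y,
    contDiff_const.mul (hφs.comp hsq), contDiff_const.mul hη₀s, ?_, ?_, ?_, ?_, ?_, ?_⟩⟩
  · intro y hy
    rw [hφ0 _ (by nlinarith [norm_nonneg y])]; simp
  · intro y hy
    simp [hη₀z y hy]
  · exact fun y => mul_nonneg (inv_nonneg.2 hpos.le) (Real.smoothTransition.nonneg _)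
  · exact fun y => mul_nonneg (inv_nonneg.2 hpos.le) (mul_nonneg zero_le_two (hdnn _))
  · intro y h
    have h1 : HasFDerivAt (fun y : Euc N => 1 - ‖y‖ ^ 2) (-(2 • innerSL ℝ y)) y := by
      simpa using (hasStrictFDerivAt_norm_sq y).hasFDerivAt.const_sub 1
    have h2 : HasDerivAt φ (deriv φ (1 - ‖y‖ ^ 2)) (1 - ‖y‖ ^ 2) :=
      (hφs.differentiable (by simp)).differentiableAt.hasDerivAt
    have h3 := (h2.comp_hasFDerivAt y h1).const_mul c⁻¹
    rw [show (fun y : Euc N => c⁻¹ * φ (1 - ‖y‖ ^ 2)) =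
      fun y => c⁻¹ * (φ ∘ fun y : Euc N => 1 - ‖y‖ ^ 2) y from rfl, h3.fderiv]
    simp [hη₀]
    ring
  · rw [integral_const_mul]
    exact inv_mul_cancel₀ hpos.ne'

/-- The trace of the second derivative of `w`. -/
def lap {N : ℕ} (w : Euc N → ℝ) (x : Euc N) : ℝ :=
  ∑ i : Fin N, fderiv ℝ (fderiv ℝ w) x (EuclideanSpace.single i 1) (EuclideanSpace.single i 1)

theorem measurable_lap {N : ℕ} (w : Euc N → ℝ) : Measurable (lap w) := by
  refine Finset.measurable_sum _ fun i _ => ?_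
  have h := measurable_fderiv_apply_const ℝ (fderiv ℝ w) (EuclideanSpace.single i (1 : ℝ))
  exact (ContinuousLinearMap.apply ℝ ℝ
    (EuclideanSpace.single i (1 : ℝ) : Euc N)).continuous.measurable.comp h

theorem norm_lap_le {N : ℕ} {w : Euc N → ℝ} {L : ℝ≥0} (hL : LipschitzWith L (fderiv ℝ w))
    (x : Euc N) : ‖lap w x‖ ≤ N * L := by
  refine (norm_sum_le _ _).trans ?_
  have : ∀ i ∈ (Finset.univ : Finset (Fin N)), ‖fderiv ℝ (fderiv ℝ w) x
      (EuclideanSpace.single i 1) (EuclideanSpace.single i 1)‖ ≤ L := by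
    intro i _
    have h1 := ContinuousLinearMap.le_opNorm₂ (fderiv ℝ (fderiv ℝ w) x)
      (EuclideanSpace.single i 1) (EuclideanSpace.single i 1)
    have h2 := norm_fderiv_le_of_lipschitz ℝ hL (x₀ := x)
    simpa using h1.trans (by simpa using h2)
  refine (Finset.sum_le_sum this).trans ?_
  simp

theorem RadialKernel.hasCompactSupport_K {N : ℕ} (k : RadialKernel N) : HasCompactSupport k.K :=
  hasCompactSupport_of_eq_zero 1 k.K_eq_zero

theorem RadialKernel.hasCompactSupport_η {N : ℕ} (k : RadialKernel N) : HasCompactSupport k.η :=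
  hasCompactSupport_of_eq_zero 1 k.η_eq_zero

theorem RadialKernel.integrable_K {N : ℕ} (k : RadialKernel N) : Integrable k.K :=
  k.contDiff_K.continuous.integrable_of_hasCompactSupport k.hasCompactSupport_K

theorem RadialKernel.integrable_η {N : ℕ} (k : RadialKernel N) : Integrable k.η :=
  k.contDiff_η.continuous.integrable_of_hasCompactSupport k.hasCompactSupport_η

theorem quasiMeasurePreserving_sub_smul {N : ℕ} (x : Euc N) {t : ℝ} (ht : t ≠ 0) :
    Measure.QuasiMeasurePreserving (fun y : Euc N => x - t • y) volume volume := by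
  have ha : Measure.QuasiMeasurePreserving (fun y : Euc N => t • y) volume volume :=
    ⟨measurable_const_smul t, by
      rw [Measure.map_addHaar_smul _ ht]
      exact Measure.smul_absolutelyContinuous⟩
  exact (quasiMeasurePreserving_sub_left volume x).comp ha

/-- Integration by parts for the radial derivative of a `C^{1,1}` function. -/
theorem RadialKernel.integral_fderiv_mul {N : ℕ} (k : RadialKernel N) {w : Euc N → ℝ} {L : ℝ≥0}
    (hL : LipschitzWith L (fderiv ℝ w)) (x : Euc N) {t : ℝ} (ht : t ≠ 0) :
    ∫ y, fderiv ℝ w (x - t • y) (-y) * k.η y = t * ∫ y, lap w (x - t • y) * k.K y := by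
  set e : Fin N → Euc N := fun i => EuclideanSpace.single i 1 with he
  have hne : ∀ i, ‖e i‖ = 1 := fun i => by simp [he]
  obtain ⟨D, hD⟩ := ContDiff.lipschitzWith_of_hasCompactSupport (n := ∞) k.hasCompactSupport_K
    k.contDiff_K (by simp)
  have hlip : ∀ i, LipschitzWith (L * ‖t‖₊) (fun y => fderiv ℝ w (x - t • y) (e i)) := by
    intro i
    refine LipschitzWith.of_dist_le_mul fun y z => ?_
    rw [dist_eq_norm, dist_eq_norm, ← sub_apply]
    refine (ContinuousLinearMap.le_opNorm _ _).trans ?_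
    rw [hne, mul_one, ← dist_eq_norm]
    refine (hL.dist_le_mul _ _).trans ?_
    rw [dist_eq_norm, show x - t • y - (x - t • z) = -(t • (y - z)) by rw [smul_sub]; abel, norm_neg,
      norm_smul]
    simp [mul_assoc]
  have hae : ∀ᵐ y : Euc N, DifferentiableAt ℝ (fderiv ℝ w) (x - t • y) := by
    have h1 : ∀ᵐ z : Euc N, DifferentiableAt ℝ (fderiv ℝ w) z := hL.ae_differentiableAt
    have h2 := quasiMeasurePreserving_sub_smul x ht
    exact h2.ae h1
  have hparts : ∀ i, ∫ y, fderiv ℝ w (x - t • y) (e i) * fderiv ℝ k.K y (e i) =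
      t * ∫ y, fderiv ℝ (fderiv ℝ w) (x - t • y) (e i) (e i) * k.K y := by
    intro i
    have h := (hlip i).integral_lineDeriv_mul_eq (μ := volume) hD k.hasCompactSupport_K (e i)
    have hl : ∀ y, lineDeriv ℝ k.K y (-e i) = - fderiv ℝ k.K y (e i) := fun y => by
      rw [(k.contDiff_K.differentiable (by simp)).differentiableAt.lineDeriv_eq_fderiv, map_neg]
    have hr : ∀ᵐ y, lineDeriv ℝ (fun y => fderiv ℝ w (x - t • y) (e i)) y (e i) * k.K y =
        -(t * (fderiv ℝ (fderiv ℝ w) (x - t • y) (e i) (e i) * k.K y)) := by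
      filter_upwards [hae] with y hy
      have h1 : HasFDerivAt (fun y : Euc N => x - t • y) (-(t • ContinuousLinearMap.id ℝ (Euc N)))
          y := ((hasFDerivAt_id y).const_smul t).const_sub x
      have h2 := (hy.hasFDerivAt.comp y h1).clm_apply (hasFDerivAt_const (e i) y)
      have h3 := (h2.hasLineDerivAt (e i)).lineDeriv
      simp only [Function.comp_def] at h3
      rw [h3]
      simp
      ring
    rw [integral_congr_ae hr] at h
    simp only [hl, neg_mul, integral_neg, integral_const_mul, neg_inj] at h
    rw [h]
    exact integral_congr_ae (.of_forall fun y => mul_comm _ _)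
  have hKd : ∀ i, Continuous fun y => fderiv ℝ k.K y (e i) := fun i =>
    (k.contDiff_K.continuous_fderiv (by simp)).clm_apply continuous_const
  have hi1 : ∀ i, Integrable (fun y => fderiv ℝ w (x - t • y) (e i) * fderiv ℝ k.K y (e i)) :=
    fun i => ((hlip i).continuous.mul (hKd i)).integrable_of_hasCompactSupport
      ((k.hasCompactSupport_K.fderiv_apply ℝ (e i)).mul_left)
  have hi2 : ∀ i, Integrable
      (fun y => fderiv ℝ (fderiv ℝ w) (x - t • y) (e i) (e i) * k.K y) := by
    intro i
    refine k.integrable_K.bdd_mul (c := L) ?_ (.of_forall fun y => ?_)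
    · have h := measurable_fderiv_apply_const ℝ (fderiv ℝ w) (e i)
      have h' := (ContinuousLinearMap.apply ℝ ℝ (e i)).continuous.measurable.comp h
      exact (h'.comp (measurable_const.sub (measurable_const_smul t))).aestronglyMeasurable
    · have h1 := ContinuousLinearMap.le_opNorm₂ (fderiv ℝ (fderiv ℝ w) (x - t • y)) (e i) (e i)
      have h2 := norm_fderiv_le_of_lipschitz ℝ hL (x₀ := x - t • y)
      rw [hne, mul_one, mul_one] at h1
      exact h1.trans h2
  have hl : ∀ y, fderiv ℝ w (x - t • y) (-y) * k.η y =
      ∑ i, fderiv ℝ w (x - t • y) (e i) * fderiv ℝ k.K y (e i) := by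
    intro y
    have hy : y = ∑ i, ⟪y, e i⟫_ℝ • e i := by
      have := (EuclideanSpace.basisFun (Fin N) ℝ).sum_repr' y
      simpa [he, real_inner_comm] using this.symm
    conv_lhs => rw [hy]
    rw [map_neg, map_sum, neg_mul, Finset.sum_mul, ← Finset.sum_neg_distrib]
    refine Finset.sum_congr rfl fun i _ => ?_
    rw [← hy, k.fderiv_K, map_smul, smul_eq_mul]
    ring
  simp only [hl]
  rw [integral_finsetSum _ fun i _ => hi1 i]
  simp only [hparts, lap, Finset.sum_mul]
  rw [integral_finsetSum _ fun i _ => hi2 i, Finset.mul_sum]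

theorem RadialKernel.hasDerivAt_integral {N : ℕ} (k : RadialKernel N) {w : Euc N → ℝ} {L : ℝ≥0}
    (hw : Differentiable ℝ w) (hL : LipschitzWith L (fderiv ℝ w)) (x : Euc N) (t : ℝ) :
    HasDerivAt (fun t : ℝ => ∫ y, w (x - t • y) * k.η y)
      (∫ y, fderiv ℝ w (x - t • y) (-y) * k.η y) t := by
  have hc : ∀ s : ℝ, Continuous fun y : Euc N => w (x - s • y) * k.η y := fun s =>
    (hw.continuous.comp (by fun_prop)).mul k.contDiff_η.continuous
  have hc' : ∀ s : ℝ, Continuous fun y : Euc N => fderiv ℝ w (x - s • y) (-y) * k.η y := fun s =>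
    ((hL.continuous.comp (by fun_prop)).clm_apply continuous_neg).mul k.contDiff_η.continuous
  set C := ‖fderiv ℝ w x‖ + L * (|t| + 1)
  refine (hasDerivAt_integral_of_dominated_loc_of_deriv_le (s := ball t 1)
    (F := fun s y => w (x - s • y) * k.η y)
    (F' := fun s y => fderiv ℝ w (x - s • y) (-y) * k.η y)
    (bound := fun y => C * k.η y) (ball_mem_nhds t one_pos)
    (.of_forall fun s => (hc s).aestronglyMeasurable)
    ((hc t).integrable_of_hasCompactSupport k.hasCompactSupport_η.mul_left)
    (hc' t).aestronglyMeasurable (.of_forall fun y s hs => ?_)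
    (k.integrable_η.const_mul C) (.of_forall fun y s hs => ?_)).2
  · rcases le_total 1 ‖y‖ with hy | hy
    · simp [k.η_eq_zero y hy]
    · rw [norm_mul, Real.norm_of_nonneg (k.η_nonneg y)]
      refine mul_le_mul_of_nonneg_right ?_ (k.η_nonneg y)
      refine (ContinuousLinearMap.le_opNorm _ _).trans ?_
      rw [norm_neg]
      refine (mul_le_of_le_one_right (norm_nonneg _) hy).trans ?_
      have h1 : ‖fderiv ℝ w (x - s • y) - fderiv ℝ w x‖ ≤ L * (|t| + 1) := by
        rw [← dist_eq_norm]
        refine (hL.dist_le_mul _ _).trans (mul_le_mul_of_nonneg_left ?_ L.2)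
        rw [dist_eq_norm, sub_sub_cancel_left, norm_neg, norm_smul]
        have : ‖s‖ ≤ |t| + 1 := by
          have h := norm_le_norm_add_norm_sub' s t
          rw [mem_ball, dist_eq_norm] at hs
          simp only [Real.norm_eq_abs] at h hs ⊢
          linarith
        nlinarith [norm_nonneg s, norm_nonneg y]
      calc ‖fderiv ℝ w (x - s • y)‖ ≤ ‖fderiv ℝ w x‖ + ‖fderiv ℝ w (x - s • y) - fderiv ℝ w x‖ :=
            norm_le_norm_add_norm_sub' _ _
        _ ≤ C := by linarith
  · have h1 : HasDerivAt (fun s : ℝ => x - s • y) (-y) s := by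
      simpa using ((hasDerivAt_id s).smul_const y).const_sub x
    exact (((hw _).hasFDerivAt.comp_hasDerivAt s h1).mul_const (k.η y))

/-- The derivative in the scale of the mollification of a `C^{1,1}` function. -/
theorem RadialKernel.hasDerivAt_mollify {N : ℕ} (k : RadialKernel N) {w : Euc N → ℝ} {L : ℝ≥0}
    (hw : Differentiable ℝ w) (hL : LipschitzWith L (fderiv ℝ w)) (x : Euc N) {t : ℝ}
    (ht : t ≠ 0) :
    HasDerivAt (fun t : ℝ => ∫ y, w (x - t • y) * k.η y)
      (t * ∫ y, lap w (x - t • y) * k.K y) t := by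
  rw [← k.integral_fderiv_mul hL x ht]
  exact k.hasDerivAt_integral hw hL x t

theorem integrable_lap_mul {N : ℕ} {w : Euc N → ℝ} {L : ℝ≥0} (hL : LipschitzWith L (fderiv ℝ w))
    {g : Euc N → ℝ} (hg : Integrable g) (x : Euc N) (t : ℝ) :
    Integrable fun y => lap w (x - t • y) * g y :=
  hg.bdd_mul (c := N * L) (((measurable_lap w).comp
    (measurable_const.sub (measurable_const_smul t))).aestronglyMeasurable)
    (.of_forall fun _ => norm_lap_le hL _)

theorem integrable_comp_mul {N : ℕ} {w : Euc N → ℝ} (hw : Continuous w) {g : Euc N → ℝ}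
    (hg : Continuous g) (hgc : HasCompactSupport g) (x : Euc N) (t : ℝ) :
    Integrable fun y => w (x - t • y) * g y :=
  ((hw.comp (by fun_prop)).mul hg).integrable_of_hasCompactSupport hgc.mul_left

section Taylor

variable {E : Type*} [NormedAddCommGroup E] [NormedSpace ℝ E]

/-- The second order Taylor polynomial of `f` at `a`, as a function of the increment. -/
def taylor2 (f : E → ℝ) (a h : E) : ℝ :=
  f a + fderiv ℝ f a h + 1 / 2 * fderiv ℝ (fderiv ℝ f) a h h

theorem abs_sub_taylor2_le {f : E → ℝ} (hf : ContDiff ℝ 2 f) {a h : E} {ε : ℝ}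
    (hε : ∀ s ∈ Icc (0 : ℝ) 1,
      ‖fderiv ℝ (fderiv ℝ f) (a + s • h) - fderiv ℝ (fderiv ℝ f) a‖ ≤ ε) :
    |f (a + h) - taylor2 f a h| ≤ ε * ‖h‖ ^ 2 := by
  have hε0 : 0 ≤ ε := by
    refine le_trans ?_ (hε 0 (by simp))
    exact ContinuousLinearMap.opNorm_nonneg _
  have hf1 : Differentiable ℝ f := hf.differentiable (by simp)
  have hf2 : Differentiable ℝ (fderiv ℝ f) :=
    (hf.fderiv_right (m := 1) (by norm_num)).differentiable (by simp)
  have hline : ∀ s : ℝ, HasDerivAt (fun s : ℝ => a + s • h) h s := fun s => by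
    simpa using ((hasDerivAt_id s).smul_const h).const_add a
  have h1 : ∀ s ∈ Icc (0 : ℝ) 1, ‖(fderiv ℝ f (a + s • h) h - s * fderiv ℝ (fderiv ℝ f) a h h) -
      (fderiv ℝ f (a + (0 : ℝ) • h) h - 0 * fderiv ℝ (fderiv ℝ f) a h h)‖ ≤
      ε * ‖h‖ ^ 2 * (s - 0) := by
    refine norm_image_sub_le_of_norm_deriv_le_segment'
      (f := fun s : ℝ => fderiv ℝ f (a + s • h) h - s * fderiv ℝ (fderiv ℝ f) a h h)
      (f' := fun s => fderiv ℝ (fderiv ℝ f) (a + s • h) h h - 1 * fderiv ℝ (fderiv ℝ f) a h h)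
      (fun s _ => ?_) (fun s hs => ?_)
    · have h2 := (hf2 _).hasFDerivAt.comp_hasDerivAt s (hline s)
      exact ((h2.clm_apply (hasDerivAt_const s h)).congr_deriv (by simp)).sub
        ((hasDerivAt_id s).mul_const _) |>.hasDerivWithinAt
    · rw [one_mul, ← sub_apply, ← sub_apply]
      refine (ContinuousLinearMap.le_opNorm₂ _ _ _).trans ?_
      rw [mul_assoc, ← sq]
      exact mul_le_mul_of_nonneg_right (hε s ⟨hs.1, hs.2.le⟩) (by positivity)
  have h3 := norm_image_sub_le_of_norm_deriv_le_segment_01' (C := ε * ‖h‖ ^ 2)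
    (f := fun s : ℝ => f (a + s • h) - s * fderiv ℝ f a h -
      s ^ 2 * (1 / 2 * fderiv ℝ (fderiv ℝ f) a h h))
    (f' := fun s => fderiv ℝ f (a + s • h) h - 1 * fderiv ℝ f a h -
      (2 * s) * (1 / 2 * fderiv ℝ (fderiv ℝ f) a h h))
    (fun s _ => by
      have h2 := (hf1 _).hasFDerivAt.comp_hasDerivAt s (hline s)
      refine ((h2.sub ((hasDerivAt_id s).mul_const _)).sub
        (HasDerivAt.mul_const ?_ _)).hasDerivWithinAt
      simpa using hasDerivAt_pow 2 s)
    (fun s hs => by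
      have h4 := h1 s ⟨hs.1, hs.2.le⟩
      simp only [zero_smul, add_zero, zero_mul, sub_zero] at h4
      rw [show fderiv ℝ f (a + s • h) h - 1 * fderiv ℝ f a h -
        (2 * s) * (1 / 2 * fderiv ℝ (fderiv ℝ f) a h h) = fderiv ℝ f (a + s • h) h -
          s * fderiv ℝ (fderiv ℝ f) a h h - fderiv ℝ f a h by ring]
      exact h4.trans (mul_le_of_le_one_right (by positivity) hs.2.le))
  rw [Real.norm_eq_abs] at h3
  convert h3 using 2
  simp [taylor2]
  ring

end Taylor

theorem abs_third_difference_le {N : ℕ} {g : Euc N → ℝ} (hg : ContDiff ℝ ∞ g)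
    (hgc : HasCompactSupport g) : ∃ C, 0 ≤ C ∧ ∀ a y : Euc N,
      |g (a + (8 : ℝ) • y) - 7 * g (a + (4 : ℝ) • y) + 14 * g (a + (2 : ℝ) • y) - 8 * g (a + y)| ≤
        C * ‖y‖ ^ 3 := by
  have h1 : ContDiff ℝ ∞ (fderiv ℝ (fderiv ℝ g)) :=
    (hg.fderiv_right (m := ∞) (by simp)).fderiv_right (m := ∞) (by simp)
  have h2 : HasCompactSupport (fderiv ℝ (fderiv ℝ g)) := (hgc.fderiv ℝ).fderiv ℝ
  obtain ⟨D, hD⟩ : ∃ D, LipschitzWith D (fderiv ℝ (fderiv ℝ g)) :=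
    ContDiff.lipschitzWith_of_hasCompactSupport (n := ∞) h2 h1 (by simp)
  have h3 : ContDiff ℝ 2 g := contDiff_infty.1 hg 2
  have key : ∀ a h : Euc N, |g (a + h) - taylor2 g a h| ≤ D * ‖h‖ ^ 3 := fun a h => by
    have := abs_sub_taylor2_le (a := a) (h := h) (ε := D * ‖h‖) h3 fun s hs => by
        refine le_trans (hD.norm_sub_le _ _) (mul_le_mul_of_nonneg_left ?_ D.2)
        rw [add_sub_cancel_left, norm_smul, Real.norm_of_nonneg hs.1]
        exact mul_le_of_le_one_left (norm_nonneg _) hs.2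
    linarith
  refine ⟨1080 * D, by positivity, fun a y => ?_⟩
  set p := fderiv ℝ g a y with hp
  set q := fderiv ℝ (fderiv ℝ g) a y y with hq
  have key' : ∀ c : ℝ, 0 ≤ c →
      |g (a + c • y) - (g a + c * p + c ^ 2 / 2 * q)| ≤ D * (c ^ 3 * ‖y‖ ^ 3) := by
    intro c hc
    have h2 := key a (c • y)
    have h3 : taylor2 g a (c • y) = g a + c * p + c ^ 2 / 2 * q := by
      simp only [taylor2, map_smul, smul_apply, smul_eq_mul, hp, hq]
      ring
    rwa [h3, norm_smul, Real.norm_of_nonneg hc, mul_pow] at h2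
  have e8 := abs_le.1 (key' 8 (by norm_num))
  have e4 := abs_le.1 (key' 4 (by norm_num))
  have e2 := abs_le.1 (key' 2 (by norm_num))
  have e1 := abs_le.1 (key' 1 (by norm_num))
  rw [one_smul] at e1
  rw [abs_le]
  constructor <;> linarith [e8.1, e8.2, e4.1, e4.2, e2.1, e2.2, e1.1, e1.2]

theorem dyadic_step {j : ℕ} (hj : j ≤ 2) {b : ℝ → ℝ} {A t₀ : ℝ} (hA : 0 ≤ A)
    (h : ∀ t ∈ Ioc 0 t₀, |b (2 * t) - 2 ^ j * b t| ≤ A * (t ^ 2 * √t))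
    (ho : b =o[𝓝[>] 0] fun t => t ^ 2) {t : ℝ} (ht : t ∈ Ioc 0 (2 * t₀)) :
    |b t| ≤ A * (t ^ 2 * √t) := by
  set r : ℝ := √(1 / 2) with hr
  have hr2 : r ^ 2 = 1 / 2 := Real.sq_sqrt (by norm_num)
  have hr0 : 0 < r := Real.sqrt_pos.2 (by norm_num)
  have hr1 : r < 3 / 4 := by nlinarith
  have ht0 := ht.1
  set c : ℕ → ℝ := fun n => (2 ^ j) ^ n * b (t / 2 ^ n) with hc
  have hj4 : (2 : ℝ) ^ j ≤ 4 := by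
    calc (2 : ℝ) ^ j ≤ 2 ^ 2 := pow_le_pow_right₀ (by norm_num) hj
      _ = 4 := by norm_num
  have hsqrt : ∀ n : ℕ, √(t / 2 ^ n) = √t * r ^ n := fun n => by
    rw [show t / 2 ^ n = t * (1 / 2) ^ n by rw [one_div, inv_pow]; rfl, Real.sqrt_mul ht0.le, hr]
    congr 1
    rw [Real.sqrt_eq_iff_mul_self_eq (by positivity) (by positivity), ← mul_pow,
      Real.mul_self_sqrt (by norm_num)]
  have hstep : ∀ n, dist (c n) (c (n + 1)) ≤ 1 / 4 * (A * (t ^ 2 * √t)) * r ^ n := by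
    intro n
    have hm : t / 2 ^ (n + 1) ∈ Ioc 0 t₀ := by
      refine ⟨by positivity, ?_⟩
      rw [div_le_iff₀ (by positivity), pow_succ]
      have : (1 : ℝ) ≤ 2 ^ n := one_le_pow₀ (by norm_num)
      nlinarith [ht.2]
    have h1 := h _ hm
    rw [show 2 * (t / 2 ^ (n + 1)) = t / 2 ^ n by rw [pow_succ]; field_simp, hsqrt] at h1
    rw [Real.dist_eq, show c n - c (n + 1) = (2 ^ j) ^ n * (b (t / 2 ^ n) -
      2 ^ j * b (t / 2 ^ (n + 1))) by simp only [hc]; ring, abs_mul,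
      abs_of_nonneg (by positivity : (0 : ℝ) ≤ (2 ^ j) ^ n)]
    have h4 : ((2 : ℝ) ^ j) ^ n ≤ 4 ^ n := pow_le_pow_left₀ (by positivity) hj4 n
    calc (2 ^ j) ^ n * |b (t / 2 ^ n) - 2 ^ j * b (t / 2 ^ (n + 1))|
        ≤ 4 ^ n * (A * ((t / 2 ^ (n + 1)) ^ 2 * (√t * r ^ (n + 1)))) := by gcongr
      _ = 1 / 4 * (A * (t ^ 2 * √t)) * r ^ n * r := by
          have : (4 : ℝ) ^ n = (2 ^ n) ^ 2 := by rw [← pow_mul, mul_comm, pow_mul]; norm_num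
          rw [this, pow_succ (2 : ℝ), pow_succ r]
          field_simp
          norm_num
      _ ≤ _ := mul_le_of_le_one_right (by positivity) (by linarith)
  have hlim : Tendsto c atTop (𝓝 0) := by
    have hseq : Tendsto (fun n : ℕ => t / 2 ^ n) atTop (𝓝[>] 0) := by
      refine tendsto_nhdsWithin_iff.2 ⟨?_, .of_forall fun n => by
        change 0 < t / 2 ^ n
        positivity⟩
      exact tendsto_const_nhds.div_atTop (tendsto_pow_atTop_atTop_of_one_lt (by norm_num))
    have h1 : (fun n : ℕ => b (t / 2 ^ n)) =o[atTop] fun n : ℕ => (t / 2 ^ n) ^ 2 :=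
      ho.comp_tendsto hseq
    have h2 : (fun n : ℕ => ((2 : ℝ) ^ j) ^ n) =O[atTop] fun n => (4 : ℝ) ^ n :=
      .of_bound 1 (.of_forall fun n => by
        rw [one_mul, Real.norm_of_nonneg (by positivity), Real.norm_of_nonneg (by positivity)]
        exact pow_le_pow_left₀ (by positivity) hj4 n)
    have h3 := h2.mul_isLittleO h1
    have h4 : (fun n : ℕ => (4 : ℝ) ^ n * (t / 2 ^ n) ^ 2) = fun _ => t ^ 2 := by
      funext n
      have : (4 : ℝ) ^ n = (2 ^ n) ^ 2 := by rw [← pow_mul, mul_comm, pow_mul]; norm_num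
      rw [this]
      field_simp
    rw [h4] at h3
    exact (isLittleO_const_iff (by positivity)).1 h3
  have h5 := dist_le_of_le_geometric_of_tendsto₀ r _ (by linarith) hstep hlim
  rw [Real.dist_eq, sub_zero] at h5
  simp only [hc, pow_zero, one_mul, div_one] at h5
  refine h5.trans ?_
  rw [div_le_iff₀ (by linarith)]
  have : 0 ≤ A * (t ^ 2 * √t) := by positivity
  nlinarith

/-- A function of one variable which is `o(t²)` at the origin and whose third dyadic difference
is `O(t^{5/2})` is itself `O(t^{5/2})`. -/
theorem abs_le_of_dyadic_difference {g : ℝ → ℝ} {A t₀ : ℝ} (hA : 0 ≤ A)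
    (h : ∀ t ∈ Ioc 0 t₀, |g (8 * t) - 7 * g (4 * t) + 14 * g (2 * t) - 8 * g t| ≤
      A * (t ^ 2 * √t))
    (ho : g =o[𝓝[>] 0] fun t => t ^ 2) {t : ℝ} (ht : t ∈ Ioc 0 (8 * t₀)) :
    |g t| ≤ A * (t ^ 2 * √t) := by
  have hdil : ∀ c : ℝ, 0 < c → (fun t => g (c * t)) =o[𝓝[>] 0] fun t => t ^ 2 := by
    intro c hc
    have hs : Tendsto (fun t => c * t) (𝓝[>] 0) (𝓝[>] 0) := by
      refine tendsto_nhdsWithin_iff.2 ⟨?_, ?_⟩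
      · have : Tendsto (fun t => c * t) (𝓝 0) (𝓝 (c * 0)) := tendsto_id.const_mul c
        rw [mul_zero] at this
        exact this.mono_left nhdsWithin_le_nhds
      · filter_upwards [self_mem_nhdsWithin] with t ht using mul_pos hc ht
    refine (ho.comp_tendsto hs).trans_isBigO (.of_bound (c ^ 2) (.of_forall fun t => ?_))
    simp [mul_pow]
  refine dyadic_step (j := 0) (by norm_num) (t₀ := 4 * t₀) hA (fun t ht => ?_) ho
    ⟨ht.1, by linarith [ht.2]⟩
  have e1 : |(fun t => g (2 * t) - g t) t| ≤ A * (t ^ 2 * √t) := by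
    refine dyadic_step (j := 1) (by norm_num) (t₀ := 2 * t₀) hA (fun t ht => ?_)
      ((hdil 2 two_pos).sub ho) ⟨ht.1, by linarith [ht.2]⟩
    have e2 : |(fun t => g (4 * t) - 3 * g (2 * t) + 2 * g t) t| ≤ A * (t ^ 2 * √t) := by
      refine dyadic_step (j := 2) le_rfl (t₀ := t₀) hA (fun t ht => ?_)
        (((hdil 4 (by norm_num)).sub ((hdil 2 two_pos).const_mul_left 3)).add
          (ho.const_mul_left 2)) ht
      refine le_of_eq_of_le ?_ (h t ht)
      congr 1
      ring_nf
    refine le_of_eq_of_le ?_ e2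
    congr 1
    ring_nf
  simpa using e1

theorem sub_le_sub_of_deriv_le {f f' g g' : ℝ → ℝ} {a b : ℝ} (hab : a ≤ b)
    (hf : ContinuousOn f (Icc a b)) (hg : ContinuousOn g (Icc a b))
    (hf' : ∀ t ∈ Ioo a b, HasDerivAt f (f' t) t) (hg' : ∀ t ∈ Ioo a b, HasDerivAt g (g' t) t)
    (h : ∀ t ∈ Ioo a b, f' t ≤ g' t) : f b - f a ≤ g b - g a := by
  have h1 : MonotoneOn (fun t => g t - f t) (Icc a b) := by
    refine monotoneOn_of_deriv_nonneg (convex_Icc a b) (hg.sub hf) (fun t ht => ?_) fun t ht => ?_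
    · rw [interior_Icc] at ht
      exact ((hg' t ht).sub (hf' t ht)).differentiableAt.differentiableWithinAt
    · rw [interior_Icc] at ht
      rw [((hg' t ht).fun_sub (hf' t ht)).deriv]
      exact sub_nonneg.2 (h t ht)
  have := h1 ⟨le_rfl, hab⟩ ⟨hab, le_rfl⟩ hab
  simp only at this
  linarith

theorem abs_sub_le_of_abs_deriv_le {f f' g g' : ℝ → ℝ} {a b : ℝ} (hab : a ≤ b)
    (hf : ContinuousOn f (Icc a b)) (hg : ContinuousOn g (Icc a b))
    (hf' : ∀ t ∈ Ioo a b, HasDerivAt f (f' t) t) (hg' : ∀ t ∈ Ioo a b, HasDerivAt g (g' t) t)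
    (h : ∀ t ∈ Ioo a b, |f' t| ≤ g' t) : |f b - f a| ≤ g b - g a := by
  rw [abs_le']
  refine ⟨sub_le_sub_of_deriv_le hab hf hg hf' hg' fun t ht => (le_abs_self _).trans (h t ht), ?_⟩
  have := sub_le_sub_of_deriv_le hab hf.neg hg (fun t ht => (hf' t ht).neg) hg'
    fun t ht => (neg_le_abs _).trans (h t ht)
  simp only [Pi.neg_apply] at this
  linarith

/-- The combination of dyadic values annihilating quadratic polynomials. -/
def dyadicDiff {N : ℕ} (g : Euc N → ℝ) (y : Euc N) : ℝ :=
  g ((8 : ℝ) • y) - 7 * g ((4 : ℝ) • y) + 14 * g ((2 : ℝ) • y) - 8 * g y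

theorem integral_dyadic {N : ℕ} {f₁ f₂ f₃ f₄ : Euc N → ℝ} (h₁ : Integrable f₁)
    (h₂ : Integrable f₂) (h₃ : Integrable f₃) (h₄ : Integrable f₄) :
    (∫ z, f₁ z) - 7 * (∫ z, f₂ z) + 14 * (∫ z, f₃ z) - 8 * (∫ z, f₄ z) =
      ∫ z, (f₁ z - 7 * f₂ z + 14 * f₃ z - 8 * f₄ z) := by
  rw [integral_sub (by fun_prop) (by fun_prop), integral_add (by fun_prop) (by fun_prop),
    integral_sub (by fun_prop) (by fun_prop)]
  simp only [integral_const_mul]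

theorem abs_dyadicDiff_mollify_le {N : ℕ} {g G : Euc N → ℝ} {C m t : ℝ} {y : Euc N}
    (hg1 : ∀ z, 1 ≤ ‖z‖ → g z = 0)
    (hC : ∀ a y : Euc N, |g (a + (8 : ℝ) • y) - 7 * g (a + (4 : ℝ) • y) +
      14 * g (a + (2 : ℝ) • y) - 8 * g (a + y)| ≤ C * ‖y‖ ^ 3)
    (hi : ∀ x : Euc N, Integrable fun z => G (x - t • z) * g z) (ht : 0 < t) (hyt : ‖y‖ ≤ t)
    (hm : 0 ≤ m) (hG : ∀ᵐ u : Euc N, ‖u‖ ≤ 9 * t → |G u| ≤ m) :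
    |dyadicDiff (fun x => ∫ z, G (x - t • z) * g z) y| ≤
      m * (C * (‖y‖ / t) ^ 3) * volume.real (closedBall (0 : Euc N) 9) := by
  have hi' : ∀ c : ℝ, Integrable fun z => G (0 - t • z) * g (z + c • (t⁻¹ • y)) := fun c => by
    have := (hi (c • y)).comp_add_right (c • (t⁻¹ • y))
    refine this.congr (.of_forall fun z => ?_)
    simp only
    congr 2
    rw [smul_add, smul_smul t c, mul_comm t c, ← smul_smul c t, smul_inv_smul₀ ht.ne']
    abel
  have hs : ∀ c : ℝ, ∫ z, G (c • y - t • z) * g z =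
      ∫ z, G (0 - t • z) * g (z + c • (t⁻¹ • y)) := fun c => by
    rw [← integral_add_right_eq_self _ (c • (t⁻¹ • y))]
    refine integral_congr_ae (.of_forall fun z => ?_)
    simp only
    congr 2
    rw [smul_add, smul_smul t c, mul_comm t c, ← smul_smul c t, smul_inv_smul₀ ht.ne']
    abel
  have hs1 := hs 1
  rw [one_smul, one_smul] at hs1
  have hi1 := hi' 1
  rw [one_smul] at hi1
  simp only [dyadicDiff]
  rw [hs 8, hs 4, hs 2, hs1, integral_dyadic (hi' 8) (hi' 4) (hi' 2) hi1]
  have hy' : ‖t⁻¹ • y‖ = ‖y‖ / t := by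
    rw [norm_smul, norm_inv, Real.norm_of_nonneg ht.le, div_eq_inv_mul]
  have hy1 : ‖y‖ / t ≤ 1 := (div_le_one ht).2 hyt
  have hfar : ∀ z : Euc N, 9 ≤ ‖z‖ → ∀ c : ℝ, 0 ≤ c → c ≤ 8 → g (z + c • (t⁻¹ • y)) = 0 := by
    intro z hz c hc hc8
    apply hg1
    have h1 := norm_sub_norm_le z (-(c • (t⁻¹ • y)))
    rw [sub_neg_eq_add, norm_neg, norm_smul, hy', Real.norm_of_nonneg hc] at h1
    nlinarith [norm_nonneg y, div_nonneg (norm_nonneg y) ht.le]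
  have hfar1 : ∀ z : Euc N, 9 ≤ ‖z‖ → g (z + t⁻¹ • y) = 0 := fun z hz => by
    have := hfar z hz 1 zero_le_one (by norm_num)
    rwa [one_smul] at this
  rw [← setIntegral_eq_integral_of_forall_compl_eq_zero (s := closedBall (0 : Euc N) 9)]
  · rw [← Real.norm_eq_abs]
    refine norm_setIntegral_le_of_norm_le_const_ae measure_closedBall_lt_top ?_
    rw [ae_restrict_iff' measurableSet_closedBall]
    filter_upwards [(quasiMeasurePreserving_sub_smul (0 : Euc N) ht.ne').ae hG] with z hz hz9
    rw [mem_closedBall, dist_zero_right] at hz9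
    have h1 : |G (0 - t • z)| ≤ m := hz (by
      rw [zero_sub, norm_neg, norm_smul, Real.norm_of_nonneg ht.le]
      nlinarith)
    have h2 := hC z (t⁻¹ • y)
    rw [hy'] at h2
    rw [show ∀ a b c d e : ℝ, a * b - 7 * (a * c) + 14 * (a * d) - 8 * (a * e) =
      a * (b - 7 * c + 14 * d - 8 * e) from fun a b c d e => by ring, norm_mul]
    exact mul_le_mul h1 h2 (norm_nonneg _) hm
  · intro z hz
    rw [mem_closedBall, dist_zero_right, not_le] at hz
    rw [hfar z hz.le 8 (by norm_num) le_rfl, hfar z hz.le 4 (by norm_num) (by norm_num),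
      hfar z hz.le 2 (by norm_num) (by norm_num), hfar1 z hz.le]
    simp

theorem schauder_dyadic (N : ℕ) [NeZero N] : ∃ C, 0 ≤ C ∧ ∀ (w : Euc N → ℝ) (L : ℝ≥0) (R A M : ℝ),
    Differentiable ℝ w → LipschitzWith L (fderiv ℝ w) → 0 < R → 0 ≤ A → 0 ≤ M →
    (∀ᵐ y : Euc N, ‖y‖ < R → |lap w y| ≤ A * √‖y‖) → (∀ y, ‖y‖ < R → |w y| ≤ M) →
    ∀ y, y ≠ 0 → ‖y‖ ≤ R / 16 →
      |dyadicDiff w y| ≤ C * (A + M / (R ^ 2 * √R)) * (‖y‖ ^ 2 * √‖y‖) := by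
  obtain ⟨k⟩ := nonempty_radialKernel N
  obtain ⟨C₁, hC₁, hK⟩ := abs_third_difference_le k.contDiff_K k.hasCompactSupport_K
  obtain ⟨C₂, hC₂, hη⟩ := abs_third_difference_le k.contDiff_η k.hasCompactSupport_η
  set V := volume.real (closedBall (0 : Euc N) 9) with hV
  have hV0 : 0 ≤ V := measureReal_nonneg
  set κ := ∫ z, k.K z with hκ
  have hκ0 : 0 ≤ κ := integral_nonneg k.K_nonneg
  refine ⟨90 * κ + 6 * C₁ * V + 1024 * C₂ * V, by positivity,
    fun w L R A M hw hL hR hA hM hlap hsup y hy0 hyR => ?_⟩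
  set n := ‖y‖ with hn
  have hn0 : 0 < n := norm_pos_iff.2 hy0
  set H := R / 16 with hH
  have hH0 : 0 < H := by positivity
  set D : ℝ → ℝ := fun t => dyadicDiff (fun x => ∫ z, w (x - t • z) * k.η z) y with hD
  set D' : ℝ → ℝ := fun t => t * dyadicDiff (fun x => ∫ z, lap w (x - t • z) * k.K z) y with hD'
  have hder : ∀ t : ℝ, t ≠ 0 → HasDerivAt D (D' t) t := by
    intro t ht
    have h := fun x => k.hasDerivAt_mollify hw hL x ht
    refine ((((h _).sub ((h _).const_mul 7)).add ((h _).const_mul 14)).sub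
      ((h _).const_mul 8)).congr_deriv ?_
    simp only [hD', dyadicDiff]
    ring
  have hcont : Continuous D := by
    refine continuous_iff_continuousAt.2 fun t => ?_
    have h := fun x => (k.hasDerivAt_integral hw hL x t).continuousAt
    exact (((h _).sub ((h _).const_mul 7)).add ((h _).const_mul 14)).sub ((h _).const_mul 8)
  have hD0 : D 0 = dyadicDiff w y := by
    simp only [hD, dyadicDiff, zero_smul, sub_zero, integral_const_mul, k.integral_η, mul_one]
  have hlap1 : ∀ s, 9 * s < R → ∀ᵐ u : Euc N, ‖u‖ ≤ 9 * s → |lap w u| ≤ A * (3 * √s) := by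
    intro s hs
    filter_upwards [hlap] with u hu hus
    refine (hu (by linarith)).trans (mul_le_mul_of_nonneg_left ?_ hA)
    rw [show 3 * √s = √(9 * s) by
      rw [Real.sqrt_mul (by norm_num), show (9 : ℝ) = 3 ^ 2 by norm_num, Real.sqrt_sq (by norm_num)]]
    exact Real.sqrt_le_sqrt hus
  -- small scales
  have hI : ∀ t, 0 < t → t ≤ n → ∀ c : ℝ, 0 ≤ c → c ≤ 8 →
      |∫ z, lap w (c • y - t • z) * k.K z| ≤ A * (3 * √n) * κ := by
    intro t ht htn c hc hc8
    rw [← Real.norm_eq_abs, hκ, ← integral_const_mul]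
    refine norm_integral_le_of_norm_le (k.integrable_K.const_mul _) ?_
    filter_upwards [(quasiMeasurePreserving_sub_smul (c • y) ht.ne').ae (hlap1 n (by linarith))]
      with z hz
    rcases le_total 1 ‖z‖ with h1 | h1
    · simp [k.K_eq_zero z h1]
    · rw [norm_mul, Real.norm_of_nonneg (k.K_nonneg z)]
      refine mul_le_mul_of_nonneg_right (hz ?_) (k.K_nonneg z)
      refine (norm_sub_le _ _).trans ?_
      rw [norm_smul, norm_smul, Real.norm_of_nonneg hc, Real.norm_of_nonneg ht.le]
      nlinarith [norm_nonneg z]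
  have hsmall : |D n - D 0| ≤ 90 * κ * A * (n ^ 2 * √n) := by
    have h := abs_sub_le_of_abs_deriv_le (f := D) (f' := D') (a := 0) (b := n)
      (g := fun t => 90 * κ * A * n * √n * t) (g' := fun t => 90 * κ * A * n * √n)
      hn0.le hcont.continuousOn (by fun_prop) (fun t ht => hder t ht.1.ne')
      (fun t ht => by simpa using (hasDerivAt_id t).const_mul (90 * κ * A * n * √n))
      (fun t ht => ?_)
    · refine h.trans_eq ?_
      ring
    · have h8 := abs_le.1 (hI t ht.1 ht.2.le 8 (by norm_num) le_rfl)
      have h4 := abs_le.1 (hI t ht.1 ht.2.le 4 (by norm_num) (by norm_num))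
      have h2 := abs_le.1 (hI t ht.1 ht.2.le 2 (by norm_num) (by norm_num))
      have h1 := abs_le.1 (hI t ht.1 ht.2.le 1 (by norm_num) (by norm_num))
      rw [one_smul] at h1
      have hb : |dyadicDiff (fun x => ∫ z, lap w (x - t • z) * k.K z) y| ≤
          30 * (A * (3 * √n) * κ) := by
        simp only [dyadicDiff]
        rw [abs_le]
        constructor <;> linarith [h8.1, h8.2, h4.1, h4.2, h2.1, h2.2, h1.1, h1.2]
      simp only [hD']
      rw [abs_mul, abs_of_pos ht.1]
      calc t * |dyadicDiff (fun x => ∫ z, lap w (x - t • z) * k.K z) y|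
          ≤ n * (30 * (A * (3 * √n) * κ)) := by
            have := ht.2.le
            gcongr
        _ = _ := by ring
  have hlarge : |D H - D n| ≤ 6 * C₁ * V * A * (n ^ 2 * √n) := by
    have hpos : ∀ t ∈ Icc n H, 0 < t := fun t ht => hn0.trans_le ht.1
    have h := abs_sub_le_of_abs_deriv_le (f := D) (f' := D') (a := n) (b := H)
      (g := fun t => -(6 * C₁ * V * A * n ^ 3) * (√t)⁻¹)
      (g' := fun t => -(6 * C₁ * V * A * n ^ 3) * (-(1 / (2 * √t)) / (√t) ^ 2))
      hyR hcont.continuousOn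
      (continuousOn_const.mul (Real.continuous_sqrt.continuousOn.inv₀
        fun t ht => (Real.sqrt_pos.2 (hpos t ht)).ne'))
      (fun t ht => hder t (hpos t (Ioo_subset_Icc_self ht)).ne')
      (fun t ht => ((Real.hasDerivAt_sqrt (hpos t (Ioo_subset_Icc_self ht)).ne').fun_inv
        (Real.sqrt_pos.2 (hpos t (Ioo_subset_Icc_self ht))).ne').const_mul _)
      (fun t ht => ?_)
    · refine h.trans ?_
      have h1 : n ^ 3 * (√n)⁻¹ = n ^ 2 * √n := by
        have := Real.mul_self_sqrt hn0.le
        have h2 := Real.sqrt_pos.2 hn0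
        field_simp
        nlinarith
      have h3 : 0 ≤ 6 * C₁ * V * A * n ^ 3 * (√H)⁻¹ := by positivity
      calc _ = 6 * C₁ * V * A * (n ^ 3 * (√n)⁻¹) - 6 * C₁ * V * A * n ^ 3 * (√H)⁻¹ := by ring
        _ ≤ _ := by rw [h1]; linarith
    · have ht0 := hpos t (Ioo_subset_Icc_self ht)
      have h1 := abs_dyadicDiff_mollify_le (G := lap w) (t := t) (y := y) k.K_eq_zero hK
        (fun x => integrable_lap_mul hL k.integrable_K x t) ht0 ht.1.le
        (m := A * (3 * √t)) (by positivity) (hlap1 t (by linarith [ht.2]))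
      simp only [hD']
      rw [abs_mul, abs_of_pos ht0]
      refine (mul_le_mul_of_nonneg_left h1 ht0.le).trans_eq ?_
      rw [← hn, ← hV]
      have h4 := Real.sq_sqrt ht0.le
      have h5 := Real.sqrt_pos.2 ht0
      set r := √t
      rw [← h4]
      field_simp
      ring
  have hend : |D H| ≤ 1024 * C₂ * V * (M / (R ^ 2 * √R)) * (n ^ 2 * √n) := by
    have h1 := abs_dyadicDiff_mollify_le (G := w) (t := H) (y := y) k.η_eq_zero hη
      (fun x => integrable_comp_mul hw.continuous k.contDiff_η.continuous k.hasCompactSupport_η x H)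
      hH0 hyR hM (.of_forall fun u hu => hsup u (by linarith))
    refine h1.trans ?_
    rw [← hn, ← hV]
    have h2 : (n / H) ^ 3 ≤ 1024 * (n ^ 2 * √n) / (R ^ 2 * √R) := by
      have h3 : n / H ≤ √(n / H) := by
        have : n / H ≤ 1 := (div_le_one hH0).2 hyR
        refine Real.le_sqrt_of_sq_le ?_
        have : 0 ≤ n / H := by positivity
        nlinarith
      have h4 : √(n / H) = 4 * √n / √R := by
        rw [hH, Real.sqrt_div hn0.le, Real.sqrt_div hR.le, show (16 : ℝ) = 4 ^ 2 by norm_num,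
          Real.sqrt_sq (by norm_num)]
        field_simp
      calc (n / H) ^ 3 = (n / H) ^ 2 * (n / H) := by ring
        _ ≤ (n / H) ^ 2 * (4 * √n / √R) := by rw [← h4]; gcongr
        _ = _ := by rw [hH]; field_simp; norm_num
    calc M * (C₂ * (n / H) ^ 3) * V ≤ M * (C₂ * (1024 * (n ^ 2 * √n) / (R ^ 2 * √R))) * V := by
          gcongr
      _ = _ := by ring
  rw [← hD0]
  have hQ : 0 ≤ M / (R ^ 2 * √R) := by positivity
  have hq : 0 ≤ n ^ 2 * √n := by positivity
  set q := n ^ 2 * √n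
  set Q := M / (R ^ 2 * √R)
  have e1 := abs_le.1 hsmall
  have e2 := abs_le.1 hlarge
  have e3 := abs_le.1 hend
  have p1 : 0 ≤ 90 * κ * Q * q := by positivity
  have p2 : 0 ≤ 6 * C₁ * V * Q * q := by positivity
  have p3 : 0 ≤ 1024 * C₂ * V * A * q := by positivity
  rw [abs_le]
  constructor <;> linarith [e1.1, e1.2, e2.1, e2.2, e3.1, e3.2]

/-- Pointwise second order Schauder estimate at the origin, with the Laplacian controlled by a
square root. -/
theorem pointwise_schauder (N : ℕ) [NeZero N] : ∃ C, 0 ≤ C ∧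
    ∀ (w T : Euc N → ℝ) (L : ℝ≥0) (R A M : ℝ),
    Differentiable ℝ w → LipschitzWith L (fderiv ℝ w) → 0 < R → 0 ≤ A → 0 ≤ M →
    (∀ᵐ y : Euc N, ‖y‖ < R → |lap w y| ≤ A * √‖y‖) → (∀ y, ‖y‖ < R → |w y| ≤ M) →
    (∀ y, dyadicDiff T y = 0) →
    (∀ h : Euc N, (fun t : ℝ => w (t • h) - T (t • h)) =o[𝓝[>] 0] fun t => t ^ 2) →
    ∀ y, y ≠ 0 → ‖y‖ ≤ R / 2 →
      |w y - T y| ≤ C * (A + M / (R ^ 2 * √R)) * (‖y‖ ^ 2 * √‖y‖) := by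
  obtain ⟨C, hC, h⟩ := schauder_dyadic N
  refine ⟨C, hC, fun w T L R A M hw hL hR hA hM hlap hsup hT ho y hy hyR => ?_⟩
  have hn : 0 < ‖y‖ := norm_pos_iff.2 hy
  set e : Euc N := ‖y‖⁻¹ • y with he
  have hne : ‖e‖ = 1 := by rw [he, norm_smul, norm_inv, norm_norm, inv_mul_cancel₀ hn.ne']
  have key := abs_le_of_dyadic_difference (g := fun t : ℝ => w (t • e) - T (t • e))
    (A := C * (A + M / (R ^ 2 * √R))) (t₀ := R / 16) (by positivity) (fun t ht => ?_) (ho e)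
    (t := ‖y‖) ⟨hn, by linarith⟩
  · have : ‖y‖ • e = y := smul_inv_smul₀ hn.ne' y
    simpa only [this] using key
  · have hte : ‖t • e‖ = t := by rw [norm_smul, hne, mul_one, Real.norm_of_nonneg ht.1.le]
    have h1 := h w L R A M hw hL hR hA hM hlap hsup (t • e)
      (norm_pos_iff.1 (by rw [hte]; exact ht.1)) (by rw [hte]; exact ht.2)
    rw [hte] at h1
    have h2 := hT (t • e)
    refine le_of_eq_of_le ?_ h1
    congr 1
    rw [← sub_zero (dyadicDiff w (t • e)), ← h2]
    simp only [dyadicDiff, smul_smul]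
    ring

theorem lap_congr {N : ℕ} {v w : Euc N → ℝ} {x : Euc N} (h : v =ᶠ[𝓝 x] w) : lap v x = lap w x := by
  simp only [lap, h.fderiv.fderiv_eq]

/-- Cutting off a function along a level set on which it vanishes to first order preserves
Lipschitz continuity of the gradient. -/
theorem cut_along_level {N : ℕ} {F q : Euc N → ℝ} (hF : Continuous F) (hq : ContDiff ℝ 2 q)
    (hqc : HasCompactSupport q) (h0 : ∀ x, F x = 0 → q x = 0)
    (h1 : ∀ x, F x = 0 → fderiv ℝ q x = 0) :
    (∀ x, HasFDerivAt (fun x => if 0 < F x then q x else 0)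
      (if 0 < F x then fderiv ℝ q x else 0) x) ∧
    ∃ L, LipschitzWith L (fun x => if 0 < F x then fderiv ℝ q x else 0) := by
  have hqd : Differentiable ℝ q := hq.differentiable (by simp)
  constructor
  · intro x
    rcases lt_trichotomy (F x) 0 with hx | hx | hx
    · rw [if_neg hx.not_gt]
      refine (hasFDerivAt_const (0 : ℝ) x).congr_of_eventuallyEq ?_
      filter_upwards [hF.continuousAt.eventually_lt_const hx] with y hy
      rw [if_neg hy.not_gt]
    · rw [if_neg hx.not_gt]
      have h2 := (hqd x).hasFDerivAt
      rw [h1 x hx] at h2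
      have h3 := hasFDerivAt_iff_isLittleO.1 h2
      refine hasFDerivAt_iff_isLittleO.2 (IsBigO.trans_isLittleO (.of_bound 1 ?_) h3)
      refine .of_forall fun y => ?_
      rw [if_neg hx.not_gt, h0 x hx]
      split_ifs
      · simp
      · simp
    · rw [if_pos hx]
      refine (hqd x).hasFDerivAt.congr_of_eventuallyEq ?_
      filter_upwards [hF.continuousAt.eventually_const_lt hx] with y hy
      rw [if_pos hy]
  · obtain ⟨L, hL⟩ : ∃ L, LipschitzWith L (fderiv ℝ q) :=
      ContDiff.lipschitzWith_of_hasCompactSupport (n := 1) (hqc.fderiv ℝ)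
        (hq.fderiv_right (by norm_num)) (by simp)
    refine ⟨L, LipschitzWith.of_dist_le_mul fun x y => ?_⟩
    have key : ∀ x y : Euc N, 0 < F x → F y ≤ 0 → ‖fderiv ℝ q x‖ ≤ L * dist x y := by
      intro x y hx hy
      have hc : ContinuousOn (fun t : ℝ => F (AffineMap.lineMap x y t)) (Icc 0 1) :=
        (hF.comp AffineMap.lineMap_continuous).continuousOn
      obtain ⟨t, ht, ht0⟩ := intermediate_value_Icc' zero_le_one hc
        (show (0 : ℝ) ∈ _ by simp [hx.le, hy])
      have h2 := hL.dist_le_mul x (AffineMap.lineMap x y t)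
      rw [h1 _ ht0, dist_zero_right, dist_left_lineMap, Real.norm_of_nonneg ht.1] at h2
      exact h2.trans (mul_le_mul_of_nonneg_left (mul_le_of_le_one_left dist_nonneg ht.2) L.2)
    by_cases hx : 0 < F x <;> by_cases hy : 0 < F y
    · simpa only [if_pos hx, if_pos hy] using hL.dist_le_mul x y
    · simpa only [if_pos hx, if_neg hy, dist_zero_right] using key x y hx (not_lt.1 hy)
    · simpa only [if_pos hy, if_neg hx, dist_zero_left, dist_comm x y] using key y x hy (not_lt.1 hx)
    · simp only [if_neg hx, if_neg hy, dist_self]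
      positivity

theorem fderiv_eq_or_eq_zero_of_one_sided {N : ℕ} {F : Euc N → ℝ} {W U : Euc N → Euc N →L[ℝ] ℝ}
    {x e : Euc N} (hF : DifferentiableAt ℝ F x) (hx : F x = 0) (he : 0 < fderiv ℝ F x e)
    (hU : DifferentiableAt ℝ U x) (hWU : ∀ᶠ y in 𝓝 x, F y ≤ 0 → W y = U y) :
    fderiv ℝ W x = fderiv ℝ U x ∨ fderiv ℝ W x = 0 := by
  by_cases hW : DifferentiableAt ℝ W x
  swap
  · exact .inr (fderiv_zero_of_not_differentiableAt hW)
  left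
  have key : ∀ h, fderiv ℝ F x h < 0 → fderiv ℝ W x h = fderiv ℝ U x h := by
    intro h hh
    have hl : HasDerivAt (fun t : ℝ => x + t • h) h 0 := by
      simpa using ((hasDerivAt_id (0 : ℝ)).smul_const h).const_add x
    have hl0 : x + (0 : ℝ) • h = x := by simp
    have hFl := HasFDerivAt.comp_hasDerivAt (0 : ℝ) (by rw [hl0]; exact hF.hasFDerivAt) hl
    have hneg : ∀ᶠ t : ℝ in 𝓝[>] 0, F (x + t • h) < 0 := by
      have h2 := (hasDerivWithinAt_iff_tendsto_slope' (s := Ioi (0 : ℝ)) (by simp)).1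
        hFl.hasDerivWithinAt
      filter_upwards [h2.eventually_lt_const hh, self_mem_nhdsWithin] with t ht ht0
      simp only [slope, Function.comp_apply, hl0, hx, vsub_eq_sub, sub_zero, smul_eq_mul] at ht
      have ht0' : (0 : ℝ) < t := ht0
      by_contra hcon
      exact absurd ht (not_lt.2 (mul_nonneg (inv_nonneg.2 ht0'.le) (not_lt.1 hcon)))
    have hWl := (HasFDerivAt.comp_hasDerivAt (0 : ℝ) (by rw [hl0]; exact hW.hasFDerivAt)
      hl).hasDerivWithinAt (s := Ioi 0)
    have hUl := (HasFDerivAt.comp_hasDerivAt (0 : ℝ) (by rw [hl0]; exact hU.hasFDerivAt)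
      hl).hasDerivWithinAt (s := Ioi 0)
    refine (uniqueDiffWithinAt_Ioi (0 : ℝ)).eq_deriv _ hWl (hUl.congr_of_eventuallyEq ?_ ?_)
    · have : Tendsto (fun t : ℝ => x + t • h) (𝓝[>] 0) (𝓝 x) := by
        have := hl.continuousAt.tendsto
        rw [hl0] at this
        exact this.mono_left nhdsWithin_le_nhds
      filter_upwards [this.eventually hWU, hneg] with t h1 h2 using h1 h2.le
    · simp only [Function.comp_apply, hl0]
      exact hWU.self_of_nhds hx.le
  ext1 v
  set s := (|fderiv ℝ F x v| + 1) / fderiv ℝ F x e with hs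
  have h1 := key (-e) (by rw [map_neg]; linarith)
  have h2 := key (v - s • e) (by
    rw [map_sub, map_smul, smul_eq_mul, hs, div_mul_cancel₀ _ he.ne']
    linarith [le_abs_self (fderiv ℝ F x v)])
  rw [map_neg, map_neg, neg_inj] at h1
  rw [map_sub, map_sub, map_smul, map_smul, h1] at h2
  exact sub_left_inj.1 h2

/-- Quantitative description of `Ω` near the boundary point `z`: `Ω` is the sublevel set of `F`,
and `x ↦ x - β x • e` is a reflection across the boundary, exact to first order. -/
structure BoundaryChart {N : ℕ} (Ω : Set (Euc N)) (z : Euc N) (R C : ℝ) where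
  F : Euc N → ℝ
  β : Euc N → ℝ
  e : Euc N
  contDiff_F : ContDiff ℝ 2 F
  norm_e : ‖e‖ = 1
  F_center : F z = 0
  fderiv_center : ∀ h, fderiv ℝ F z h = ⟪e, h⟫_ℝ
  le_fderiv_e : ∀ x ∈ ball z R, 3 / 4 ≤ fderiv ℝ F x e
  norm_fderiv_le : ∀ x ∈ ball z R, ‖fderiv ℝ F x‖ ≤ 5 / 4
  norm_fderiv_fderiv_le : ∀ x ∈ ball z R, ‖fderiv ℝ (fderiv ℝ F) x‖ ≤ C
  norm_fderiv_fderiv_sub_le : ∀ x ∈ ball z R,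
    ‖fderiv ℝ (fderiv ℝ F) x - fderiv ℝ (fderiv ℝ F) z‖ ≤ C * ‖x - z‖
  mem_iff : ∀ x ∈ ball z R, x ∈ Ω ↔ F x < 0
  contDiffAt_β : ∀ x ∈ ball z R, ContDiffAt ℝ 2 β x
  β_mul : ∀ x ∈ ball z R, β x * fderiv ℝ F x e = 2 * F x
  norm_fderiv_β_sub_le : ∀ x ∈ ball z R, ‖fderiv ℝ β x - (2 : ℝ) • innerSL ℝ e‖ ≤ C * ‖x - z‖
  norm_fderiv_fderiv_β_le : ∀ x ∈ ball z R, ‖fderiv ℝ (fderiv ℝ β) x‖ ≤ C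

namespace BoundaryChart

variable {N : ℕ} {Ω : Set (Euc N)} {z : Euc N} {R C : ℝ} (c : BoundaryChart Ω z R C)

include c

theorem differentiable_F : Differentiable ℝ c.F := c.contDiff_F.differentiable (by simp)

theorem add_le_F {p : Euc N} {s : ℝ} (hs : 0 ≤ s) (hp : p ∈ ball z R) (hps : p + s • c.e ∈ ball z R) :
    c.F p + 3 / 4 * s ≤ c.F (p + s • c.e) := by
  have hl : ∀ t : ℝ, HasDerivAt (fun t : ℝ => p + t • c.e) c.e t := fun t => by
    simpa using ((hasDerivAt_id t).smul_const c.e).const_add p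
  have hd : ∀ t : ℝ, HasDerivAt (fun t : ℝ => c.F (p + t • c.e)) (fderiv ℝ c.F (p + t • c.e) c.e) t :=
    fun t => (c.differentiable_F _).hasFDerivAt.comp_hasDerivAt t (hl t)
  have h := sub_le_sub_of_deriv_le (f := fun t => 3 / 4 * t) (f' := fun _ => 3 / 4)
    (g := fun t => c.F (p + t • c.e)) (g' := fun t => fderiv ℝ c.F (p + t • c.e) c.e) hs
    (by fun_prop) (fun t _ => (hd t).continuousAt.continuousWithinAt)
    (fun t _ => by simpa using (hasDerivAt_id t).const_mul (3 / 4 : ℝ)) (fun t _ => hd t)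
    (fun t ht => c.le_fderiv_e _ ?_)
  · simp only [mul_zero, sub_zero, zero_smul, add_zero] at h
    linarith
  · have h1 : p + t • c.e ∈ segment ℝ p (p + s • c.e) := by
      rw [segment_eq_image']
      have hs' : 0 < s := ht.1.trans ht.2
      refine ⟨t / s, ⟨div_nonneg ht.1.le hs, (div_le_one hs').2 ht.2.le⟩, ?_⟩
      simp only [add_sub_cancel_left, smul_smul]
      rw [div_mul_cancel₀ _ hs'.ne']
    exact (convex_ball z R).segment_subset hp hps h1

theorem abs_F_sub_le {x y : Euc N} (hx : x ∈ ball z R) (hy : y ∈ ball z R) :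
    |c.F x - c.F y| ≤ 5 / 4 * ‖x - y‖ :=
  (convex_ball z R).norm_image_sub_le_of_norm_fderiv_le (fun x _ => c.differentiable_F x)
    c.norm_fderiv_le hy hx

theorem mem_closure {x : Euc N} (hx : x ∈ ball z R) (hF : c.F x ≤ 0) : x ∈ closure Ω := by
  have ht : Tendsto (fun t : ℝ => x - t • c.e) (𝓝[>] 0) (𝓝 x) := by
    have : Continuous fun t : ℝ => x - t • c.e := by fun_prop
    have := this.tendsto 0
    rw [zero_smul, sub_zero] at this
    exact this.mono_left nhdsWithin_le_nhds
  refine mem_closure_of_tendsto ht ?_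
  filter_upwards [ht.eventually (isOpen_ball.mem_nhds hx), self_mem_nhdsWithin] with t h1 h2
  have h2' : (0 : ℝ) < t := h2
  rw [c.mem_iff _ h1]
  have := c.add_le_F h2'.le h1 (by rwa [sub_add_cancel])
  rw [sub_add_cancel] at this
  linarith

theorem mem_frontier (hΩ : IsOpen Ω) {x : Euc N} (hx : x ∈ ball z R) (hF : c.F x = 0) :
    x ∈ frontier Ω := by
  rw [hΩ.frontier_eq]
  exact ⟨c.mem_closure hx hF.le, fun h => by
    have := (c.mem_iff x hx).1 h
    linarith⟩

theorem abs_F_le {x : Euc N} (hx : x ∈ ball z R) : |c.F x| ≤ 5 / 4 * ‖x - z‖ := by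
  have h := c.abs_F_sub_le hx (y := z) (mem_ball_self (pos_of_mem_ball hx))
  rwa [c.F_center, sub_zero] at h

theorem abs_β_le {x : Euc N} (hx : x ∈ ball z R) : |c.β x| ≤ 8 / 3 * |c.F x| := by
  have h1 := c.β_mul x hx
  have h2 := c.le_fderiv_e x hx
  have h3 : |c.β x| * fderiv ℝ c.F x c.e = 2 * |c.F x| := by
    rw [← abs_of_nonneg (a := fderiv ℝ c.F x c.e) (by linarith), ← abs_mul, h1, abs_mul,
      abs_two]
  nlinarith [abs_nonneg (c.β x)]

theorem norm_reflect_sub_le {x : Euc N} (hx : x ∈ ball z R) :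
    ‖x - c.β x • c.e - z‖ ≤ 5 * ‖x - z‖ := by
  have h1 := c.abs_β_le hx
  have h2 := c.abs_F_le hx
  rw [sub_right_comm]
  refine (norm_sub_le _ _).trans ?_
  rw [norm_smul, c.norm_e, mul_one, Real.norm_eq_abs]
  linarith [norm_nonneg (x - z)]

theorem reflect_mem_ball {x : Euc N} (hx : ‖x - z‖ < R / 5) : x - c.β x • c.e ∈ ball z R := by
  have hx' : x ∈ ball z R := by
    rw [mem_ball, dist_eq_norm]
    linarith [norm_nonneg (x - z)]
  have := c.norm_reflect_sub_le hx'
  rw [mem_ball, dist_eq_norm]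
  linarith

theorem F_reflect_neg {x : Euc N} (hx : ‖x - z‖ < R / 5) (hF : 0 < c.F x) :
    c.F (x - c.β x • c.e) < 0 := by
  have hx' : x ∈ ball z R := by
    rw [mem_ball, dist_eq_norm]
    linarith [norm_nonneg (x - z)]
  have h1 := c.β_mul x hx'
  have h2 := c.le_fderiv_e x hx'
  have h3 : fderiv ℝ c.F x c.e ≤ 5 / 4 := by
    have := (fderiv ℝ c.F x).le_opNorm c.e
    rw [c.norm_e, mul_one] at this
    exact (le_abs_self _).trans (this.trans (c.norm_fderiv_le x hx'))
  have hβ : 0 < c.β x := by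
    by_contra hcon
    nlinarith
  have h4 := c.add_le_F hβ.le (c.reflect_mem_ball hx) (by rwa [sub_add_cancel])
  rw [sub_add_cancel] at h4
  nlinarith

/-- Points of `Ω` near the boundary are joined to the center by short paths in `Ω`. -/
theorem norm_sub_center_le {G : Type*} [NormedAddCommGroup G] [NormedSpace ℝ G] {V : Euc N → G}
    (hV : Differentiable ℝ V) {K : ℝ} (hK : ∀ x ∈ ball z R, c.F x ≤ 0 → ‖fderiv ℝ V x‖ ≤ K)
    {x : Euc N} (hx : ‖x - z‖ < R / 4) (hF : c.F x ≤ 0) : ‖V x - V z‖ ≤ 5 * K * ‖x - z‖ := by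
  set n := ‖x - z‖ with hn
  have hn0 : 0 ≤ n := norm_nonneg _
  have hR : 0 < R := by linarith
  set s := 2 * n with hs
  have hball : ∀ y : Euc N, ‖y - z‖ ≤ n → ∀ t : ℝ, 0 ≤ t → t ≤ s → y - t • c.e ∈ ball z R := by
    intro y hy t ht hts
    rw [mem_ball, dist_eq_norm, sub_right_comm]
    refine (norm_sub_le _ _).trans_lt ?_
    rw [norm_smul, c.norm_e, mul_one, Real.norm_of_nonneg ht]
    linarith
  have hdown : ∀ y : Euc N, ‖y - z‖ ≤ n → ∀ t : ℝ, 0 ≤ t → t ≤ s →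
      c.F (y - t • c.e) ≤ c.F y - 3 / 4 * t := by
    intro y hy t ht hts
    have h0 := hball y hy 0 le_rfl (by positivity)
    rw [zero_smul, sub_zero] at h0
    have := c.add_le_F ht (hball y hy t ht hts) (by rwa [sub_add_cancel])
    rw [sub_add_cancel] at this
    linarith
  have hseg : ∀ a b : Euc N, (∀ y ∈ segment ℝ a b, y ∈ ball z R ∧ c.F y ≤ 0) →
      ‖V b - V a‖ ≤ K * ‖b - a‖ := fun a b hab =>
    (convex_segment a b).norm_image_sub_le_of_norm_fderiv_le (fun y _ => hV y)
      (fun y hy => hK y (hab y hy).1 (hab y hy).2) (left_mem_segment ℝ a b) (right_mem_segment ℝ a b)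
  have hvert : ∀ y : Euc N, ‖y - z‖ ≤ n → c.F y ≤ 0 → ‖V (y - s • c.e) - V y‖ ≤ K * s := by
    intro y hy hFy
    have h := hseg y (y - s • c.e) fun p hp => ?_
    · rwa [sub_sub_cancel_left, norm_neg, norm_smul, c.norm_e, mul_one,
        Real.norm_of_nonneg (by positivity)] at h
    · rw [segment_eq_image'] at hp
      obtain ⟨θ, hθ, rfl⟩ := hp
      have h1 : 0 ≤ θ * s := mul_nonneg hθ.1 (by positivity)
      have h2 : θ * s ≤ s := mul_le_of_le_one_left (by positivity) hθ.2
      have h3 : y + θ • (y - s • c.e - y) = y - (θ * s) • c.e := by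
        rw [sub_sub_cancel_left, smul_neg, smul_smul, sub_eq_add_neg]
      simp only [h3]
      exact ⟨hball y hy _ h1 h2, (hdown y hy _ h1 h2).trans (by linarith)⟩
  have hz0 : ‖z - z‖ ≤ n := by simpa using hn0
  have e1 := hvert z hz0 c.F_center.le
  have e3 := hvert x le_rfl hF
  have e2 := hseg (z - s • c.e) (x - s • c.e) fun p hp => by
    rw [segment_eq_image'] at hp
    obtain ⟨θ, hθ, rfl⟩ := hp
    have h3 : z - s • c.e + θ • (x - s • c.e - (z - s • c.e)) = z + θ • (x - z) - s • c.e := by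
      rw [sub_sub_sub_cancel_right]
      abel
    have h4 : ‖z + θ • (x - z) - z‖ ≤ n := by
      rw [add_sub_cancel_left, norm_smul, Real.norm_of_nonneg hθ.1]
      exact mul_le_of_le_one_left hn0 hθ.2
    have h5 : z + θ • (x - z) ∈ ball z R := by
      rw [mem_ball, dist_eq_norm]
      linarith
    simp only [h3]
    refine ⟨hball _ h4 _ (by positivity) le_rfl, (hdown _ h4 s (by positivity) le_rfl).trans ?_⟩
    have := (le_abs_self _).trans (c.abs_F_le h5)
    linarith
  rw [sub_sub_sub_cancel_right] at e2
  rw [norm_sub_rev] at e3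
  calc ‖V x - V z‖ = ‖(V x - V (x - s • c.e)) + (V (x - s • c.e) - V (z - s • c.e)) +
        (V (z - s • c.e) - V z)‖ := by congr 1; abel
    _ ≤ K * s + K * n + K * s := by
      refine (norm_add_le _ _).trans (add_le_add ((norm_add_le _ _).trans (add_le_add e3 e2)) e1)
    _ = 5 * K * n := by rw [hs]; ring

end BoundaryChart

section Lap

variable {N : ℕ}

theorem sum_inner_single_smul (e : Euc N) :
    ∑ i : Fin N, ⟪e, EuclideanSpace.single i 1⟫_ℝ • (EuclideanSpace.single i 1 : Euc N) = e := by
  have := (EuclideanSpace.basisFun (Fin N) ℝ).sum_repr' e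
  simpa [real_inner_comm] using this

theorem sum_inner_single_sq (e : Euc N) :
    ∑ i : Fin N, ⟪e, EuclideanSpace.single i 1⟫_ℝ ^ 2 = ‖e‖ ^ 2 := by
  rw [EuclideanSpace.norm_sq_eq]
  simp [EuclideanSpace.inner_single_right]

theorem abs_sum_apply_single_le {A : Fin N → ℝ} {M : ℝ} (h : ∀ i, |A i| ≤ M) :
    |∑ i, A i| ≤ N * M := by
  refine (Finset.abs_sum_le_sum_abs _ _).trans ((Finset.sum_le_sum fun i _ => h i).trans ?_)
  simp

theorem abs_lap_sub_le (f g : Euc N → ℝ) (x y : Euc N) :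
    |lap f x - lap g y| ≤ N * ‖fderiv ℝ (fderiv ℝ f) x - fderiv ℝ (fderiv ℝ g) y‖ := by
  rw [lap, lap, ← Finset.sum_sub_distrib]
  refine abs_sum_apply_single_le fun i => ?_
  have := (fderiv ℝ (fderiv ℝ f) x - fderiv ℝ (fderiv ℝ g) y).le_opNorm₂
    (EuclideanSpace.single i 1) (EuclideanSpace.single i 1)
  simpa using this

theorem hasFDerivAt_comp_reflect {u β : Euc N → ℝ} {e y : Euc N} (hu : Differentiable ℝ u)
    (hβ : DifferentiableAt ℝ β y) :
    HasFDerivAt (fun y => u (y - β y • e))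
      (fderiv ℝ u (y - β y • e) - fderiv ℝ u (y - β y • e) e • fderiv ℝ β y) y := by
  have h1 : HasFDerivAt (fun y => y - β y • e)
      (ContinuousLinearMap.id ℝ (Euc N) - (fderiv ℝ β y).smulRight e) y :=
    (hasFDerivAt_id y).sub (hβ.hasFDerivAt.smul_const e)
  refine ((hu _).hasFDerivAt.comp y h1).congr_fderiv ?_
  ext h
  simp [mul_comm]

theorem fderiv_fderiv_comp_reflect {u β : Euc N → ℝ} {e x : Euc N} (hu : ContDiff ℝ 2 u)
    (hβ : ContDiffAt ℝ 2 β x) (h : Euc N) :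
    fderiv ℝ (fderiv ℝ fun y => u (y - β y • e)) x h h =
      fderiv ℝ (fderiv ℝ u) (x - β x • e) (h - fderiv ℝ β x h • e) (h - fderiv ℝ β x h • e) -
        fderiv ℝ u (x - β x • e) e * fderiv ℝ (fderiv ℝ β) x h h := by
  have hud : Differentiable ℝ u := hu.differentiable (by simp)
  have hu2 : Differentiable ℝ (fderiv ℝ u) :=
    (hu.fderiv_right (m := 1) (by norm_num)).differentiable (by simp)
  have hβd : DifferentiableAt ℝ β x := hβ.differentiableAt (by simp)
  have hβ2 : DifferentiableAt ℝ (fderiv ℝ β) x :=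
    (hβ.fderiv_right (m := 1) (by norm_num)).differentiableAt (by simp)
  have hev : (fderiv ℝ fun y => u (y - β y • e)) =ᶠ[𝓝 x] fun y =>
      fderiv ℝ u (y - β y • e) - fderiv ℝ u (y - β y • e) e • fderiv ℝ β y := by
    filter_upwards [hβ.eventually (by simp)] with y hy
    exact (hasFDerivAt_comp_reflect hud (hy.differentiableAt (by simp))).fderiv
  have h1 : HasFDerivAt (fun y => y - β y • e)
      (ContinuousLinearMap.id ℝ (Euc N) - (fderiv ℝ β x).smulRight e) x :=
    (hasFDerivAt_id x).sub (hβd.hasFDerivAt.smul_const e)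
  have h2 := (hu2 (x - β x • e)).hasFDerivAt.comp x h1
  have h3 := h2.sub ((h2.clm_apply (hasFDerivAt_const e x)).smul hβ2.hasFDerivAt)
  have h4 : fderiv ℝ (fun y => fderiv ℝ u (y - β y • e) -
      fderiv ℝ u (y - β y • e) e • fderiv ℝ β y) x = _ := h3.fderiv
  rw [hev.fderiv_eq, h4]
  simp
  ring

theorem abs_lap_comp_reflect_sub_le {u β : Euc N → ℝ} {e x : Euc N} (hu : ContDiff ℝ 2 u)
    (hβ : ContDiffAt ℝ 2 β x) (he : ‖e‖ = 1) {b A D C : ℝ}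
    (hb : ‖fderiv ℝ β x - (2 : ℝ) • innerSL ℝ e‖ ≤ b)
    (hA : ‖fderiv ℝ (fderiv ℝ u) (x - β x • e)‖ ≤ A) (hD : ‖fderiv ℝ u (x - β x • e)‖ ≤ D)
    (hC : ‖fderiv ℝ (fderiv ℝ β) x‖ ≤ C) :
    |lap (fun y => u (y - β y • e)) x - lap u (x - β x • e)| ≤
      N * (A * (2 * b + b ^ 2) + D * C) := by
  set B := fderiv ℝ (fderiv ℝ u) (x - β x • e) with hB
  set s : Fin N → Euc N := fun i => EuclideanSpace.single i 1 with hs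
  have hsn : ∀ i, ‖s i‖ = 1 := fun i => by simp [hs]
  have hA0 : 0 ≤ A := le_trans B.opNorm_nonneg hA
  have hb0 : 0 ≤ b := (norm_nonneg _).trans hb
  have hBA : ∀ v w : Euc N, |B v w| ≤ A * (‖v‖ * ‖w‖) := fun v w => by
    have := B.le_opNorm₂ v w
    rw [Real.norm_eq_abs, mul_assoc] at this
    exact this.trans (mul_le_mul_of_nonneg_right hA (by positivity))
  set p : Fin N → ℝ := fun i => ⟪e, s i⟫_ℝ with hp
  set r : Fin N → ℝ := fun i => fderiv ℝ β x (s i) - 2 * p i with hr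
  have hrb : ∀ i, |r i| ≤ b := fun i => by
    have := (fderiv ℝ β x - (2 : ℝ) • innerSL ℝ e).le_opNorm (s i)
    rw [hsn, mul_one] at this
    simpa [hr, hp] using this.trans hb
  have hrefl : ∀ i, ‖s i - (2 * p i) • e‖ = 1 := fun i => by
    have h1 : ‖s i - (2 * p i) • e‖ ^ 2 = 1 ^ 2 := by
      rw [norm_sub_sq_real, hsn, norm_smul, he, inner_smul_right, real_inner_comm, mul_pow,
        Real.norm_eq_abs, sq_abs]
      simp only [hp]
      ring
    exact (sq_eq_sq₀ (norm_nonneg _) zero_le_one).1 h1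
  have htrace : ∑ i, B (s i - (2 * p i) • e) (s i - (2 * p i) • e) = lap u (x - β x • e) := by
    have h1 : ∀ i, B (s i - (2 * p i) • e) (s i - (2 * p i) • e) =
        B (s i) (s i) - 2 * (B (p i • s i) e + B e (p i • s i)) + 4 * (p i ^ 2 * B e e) := by
      intro i
      simp only [map_sub, map_smul, sub_apply, smul_apply, smul_eq_mul]
      ring
    have h2 : ∑ i, p i • s i = e := sum_inner_single_smul e
    have h3 : ∑ i, p i ^ 2 = 1 := by
      have := sum_inner_single_sq e
      rw [he] at this
      simpa [hp, hs] using this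
    simp only [h1]
    rw [Finset.sum_add_distrib, Finset.sum_sub_distrib, ← Finset.mul_sum, ← Finset.mul_sum,
      Finset.sum_add_distrib, ← Finset.sum_mul, ← map_sum, h2, h3]
    have h4 : ∑ i, B (p i • s i) e = B e e := by
      rw [← sum_apply, ← map_sum, h2]
    rw [h4, lap]
    ring
  rw [← htrace, lap, ← Finset.sum_sub_distrib]
  refine abs_sum_apply_single_le fun i => ?_
  rw [fderiv_fderiv_comp_reflect hu hβ, ← hB]
  change |B (s i - fderiv ℝ β x (s i) • e) (s i - fderiv ℝ β x (s i) • e) -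
    fderiv ℝ u (x - β x • e) e * fderiv ℝ (fderiv ℝ β) x (s i) (s i) - _| ≤ _
  have h1 : s i - fderiv ℝ β x (s i) • e = (s i - (2 * p i) • e) - r i • e := by
    rw [hr]
    simp only [sub_smul]
    abel
  rw [h1]
  set v := s i - (2 * p i) • e
  have hv : ‖v‖ = 1 := hrefl i
  have h2 : |B v e| ≤ A := by simpa [hv, he] using hBA v e
  have h3 : |B e v| ≤ A := by simpa [hv, he] using hBA e v
  have h4 : |B e e| ≤ A := by simpa [he] using hBA e e
  have h5 : |fderiv ℝ u (x - β x • e) e| ≤ D := by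
    have := (fderiv ℝ u (x - β x • e)).le_opNorm e
    rw [he, mul_one] at this
    exact this.trans hD
  have h6 : |fderiv ℝ (fderiv ℝ β) x (s i) (s i)| ≤ C := by
    have := (fderiv ℝ (fderiv ℝ β) x).le_opNorm₂ (s i) (s i)
    rw [hsn, mul_one, mul_one] at this
    exact this.trans hC
  have h7 : B (v - r i • e) (v - r i • e) - fderiv ℝ u (x - β x • e) e *
      fderiv ℝ (fderiv ℝ β) x (s i) (s i) - B v v =
      -(r i * B v e) - r i * B e v + r i * (r i * B e e) - fderiv ℝ u (x - β x • e) e *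
      fderiv ℝ (fderiv ℝ β) x (s i) (s i) := by
    simp only [map_sub, map_smul, sub_apply, smul_apply, smul_eq_mul]
    ring
  rw [h7]
  have e1 : |r i * B v e| ≤ b * A := by
    rw [abs_mul]; exact mul_le_mul (hrb i) h2 (abs_nonneg _) hb0
  have e2 : |r i * B e v| ≤ b * A := by
    rw [abs_mul]; exact mul_le_mul (hrb i) h3 (abs_nonneg _) hb0
  have e3 : |r i * (r i * B e e)| ≤ b * (b * A) := by
    rw [abs_mul, abs_mul]
    exact mul_le_mul (hrb i) (mul_le_mul (hrb i) h4 (abs_nonneg _) hb0) (by positivity) hb0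
  have e4 : |fderiv ℝ u (x - β x • e) e * fderiv ℝ (fderiv ℝ β) x (s i) (s i)| ≤ D * C := by
    rw [abs_mul]; exact mul_le_mul h5 h6 (abs_nonneg _) ((norm_nonneg _).trans hD)
  rw [abs_le] at *
  constructor <;> linarith [e1.1, e1.2, e2.1, e2.2, e3.1, e3.2, e4.1, e4.2]

end Lap

theorem abs_apply_apply_le {E : Type*} [NormedAddCommGroup E] [NormedSpace ℝ E]
    {f : E →L[ℝ] E →L[ℝ] ℝ} {b : ℝ} (hf : ‖f‖ ≤ b) (h k : E) : |f h k| ≤ b * ‖h‖ * ‖k‖ :=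
  (f.le_opNorm₂ h k).trans (by gcongr)

theorem abs_apply_le {E : Type*} [NormedAddCommGroup E] [NormedSpace ℝ E]
    {f : E →L[ℝ] ℝ} {b : ℝ} (hf : ‖f‖ ≤ b) (h : E) : |f h| ≤ b * ‖h‖ :=
  f.le_of_opNorm_le hf h

/-- A function vanishing on a regular level set has its derivative parallel to that of the
defining function. -/
theorem fderiv_mul_eq_of_eq_zero_on_level {E : Type*} [NormedAddCommGroup E] [NormedSpace ℝ E]
    [CompleteSpace E] {F φ : E → ℝ} {F' φ' : E →L[ℝ] ℝ} {x : E}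
    (hF : HasStrictFDerivAt F F' x) (hφ : HasStrictFDerivAt φ φ' x)
    (h0 : ∀ᶠ y in 𝓝 x, F y = F x → φ y = 0) (e h : E) : φ' h * F' e = φ' e * F' h := by
  by_cases hF0 : F' = 0
  · simp [hF0]
  have hext : IsLocalExtrOn φ {y | F y = F x} x := by
    left
    have : ∀ᶠ y in 𝓝[{y | F y = F x}] x, φ y = 0 := by
      rw [eventually_nhdsWithin_iff]
      exact h0
    filter_upwards [this] with y hy
    rw [hy, h0.self_of_nhds rfl]
  obtain ⟨a, b, hab, hl⟩ := hext.exists_multipliers_of_hasStrictFDerivAt_1d hF hφ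
  have hb : b ≠ 0 := by
    rintro rfl
    rw [zero_smul, add_zero] at hl
    rcases smul_eq_zero.1 hl with rfl | h
    · exact hab rfl
    · exact hF0 h
  have key : ∀ k, a * F' k + b * φ' k = 0 := fun k => by
    simpa using congrArg (fun L : E →L[ℝ] ℝ => L k) hl
  have h1 := key h
  have h2 := key e
  apply mul_left_cancel₀ hb
  linear_combination F' e * h1 - F' h * h2

namespace BoundaryChart

variable {N : ℕ} {Ω : Set (Euc N)} {z : Euc N} {R C : ℝ} (c : BoundaryChart Ω z R C)

include c

theorem fderiv_mul_of_eq_zero_on_frontier (hΩ : IsOpen Ω) {φ : Euc N → ℝ}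
    (hφ : ∀ x ∈ frontier Ω, φ x = 0) {x : Euc N} (hd : ContDiffAt ℝ 1 φ x) (hx : x ∈ ball z R)
    (hFx : c.F x = 0) (e h : Euc N) :
    fderiv ℝ φ x h * fderiv ℝ c.F x e = fderiv ℝ φ x e * fderiv ℝ c.F x h := by
  refine fderiv_mul_eq_of_eq_zero_on_level
    (c.contDiff_F.contDiffAt.hasStrictFDerivAt (by simp))
    (hd.hasStrictFDerivAt (by simp)) ?_ e h
  filter_upwards [isOpen_ball.mem_nhds hx] with y hy hFy
  exact hφ y (c.mem_frontier hΩ hy (hFy.trans hFx))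

theorem fderiv_center_apply (hΩ : IsOpen Ω) {ψ : Euc N → ℝ} (hψ : ContDiff ℝ 2 ψ)
    (h0 : ∀ x ∈ frontier Ω, ψ x = 0) (hR : 0 < R) (h : Euc N) :
    fderiv ℝ ψ z h = fderiv ℝ ψ z c.e * ⟪c.e, h⟫_ℝ := by
  have := c.fderiv_mul_of_eq_zero_on_frontier hΩ h0 (hψ.of_le (by norm_num)).contDiffAt
    (mem_ball_self hR) c.F_center c.e h
  rwa [c.fderiv_center, c.fderiv_center, real_inner_self_eq_norm_sq, c.norm_e, one_pow,
    mul_one] at this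

theorem fderiv_fderiv_center_apply (hΩ : IsOpen Ω) {ψ : Euc N → ℝ} (hψ : ContDiff ℝ 2 ψ)
    (h0 : ∀ x ∈ frontier Ω, ψ x = 0) (hR : 0 < R) {h k : Euc N} (hh : ⟪c.e, h⟫_ℝ = 0)
    (hk : ⟪c.e, k⟫_ℝ = 0) :
    fderiv ℝ (fderiv ℝ ψ) z k h = fderiv ℝ ψ z c.e * fderiv ℝ (fderiv ℝ c.F) z k h := by
  have hψ1 : ContDiff ℝ 1 (fderiv ℝ ψ) := hψ.fderiv_right (by norm_num)
  have hF1 : ContDiff ℝ 1 (fderiv ℝ c.F) := c.contDiff_F.fderiv_right (by norm_num)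
  set m : Euc N → ℝ := fun x => fderiv ℝ c.F x c.e * fderiv ℝ ψ x h
    - fderiv ℝ ψ x c.e * fderiv ℝ c.F x h with hm
  have hmC : ContDiff ℝ 1 m := by
    rw [hm]
    exact ((hF1.clm_apply contDiff_const).mul (hψ1.clm_apply contDiff_const)).sub
      ((hψ1.clm_apply contDiff_const).mul (hF1.clm_apply contDiff_const))
  have hz : z ∈ ball z R := mem_ball_self hR
  have hd : ∀ {f : Euc N → Euc N →L[ℝ] ℝ}, ContDiff ℝ 1 f → ∀ v, HasFDerivAt (fun x => f x v)
      ((fderiv ℝ f z).flip v) z := fun {f} hf v => by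
    simpa using (hf.differentiable (by simp) z).hasFDerivAt.clm_apply (hasFDerivAt_const v z)
  have hmd := ((hd hF1 c.e).mul (hd hψ1 h)).sub ((hd hψ1 c.e).mul (hd hF1 h))
  have key := fderiv_mul_eq_of_eq_zero_on_level
    (c.contDiff_F.contDiffAt.hasStrictFDerivAt (x := z) (by simp))
    (hmC.contDiffAt.hasStrictFDerivAt (x := z) (by simp)) ?_ c.e k
  · rw [show fderiv ℝ m z = _ from hmd.fderiv] at key
    simp only [c.fderiv_center, real_inner_self_eq_norm_sq, c.norm_e, hk, sub_apply, add_apply,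
      smul_apply, smul_eq_mul, ContinuousLinearMap.flip_apply, hh,
      c.fderiv_center_apply hΩ hψ h0 hR h] at key
    linarith
  · filter_upwards [isOpen_ball.mem_nhds hz] with y hy hFy
    have := c.fderiv_mul_of_eq_zero_on_frontier hΩ h0 (hψ.of_le (by norm_num)).contDiffAt
      hy (hFy.trans c.F_center) c.e h
    simp only [hm]
    linarith

/-- A function vanishing on the zero level of the chart which has the same second order Taylor
polynomial as `ψ` at the center. -/
theorem exists_corrector (hΩ : IsOpen Ω) {ψ : Euc N → ℝ} (hψ : ContDiff ℝ 2 ψ)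
    (h0 : ∀ x ∈ frontier Ω, ψ x = 0) (hR : 0 < R) (hR1 : R ≤ 1) (hC : 1 ≤ C) {K : ℝ}
    (hK₁ : ‖fderiv ℝ ψ z‖ ≤ K) (hK₂ : ‖fderiv ℝ (fderiv ℝ ψ) z‖ ≤ K) :
    ∃ τ : Euc N → ℝ, ContDiff ℝ 2 τ ∧ (∀ x, c.F x = 0 → τ x = 0) ∧
      fderiv ℝ τ z = fderiv ℝ ψ z ∧
      (∀ h, fderiv ℝ (fderiv ℝ τ) z h h = fderiv ℝ (fderiv ℝ ψ) z h h) ∧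
      (∀ x ∈ ball z R, ‖fderiv ℝ (fderiv ℝ τ) x‖ ≤ 12 * C ^ 2 * K) ∧
      (∀ x ∈ ball z R, ‖fderiv ℝ (fderiv ℝ τ) x - fderiv ℝ (fderiv ℝ τ) z‖
        ≤ 12 * C ^ 2 * K * ‖x - z‖) := by
  have hK0 : 0 ≤ K := (norm_nonneg _).trans hK₁
  have hz : z ∈ ball z R := mem_ball_self hR
  set a := fderiv ℝ ψ z c.e with ha
  set B := fderiv ℝ (fderiv ℝ ψ) z - a • fderiv ℝ (fderiv ℝ c.F) z with hB
  set ℓ : Euc N →L[ℝ] ℝ := (1 / 2 : ℝ) • (B.flip c.e + B c.e)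
    - (1 / 2 * B c.e c.e) • innerSL ℝ c.e with hℓ
  set g : Euc N → ℝ := fun x => a + ℓ (x - z) with hg
  have hee : ⟪c.e, c.e⟫_ℝ = 1 := by rw [real_inner_self_eq_norm_sq, c.norm_e, one_pow]
  have haK : |a| ≤ K := by
    have := (fderiv ℝ ψ z).le_opNorm c.e
    rw [c.norm_e, mul_one] at this
    exact this.trans hK₁
  have hBK : ∀ h k, |B h k| ≤ 2 * K * C * ‖h‖ * ‖k‖ := fun h k => by
    have h1 : |fderiv ℝ (fderiv ℝ ψ) z h k| ≤ K * ‖h‖ * ‖k‖ :=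
      abs_apply_apply_le hK₂ h k
    have h2 : |fderiv ℝ (fderiv ℝ c.F) z h k| ≤ C * ‖h‖ * ‖k‖ :=
      abs_apply_apply_le (c.norm_fderiv_fderiv_le z hz) h k
    have h3 : |a| * |fderiv ℝ (fderiv ℝ c.F) z h k| ≤ K * (C * ‖h‖ * ‖k‖) := by gcongr
    have h4 : K * ‖h‖ * ‖k‖ ≤ C * (K * ‖h‖ * ‖k‖) := le_mul_of_one_le_left (by positivity) hC
    rw [hB, sub_apply, sub_apply, smul_apply, smul_apply, smul_eq_mul]
    refine (abs_sub _ _).trans ?_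
    rw [abs_mul]
    linarith
  have hℓa : ∀ h, ℓ h = 1 / 2 * (B h c.e + B c.e h) - 1 / 2 * B c.e c.e * ⟪c.e, h⟫_ℝ := fun h => by
    simp [hℓ]
    ring
  have hℓK : ∀ h, |ℓ h| ≤ 3 * K * C * ‖h‖ := fun h => by
    have h1 := hBK h c.e
    have h2 := hBK c.e h
    have h3 := hBK c.e c.e
    have h4 := abs_real_inner_le_norm c.e h
    rw [c.norm_e] at h1 h2 h3 h4
    have h5 : |B c.e c.e * ⟪c.e, h⟫_ℝ| ≤ (2 * K * C * 1 * 1) * (1 * ‖h‖) := by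
      rw [abs_mul]
      gcongr
    rw [hℓa]
    rw [abs_le] at *
    constructor <;> linarith
  have hBq : ∀ h, B h h = 2 * ⟪c.e, h⟫_ℝ * ℓ h := fun h => by
    set s := ⟪c.e, h⟫_ℝ with hs
    have ht : ⟪c.e, h - s • c.e⟫_ℝ = 0 := by
      rw [inner_sub_right, inner_smul_right, hee, ← hs]
      ring
    have h1 := c.fderiv_fderiv_center_apply hΩ hψ h0 hR ht ht
    have h2 : B (h - s • c.e) (h - s • c.e) = 0 := by
      rw [hB, sub_apply, sub_apply, smul_apply, smul_apply, smul_eq_mul, h1, ha, sub_self]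
    simp only [map_sub, map_smul, sub_apply, smul_apply, smul_eq_mul] at h2
    rw [hℓa, ← hs]
    linear_combination h2
  have hgd : ∀ x, HasFDerivAt g ℓ x := fun x => by
    simpa [hg] using ((ℓ.hasFDerivAt.comp x ((hasFDerivAt_id x).sub_const z)).const_add a)
  have hFd : ∀ x, HasFDerivAt c.F (fderiv ℝ c.F x) x := fun x => (c.differentiable_F x).hasFDerivAt
  have hF1 : ContDiff ℝ 1 (fderiv ℝ c.F) := c.contDiff_F.fderiv_right (by norm_num)
  have hτ1 : ∀ x, HasFDerivAt (fun x => c.F x * g x) (c.F x • ℓ + g x • fderiv ℝ c.F x) x :=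
    fun x => (hFd x).mul (hgd x)
  have hτ1' : fderiv ℝ (fun x => c.F x * g x) = fun x => c.F x • ℓ + g x • fderiv ℝ c.F x :=
    funext fun x => (hτ1 x).fderiv
  have hτ2 : ∀ x h k, fderiv ℝ (fderiv ℝ (fun x => c.F x * g x)) x h k
      = fderiv ℝ c.F x h * ℓ k + ℓ h * fderiv ℝ c.F x k
        + g x * fderiv ℝ (fderiv ℝ c.F) x h k := fun x h k => by
    have := ((hFd x).smul_const ℓ).add ((hgd x).smul (hF1.differentiable (by simp) x).hasFDerivAt)
    rw [hτ1']
    erw [this.fderiv]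
    simp only [add_apply, smul_apply, smul_eq_mul, ContinuousLinearMap.smulRight_apply]
    ring
  have hgz : g z = a := by simp [hg]
  refine ⟨fun x => c.F x * g x, ?_, fun x hx => by simp [hx], ?_, fun h => ?_, fun x hx => ?_,
    fun x hx => ?_⟩
  · exact c.contDiff_F.mul (contDiff_const.add (ℓ.contDiff.comp (contDiff_id.sub contDiff_const)))
  · ext h
    rw [(hτ1 z).fderiv, c.F_center, hgz, zero_smul, zero_add, smul_apply, c.fderiv_center,
      smul_eq_mul, c.fderiv_center_apply hΩ hψ h0 hR h]
  · have h1 := hBq h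
    rw [hB, sub_apply, sub_apply, smul_apply, smul_apply, smul_eq_mul] at h1
    rw [hτ2, hgz, c.fderiv_center]
    linarith
  · have hxz : ‖x - z‖ ≤ 1 := by
      rw [mem_ball, dist_eq_norm] at hx
      linarith
    refine ContinuousLinearMap.opNorm_le_bound₂ _ (by positivity) fun h k => ?_
    have h1 : |fderiv ℝ c.F x h| ≤ 5 / 4 * ‖h‖ :=
      abs_apply_le (c.norm_fderiv_le x hx) h
    have h2 : |fderiv ℝ c.F x k| ≤ 5 / 4 * ‖k‖ :=
      abs_apply_le (c.norm_fderiv_le x hx) k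
    have h3 : |fderiv ℝ (fderiv ℝ c.F) x h k| ≤ C * ‖h‖ * ‖k‖ :=
      abs_apply_apply_le (c.norm_fderiv_fderiv_le x hx) h k
    have h4 : |g x| ≤ K + 3 * K * C * 1 := (abs_add_le _ _).trans (by
      have := hℓK (x - z)
      have h5 : 3 * K * C * ‖x - z‖ ≤ 3 * K * C * 1 := by gcongr
      linarith)
    rw [hτ2, Real.norm_eq_abs]
    calc |fderiv ℝ c.F x h * ℓ k + ℓ h * fderiv ℝ c.F x k + g x * fderiv ℝ (fderiv ℝ c.F) x h k|
        ≤ |fderiv ℝ c.F x h| * |ℓ k| + |ℓ h| * |fderiv ℝ c.F x k|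
          + |g x| * |fderiv ℝ (fderiv ℝ c.F) x h k| := by
          simp only [← abs_mul]
          exact abs_add_three _ _ _
      _ ≤ 5 / 4 * ‖h‖ * (3 * K * C * ‖k‖) + 3 * K * C * ‖h‖ * (5 / 4 * ‖k‖)
          + (K + 3 * K * C * 1) * (C * ‖h‖ * ‖k‖) := by
          gcongr
          · exact hℓK k
          · exact hℓK h
      _ = K * (‖h‖ * ‖k‖) * (15 / 2 * C + C + 3 * C ^ 2) := by ring
      _ ≤ K * (‖h‖ * ‖k‖) * (12 * C ^ 2) := by
          gcongr
          nlinarith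
      _ = _ := by ring
  · refine ContinuousLinearMap.opNorm_le_bound₂ _ (by positivity) fun h k => ?_
    have hDF : ‖fderiv ℝ c.F x - fderiv ℝ c.F z‖ ≤ C * ‖x - z‖ :=
      (convex_ball z R).norm_image_sub_le_of_norm_fderiv_le
        (fun y _ => hF1.differentiable (by simp) y) c.norm_fderiv_fderiv_le hz hx
    have h1 : |(fderiv ℝ c.F x - fderiv ℝ c.F z) h| ≤ C * ‖x - z‖ * ‖h‖ :=
      abs_apply_le hDF h
    have h2 : |(fderiv ℝ c.F x - fderiv ℝ c.F z) k| ≤ C * ‖x - z‖ * ‖k‖ :=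
      abs_apply_le hDF k
    have h3 : |fderiv ℝ (fderiv ℝ c.F) x h k| ≤ C * ‖h‖ * ‖k‖ :=
      abs_apply_apply_le (c.norm_fderiv_fderiv_le x hx) h k
    have h4 : |(fderiv ℝ (fderiv ℝ c.F) x - fderiv ℝ (fderiv ℝ c.F) z) h k|
        ≤ C * ‖x - z‖ * ‖h‖ * ‖k‖ :=
      abs_apply_apply_le (c.norm_fderiv_fderiv_sub_le x hx) h k
    have e : (fderiv ℝ (fderiv ℝ (fun x => c.F x * g x)) x
        - fderiv ℝ (fderiv ℝ (fun x => c.F x * g x)) z) h k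
        = (fderiv ℝ c.F x - fderiv ℝ c.F z) h * ℓ k + ℓ h * (fderiv ℝ c.F x - fderiv ℝ c.F z) k
          + (ℓ (x - z) * fderiv ℝ (fderiv ℝ c.F) x h k
            + a * (fderiv ℝ (fderiv ℝ c.F) x - fderiv ℝ (fderiv ℝ c.F) z) h k) := by
      simp only [sub_apply, hτ2, hgz]
      simp only [hg]
      ring
    rw [e, Real.norm_eq_abs]
    refine (abs_add_three _ _ _).trans ?_
    refine (add_le_add_right (abs_add_le _ _) _).trans ?_
    simp only [abs_mul]
    calc _ ≤ C * ‖x - z‖ * ‖h‖ * (3 * K * C * ‖k‖) + 3 * K * C * ‖h‖ * (C * ‖x - z‖ * ‖k‖)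
          + (3 * K * C * ‖x - z‖ * (C * ‖h‖ * ‖k‖) + K * (C * ‖x - z‖ * ‖h‖ * ‖k‖)) := by
          gcongr
          · exact hℓK k
          · exact hℓK h
          · exact hℓK _
      _ = K * ‖x - z‖ * (‖h‖ * ‖k‖) * (9 * C ^ 2 + C) := by ring
      _ ≤ K * ‖x - z‖ * (‖h‖ * ‖k‖) * (12 * C ^ 2) := by
          gcongr
          nlinarith
      _ = _ := by ring

end BoundaryChart

theorem contDiff_mul_of_eq_zero {N : ℕ} {χ v : Euc N → ℝ} {z : Euc N} {r R : ℝ}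
    (hχ : ContDiff ℝ 2 χ) (hrR : r < R) (h0 : ∀ x, r ≤ dist x z → χ x = 0)
    (hv : ∀ x ∈ ball z R, ContDiffAt ℝ 2 v x) : ContDiff ℝ 2 (fun x => χ x * v x) := by
  rw [contDiff_iff_contDiffAt]
  intro x
  by_cases hx : x ∈ ball z R
  · exact hχ.contDiffAt.mul (hv x hx)
  · rw [mem_ball, not_lt] at hx
    refine (contDiffAt_const (c := (0 : ℝ))).congr_of_eventuallyEq ?_
    have : ∀ᶠ y in 𝓝 x, r < dist y z :=
      (continuous_id.dist continuous_const).continuousAt.eventually_const_lt (hrR.trans_le hx)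
    filter_upwards [this] with y hy
    rw [h0 y hy.le, zero_mul]

theorem hasCompactSupport_mul_of_eq_zero {N : ℕ} {χ v : Euc N → ℝ} {z : Euc N} {r : ℝ}
    (h0 : ∀ x, r ≤ dist x z → χ x = 0) : HasCompactSupport (fun x => χ x * v x) :=
  HasCompactSupport.intro (isCompact_closedBall z r) fun x hx => by
    rw [mem_closedBall, not_le] at hx
    rw [h0 x hx.le, zero_mul]

theorem exists_lipschitzWith_fderiv {N : ℕ} {f : Euc N → ℝ} (hf : ContDiff ℝ 2 f)
    (hc : HasCompactSupport f) : ∃ D, LipschitzWith D (fderiv ℝ f) :=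
  ContDiff.lipschitzWith_of_hasCompactSupport (n := 1) (hc.fderiv ℝ)
    (hf.fderiv_right (by norm_num)) (by simp)

namespace BoundaryChart

variable {N : ℕ} {Ω : Set (Euc N)} {z : Euc N} {R C : ℝ} (c : BoundaryChart Ω z R C)

include c

theorem β_eq_zero {x : Euc N} (hx : x ∈ ball z R) (hF : c.F x = 0) : c.β x = 0 := by
  have := c.abs_β_le hx
  rw [hF, abs_zero, mul_zero] at this
  exact abs_eq_zero.1 (le_antisymm this (abs_nonneg _))

theorem fderiv_β_mul {x : Euc N} (hx : x ∈ ball z R) (hF : c.F x = 0) (h : Euc N) :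
    fderiv ℝ c.β x h * fderiv ℝ c.F x c.e = 2 * fderiv ℝ c.F x h := by
  have hF1 : ContDiff ℝ 1 (fderiv ℝ c.F) := c.contDiff_F.fderiv_right (by norm_num)
  have h1 : HasFDerivAt (fun y => fderiv ℝ c.F y c.e)
      ((fderiv ℝ (fderiv ℝ c.F) x).flip c.e) x := by
    simpa using (hF1.differentiable (by simp) x).hasFDerivAt.clm_apply (hasFDerivAt_const c.e x)
  have h2 := ((c.contDiffAt_β x hx).differentiableAt (by simp)).hasFDerivAt.mul h1
  have h3 := (c.differentiable_F x).hasFDerivAt.const_mul 2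
  have h4 := h2.unique (h3.congr_of_eventuallyEq (by
    filter_upwards [isOpen_ball.mem_nhds hx] with y hy using c.β_mul y hy))
  have h5 := congrArg (fun L : Euc N →L[ℝ] ℝ => L h) h4
  simp only [add_apply, smul_apply, smul_eq_mul, c.β_eq_zero hx hF] at h5
  linarith

theorem contDiffAt_comp_reflect {u : Euc N → ℝ} (hu : ContDiff ℝ 2 u) {x : Euc N}
    (hx : x ∈ ball z R) : ContDiffAt ℝ 2 (fun y => u (y - c.β y • c.e)) x :=
  hu.contDiffAt.comp x (contDiffAt_id.sub ((c.contDiffAt_β x hx).smul contDiffAt_const))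

/-- A `C²` function vanishing on the boundary extends across it by odd reflection, with
Lipschitz gradient. -/
theorem exists_odd_extension {u : Euc N → ℝ} (hR : 0 < R) (hu : ContDiff ℝ 2 u)
    (hu0 : ∀ x ∈ ball z R, c.F x = 0 → u x = 0) :
    ∃ w : Euc N → ℝ, Differentiable ℝ w ∧ (∃ L, LipschitzWith L (fderiv ℝ w)) ∧
      ∀ x ∈ ball z (R / 20), (c.F x ≤ 0 → w x = u x) ∧
        (0 < c.F x → w x = -u (x - c.β x • c.e)) ∧
        (c.F x ≤ 0 → lap w x = lap u x ∨ lap w x = 0) ∧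
        (0 < c.F x → lap w x = -lap (fun y => u (y - c.β y • c.e)) x) := by
  let χ : ContDiffBump z := ⟨R / 20, R / 6, by positivity, by linarith⟩
  have hχ0 : ∀ x, R / 6 ≤ dist x z → χ x = 0 := fun x hx => χ.zero_of_le_dist hx
  have hχ1 : ∀ x ∈ ball z (R / 20), χ x = 1 := fun x hx =>
    χ.one_of_mem_closedBall (ball_subset_closedBall hx)
  have hχ : ContDiff ℝ 2 χ := χ.contDiff
  set q : Euc N → ℝ := fun x => χ x * -(u (x - c.β x • c.e) + u x) with hqdef
  have hvC : ∀ x ∈ ball z R, ContDiffAt ℝ 2 (fun x => -(u (x - c.β x • c.e) + u x)) x :=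
    fun x hx => ((c.contDiffAt_comp_reflect hu hx).add hu.contDiffAt).neg
  have hq : ContDiff ℝ 2 q := contDiff_mul_of_eq_zero hχ (by linarith) hχ0 hvC
  have hqc : HasCompactSupport q := hasCompactSupport_mul_of_eq_zero hχ0
  have hF : Continuous c.F := c.differentiable_F.continuous
  have hud : Differentiable ℝ u := hu.differentiable (by simp)
  have hv0 : ∀ x ∈ ball z R, c.F x = 0 → -(u (x - c.β x • c.e) + u x) = 0 := fun x hx hFx => by
    rw [c.β_eq_zero hx hFx, zero_smul, sub_zero, hu0 x hx hFx, add_zero, neg_zero]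
  have hfar : ∀ x ∉ ball z R, ∀ᶠ y in 𝓝 x, χ y = 0 := fun x hx => by
    rw [mem_ball, not_lt] at hx
    have : ∀ᶠ y in 𝓝 x, R / 6 < dist y z :=
      (continuous_id.dist continuous_const).continuousAt.eventually_const_lt
        (lt_of_lt_of_le (by linarith : R / 6 < R) hx)
    filter_upwards [this] with y hy using hχ0 y hy.le
  have hq0 : ∀ x, c.F x = 0 → q x = 0 := fun x hFx => by
    by_cases hx : x ∈ ball z R
    · simp only [hqdef, hv0 x hx hFx, mul_zero]
    · simp only [hqdef, (hfar x hx).self_of_nhds, zero_mul]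
  have hq1 : ∀ x, c.F x = 0 → fderiv ℝ q x = 0 := fun x hFx => by
    by_cases hx : x ∈ ball z R
    · have hvd : HasFDerivAt (fun x => -(u (x - c.β x • c.e) + u x))
          (0 : Euc N →L[ℝ] ℝ) x := by
        have h1 := ((hasFDerivAt_comp_reflect (e := c.e) hud
          ((c.contDiffAt_β x hx).differentiableAt (by simp))).add (hud x).hasFDerivAt).neg
        refine h1.congr_fderiv ?_
        ext h
        have h2 := c.fderiv_β_mul hx hFx h
        have h3 := fderiv_mul_eq_of_eq_zero_on_level
          (c.contDiff_F.contDiffAt.hasStrictFDerivAt (x := x) (by simp))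
          (hu.contDiffAt.hasStrictFDerivAt (x := x) (by simp))
          (by filter_upwards [isOpen_ball.mem_nhds hx] with y hy hFy using
            hu0 y hy (hFy.trans hFx)) c.e h
        have h4 : fderiv ℝ c.F x c.e ≠ 0 := by linarith [c.le_fderiv_e x hx]
        rw [c.β_eq_zero hx hFx]
        simp only [zero_smul, sub_zero, neg_apply, add_apply, sub_apply,
          smul_apply, smul_eq_mul, zero_apply]
        apply mul_left_cancel₀ h4
        linear_combination fderiv ℝ u x c.e * h2 - 2 * h3
      have := (hχ.differentiable (by simp) x).hasFDerivAt.mul hvd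
      rw [show fderiv ℝ q x = _ from this.fderiv, hv0 x hx hFx, smul_zero, zero_smul, add_zero]
    · have : q =ᶠ[𝓝 x] fun _ => 0 := by
        filter_upwards [hfar x hx] with y hy
        simp only [hqdef, hy, zero_mul]
      rw [this.fderiv_eq, fderiv_fun_const, Pi.zero_apply]
  obtain ⟨hcd, L₁, hL₁⟩ := cut_along_level hF hq hqc hq0 hq1
  have hu2 : ContDiff ℝ 2 (fun x => χ x * u x) := hχ.mul hu
  obtain ⟨L₂, hL₂⟩ := exists_lipschitzWith_fderiv hu2 (hasCompactSupport_mul_of_eq_zero hχ0)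
  have hud2 : Differentiable ℝ (fun x => χ x * u x) := hu2.differentiable (by simp)
  set w : Euc N → ℝ := fun x => χ x * u x + if 0 < c.F x then q x else 0 with hw
  have hwd : ∀ x, HasFDerivAt w (fderiv ℝ (fun x => χ x * u x) x +
      if 0 < c.F x then fderiv ℝ q x else 0) x := fun x => (hud2 x).hasFDerivAt.add (hcd x)
  have hwf : fderiv ℝ w = fun x => fderiv ℝ (fun x => χ x * u x) x +
      if 0 < c.F x then fderiv ℝ q x else 0 := funext fun x => (hwd x).fderiv
  have hwneg : ∀ x ∈ ball z (R / 20), c.F x ≤ 0 → w x = u x := fun x hx hFx => by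
    simp only [hw, hχ1 x hx, one_mul, if_neg hFx.not_gt, add_zero]
  have hwpos : ∀ x ∈ ball z (R / 20), 0 < c.F x → w x = -u (x - c.β x • c.e) :=
    fun x hx hFx => by
      simp only [hw, hqdef, hχ1 x hx, one_mul, if_pos hFx]
      ring
  refine ⟨w, fun x => (hwd x).differentiableAt, ⟨L₂ + L₁, hwf ▸ hL₂.add hL₁⟩, fun x hx =>
    ⟨hwneg x hx, hwpos x hx, fun hFx => ?_, fun hFx => ?_⟩⟩
  · rcases hFx.lt_or_eq with hFx | hFx
    · left
      apply lap_congr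
      filter_upwards [isOpen_ball.mem_nhds hx, hF.continuousAt.eventually_lt_const hFx] with y hy hFy
      exact hwneg y hy hFy.le
    · have hxR : x ∈ ball z R := ball_subset_ball (by linarith) hx
      have := fderiv_eq_or_eq_zero_of_one_sided (W := fderiv ℝ w) (U := fderiv ℝ u)
        (e := c.e) (c.differentiable_F x) hFx (by linarith [c.le_fderiv_e x hxR])
        ((hu.fderiv_right (m := 1) (by norm_num)).differentiable (by simp) x) (by
          filter_upwards [isOpen_ball.mem_nhds hx] with y hy hFy
          rw [hwf]
          simp only [if_neg hFy.not_gt, add_zero]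
          apply Filter.EventuallyEq.fderiv_eq
          filter_upwards [isOpen_ball.mem_nhds hy] with y' hy'
          rw [hχ1 y' hy', one_mul])
      rcases this with h | h
      · left
        simp only [lap, h]
      · right
        simp [lap, h]
  · have h1 : lap w x = lap (fun y => -u (y - c.β y • c.e)) x := by
      apply lap_congr
      filter_upwards [isOpen_ball.mem_nhds hx, hF.continuousAt.eventually_const_lt hFx] with y hy hFy
      exact hwpos y hy hFy
    rw [h1]
    have h2 : fderiv ℝ (fun y => -u (y - c.β y • c.e)) =
      fun y => -fderiv ℝ (fun y => u (y - c.β y • c.e)) y := funext fun y => fderiv_neg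
    simp only [lap, h2, fderiv_fun_neg, neg_apply, Finset.sum_neg_distrib]

end BoundaryChart

set_option maxSynthPendingDepth 3

theorem lap_sub {N : ℕ} {f g : Euc N → ℝ} (hf : ContDiff ℝ 2 f) (hg : ContDiff ℝ 2 g) (x : Euc N) :
    lap (fun x => f x - g x) x = lap f x - lap g x := by
  have h1 : fderiv ℝ (fun x => f x - g x) = fun x => fderiv ℝ f x - fderiv ℝ g x := funext fun x =>
    fderiv_fun_sub (hf.differentiable (by simp) x) (hg.differentiable (by simp) x)
  have h2 := fderiv_fun_sub (((hf.fderiv_right (m := 1) (by norm_num)).differentiable (by simp)) x)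
    (((hg.fderiv_right (m := 1) (by norm_num)).differentiable (by simp)) x)
  simp only [lap, h1, h2, sub_apply, Finset.sum_sub_distrib]

theorem lap_comp_const_add {N : ℕ} (w : Euc N → ℝ) (z y : Euc N) :
    lap (fun y => w (z + y)) y = lap w (z + y) := by
  have h1 : fderiv ℝ (fun y => w (z + y)) = fun y => fderiv ℝ w (z + y) :=
    funext fun y => fderiv_comp_add_left z
  simp only [lap, h1]
  rw [fderiv_comp_add_left (f := fderiv ℝ w) z]

/-- A `C²` function is `o(‖k‖²)` close to its second order Taylor polynomial. -/
theorem eventually_abs_sub_taylor2_le {N : ℕ} {f : Euc N → ℝ} (hf : ContDiff ℝ 2 f) (z : Euc N)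
    {ε : ℝ} (hε : 0 < ε) :
    ∃ δ > 0, ∀ k : Euc N, ‖k‖ < δ → |f (z + k) - taylor2 f z k| ≤ ε * ‖k‖ ^ 2 := by
  have h1 : ContDiff ℝ 1 (fderiv ℝ f) := hf.fderiv_right (by norm_num)
  have h2 : Continuous (fderiv ℝ (fderiv ℝ f)) := h1.continuous_fderiv (by simp)
  obtain ⟨δ, hδ, h⟩ := Metric.continuousAt_iff.1 (h2.continuousAt (x := z)) ε hε
  refine ⟨δ, hδ, fun k hk => abs_sub_taylor2_le hf fun s hs => ?_⟩
  rw [← dist_eq_norm]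
  refine (@h (z + s • k) ?_).le
  rw [dist_eq_norm, add_sub_cancel_left, norm_smul, Real.norm_of_nonneg hs.1]
  exact (mul_le_of_le_one_left (norm_nonneg _) hs.2).trans_lt hk

/-- The pointwise Schauder estimate centered at an arbitrary point. -/
theorem pointwise_schauder_at (N : ℕ) [NeZero N] : ∃ C, 0 ≤ C ∧
    ∀ (w T : Euc N → ℝ) (z : Euc N) (R A M : ℝ), Differentiable ℝ w →
      (∃ L, LipschitzWith L (fderiv ℝ w)) → 0 < R → 0 ≤ A → 0 ≤ M →
      (∀ x, ‖x - z‖ < R → |lap w x| ≤ A * √‖x - z‖) →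
      (∀ x, ‖x - z‖ < R → |w x| ≤ M) → (∀ y, dyadicDiff T y = 0) →
      (∀ h, (fun t : ℝ => w (z + t • h) - T (t • h)) =o[𝓝[>] 0] fun t => t ^ 2) →
      ∀ x, ‖x - z‖ ≤ R / 2 →
        |w x - T (x - z)| ≤ C * (A + M / (R ^ 2 * √R)) * (‖x - z‖ ^ 2 * √‖x - z‖) := by
  obtain ⟨C, hC, h⟩ := pointwise_schauder N
  refine ⟨C, hC, fun w T z R A M hw ⟨L, hL⟩ hR hA hM hlap hwM hT ho x hx => ?_⟩
  have h1 : fderiv ℝ (fun y => w (z + y)) = fun y => fderiv ℝ w (z + y) :=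
    funext fun y => fderiv_comp_add_left z
  rcases eq_or_ne (x - z) 0 with h0 | h0
  · have ho' := ho 0
    simp only [smul_zero, add_zero] at ho'
    have hlim : Tendsto (fun _ : ℝ => w z - T 0) (𝓝[>] 0) (𝓝 0) := by
      refine ho'.trans_tendsto ?_
      have : Tendsto (fun t : ℝ => t ^ 2) (𝓝 0) (𝓝 (0 ^ 2)) := (continuous_pow 2).tendsto 0
      rw [zero_pow two_ne_zero] at this
      exact this.mono_left nhdsWithin_le_nhds
    have h2 := tendsto_nhds_unique hlim tendsto_const_nhds
    rw [h0, sub_eq_zero.1 h0, ← h2]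
    simp
  have := h (fun y => w (z + y)) T L R A M (fun y => (hw _).comp y (by fun_prop)) (by
      rw [h1]
      intro a b
      have := hL (z + a) (z + b)
      rwa [edist_add_left] at this) hR hA hM
    (ae_of_all _ fun y hy => by
      rw [lap_comp_const_add]
      have := hlap (z + y) (by rwa [add_sub_cancel_left])
      rwa [add_sub_cancel_left] at this)
    (fun y hy => hwM _ (by rwa [add_sub_cancel_left])) hT ho (x - z) h0 hx
  simpa only [add_sub_cancel] using this

theorem dyadicDiff_zero {N : ℕ} (y : Euc N) : dyadicDiff (fun _ => 0) y = 0 := by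
  simp [dyadicDiff]

set_option maxHeartbeats 1600000 in
/-- Near a boundary point, a `C²` function vanishing on the boundary is approximated by its second
order Taylor polynomial to order `5 / 2`. -/
theorem boundary_estimate (N : ℕ) [NeZero N] {R C : ℝ} (hR : 0 < R) (hR1 : R ≤ 1) (hC : 1 ≤ C) :
    ∃ C₁, 0 ≤ C₁ ∧ ∀ (Ω : Set (Euc N)) (z : Euc N) (_ : BoundaryChart Ω z R C) (ψ : Euc N → ℝ)
      (K Λ : ℝ), IsOpen Ω → ContDiff ℝ 2 ψ → (∀ x ∈ frontier Ω, ψ x = 0) → 0 ≤ Λ →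
      (∀ x ∈ closure Ω, ‖fderiv ℝ ψ x‖ ≤ K) → (∀ x ∈ closure Ω, ‖fderiv ℝ (fderiv ℝ ψ) x‖ ≤ K) →
      (∀ x ∈ closure Ω, ‖x - z‖ < R / 4 → |lap ψ x - lap ψ z| ≤ Λ * ‖x - z‖) →
      ∀ x ∈ Ω, ‖x - z‖ ≤ R / 40 →
        |ψ x - taylor2 ψ z (x - z)| ≤ C₁ * (K + Λ) * (‖x - z‖ ^ 2 * √‖x - z‖) := by
  obtain ⟨C₀, hC₀, hS⟩ := pointwise_schauder_at N
  set R' := R / 20 with hR'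
  have hR'0 : 0 < R' := by positivity
  refine ⟨C₀ * (424 * N * C ^ 4 + 5 + 24 * C ^ 2 / (R' ^ 2 * √R')) + 12 * C ^ 2, by positivity, ?_⟩
  intro Ω z c ψ K Λ hΩ hψ h0 hΛ hK₁ hK₂ hlap x hx hxz
  have hzR : z ∈ ball z R := mem_ball_self hR
  have hzΩ : z ∈ closure Ω := c.mem_closure hzR c.F_center.le
  have hzf : z ∈ frontier Ω := c.mem_frontier hΩ hzR c.F_center
  have hK0 : 0 ≤ K := (norm_nonneg _).trans (hK₁ z hzΩ)
  obtain ⟨τ, hτ, hτ0, hτ1, hτ2, hτb, hτl⟩ :=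
    c.exists_corrector hΩ hψ h0 hR hR1 hC (hK₁ z hzΩ) (hK₂ z hzΩ)
  have hC2 : 1 ≤ C ^ 2 := one_le_pow₀ hC
  have hKC : K ≤ C ^ 2 * K := le_mul_of_one_le_left hK0 hC2
  set u : Euc N → ℝ := fun x => ψ x - τ x with hu
  have huC : ContDiff ℝ 2 u := hψ.sub hτ
  have hψ1 : ContDiff ℝ 1 (fderiv ℝ ψ) := hψ.fderiv_right (by norm_num)
  have hτ1' : ContDiff ℝ 1 (fderiv ℝ τ) := hτ.fderiv_right (by norm_num)
  have hu1 : fderiv ℝ u = fun x => fderiv ℝ ψ x - fderiv ℝ τ x := funext fun x =>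
    fderiv_fun_sub (hψ.differentiable (by simp) x) (hτ.differentiable (by simp) x)
  have hu2 : ∀ x, fderiv ℝ (fderiv ℝ u) x = fderiv ℝ (fderiv ℝ ψ) x - fderiv ℝ (fderiv ℝ τ) x :=
    fun x => by
      rw [hu1]
      exact fderiv_fun_sub (hψ1.differentiable (by simp) x) (hτ1'.differentiable (by simp) x)
  have hball : ∀ {y : Euc N} {r : ℝ}, r ≤ R → ‖y - z‖ < r → y ∈ ball z R := fun hr hy => by
    rw [mem_ball, dist_eq_norm]
    exact hy.trans_le hr
  have hu0 : ∀ y ∈ ball z R, c.F y = 0 → u y = 0 := fun y hy hFy => by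
    rw [hu]
    simp only [hτ0 y hFy, h0 y (c.mem_frontier hΩ hy hFy), sub_zero]
  set P := 13 * C ^ 2 * K with hP
  have hP0 : 0 ≤ P := by positivity
  have hD2u : ∀ y ∈ ball z R, c.F y ≤ 0 → ‖fderiv ℝ (fderiv ℝ u) y‖ ≤ P := fun y hy hFy => by
    rw [hu2]
    refine (norm_sub_le _ _).trans ?_
    have h1 := hK₂ y (c.mem_closure hy hFy)
    have h2 := hτb y hy
    linarith
  have huz1 : fderiv ℝ u z = 0 := by rw [hu1]; simp only [hτ1, sub_self]
  have hDu : ∀ y, ‖y - z‖ < R / 4 → c.F y ≤ 0 → ‖fderiv ℝ u y‖ ≤ 5 * P * ‖y - z‖ := by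
    intro y hy hFy
    have := c.norm_sub_center_le ((huC.fderiv_right (m := 1) (by norm_num)).differentiable (by simp))
      hD2u hy hFy
    rwa [huz1, sub_zero] at this
  have hτT : ∀ y, ‖y - z‖ < R → |τ y - taylor2 τ z (y - z)| ≤ 12 * C ^ 2 * K * ‖y - z‖ ^ 3 := by
    intro y hy
    have h1 := abs_sub_taylor2_le hτ (a := z) (h := y - z) (ε := 12 * C ^ 2 * K * ‖y - z‖)
      fun s hs => by
        have h2 : ‖s • (y - z)‖ ≤ ‖y - z‖ := by
          rw [norm_smul, Real.norm_of_nonneg hs.1]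
          exact mul_le_of_le_one_left (norm_nonneg _) hs.2
        have h3 := hτl (z + s • (y - z))
          (hball le_rfl (by rw [add_sub_cancel_left]; exact h2.trans_lt hy))
        rw [add_sub_cancel_left] at h3
        exact h3.trans (by gcongr)
    rw [add_sub_cancel] at h1
    exact h1.trans (by rw [pow_succ' ‖y - z‖ 2, mul_assoc])
  have hTeq : ∀ h, taylor2 τ z h = taylor2 ψ z h := fun h => by
    rw [taylor2, taylor2, hτ0 z c.F_center, h0 z hzf, hτ1, hτ2]
  have hψM : ∀ y, ‖y - z‖ < R / 4 → c.F y ≤ 0 → |ψ y| ≤ 5 * K := fun y hy hFy => by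
    have := c.norm_sub_center_le (hψ.differentiable (by simp))
      (fun x hx hFx => hK₁ x (c.mem_closure hx hFx)) hy hFy
    rw [h0 z hzf, sub_zero] at this
    exact this.trans (mul_le_of_le_one_right (by positivity) (by linarith))
  have huM : ∀ y, ‖y - z‖ < R / 4 → c.F y ≤ 0 → |u y| ≤ 24 * C ^ 2 * K := fun y hy hFy => by
    have h1 := hτT y (by linarith)
    have hn : ‖y - z‖ ≤ 1 := by linarith
    have h3 : 12 * C ^ 2 * K * ‖y - z‖ ^ 3 ≤ 12 * C ^ 2 * K :=
      mul_le_of_le_one_right (by positivity) (pow_le_one₀ (norm_nonneg _) hn)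
    have h4 : |taylor2 τ z (y - z)| ≤ 2 * K := by
      rw [hTeq, taylor2, h0 z hzf, zero_add]
      have h5 : |fderiv ℝ ψ z (y - z)| ≤ K * 1 :=
        (abs_apply_le (hK₁ z hzΩ) _).trans (by gcongr)
      have h6 : |fderiv ℝ (fderiv ℝ ψ) z (y - z) (y - z)| ≤ K * 1 * 1 :=
        (abs_apply_apply_le (hK₂ z hzΩ) _ _).trans (by gcongr)
      rw [abs_le] at *
      constructor <;> linarith
    have h7 := hψM y hy hFy
    simp only [hu]
    rw [abs_le] at *
    constructor <;> nlinarith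
  set S := Λ + 12 * N * C ^ 2 * K with hSdef
  have hlapz : lap u z = 0 := by
    simp only [lap, hu2, sub_apply, hτ2, sub_self, Finset.sum_const_zero]
  have hlapu : ∀ y, ‖y - z‖ < R / 4 → c.F y ≤ 0 → |lap u y| ≤ S * ‖y - z‖ := fun y hy hFy => by
    have h1 := hlap y (c.mem_closure (hball (by linarith) hy) hFy) hy
    have h2 := abs_lap_sub_le τ τ y z
    have h3 : (N : ℝ) * ‖fderiv ℝ (fderiv ℝ τ) y - fderiv ℝ (fderiv ℝ τ) z‖
        ≤ N * (12 * C ^ 2 * K * ‖y - z‖) := by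
      gcongr
      exact hτl y (hball (by linarith) hy)
    have h4 := lap_sub hψ hτ y
    have h5 := lap_sub hψ hτ z
    have h6 : lap u y = (lap ψ y - lap ψ z) - (lap τ y - lap τ z) := by
      rw [← sub_zero (lap u y), ← hlapz, h4, h5]
      ring
    rw [h6]
    refine (abs_sub _ _).trans ?_
    rw [hSdef]
    linarith
  obtain ⟨w, hwd, hwL, hw⟩ := c.exists_odd_extension hR huC hu0
  have hrefl : ∀ y, ‖y - z‖ < R / 20 → ‖y - c.β y • c.e - z‖ ≤ 5 * ‖y - z‖ := fun y hy =>
    c.norm_reflect_sub_le (hball (by linarith) hy)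
  have hreflF : ∀ y, ‖y - z‖ < R / 20 → 0 < c.F y → c.F (y - c.β y • c.e) ≤ 0 := fun y hy hFy =>
    (c.F_reflect_neg (by linarith) hFy).le
  have hmem : ∀ {y : Euc N}, ‖y - z‖ < R / 20 → y ∈ ball z (R / 20) := fun hy => by
    rwa [mem_ball, dist_eq_norm]
  set A := 5 * S + 28 * N * P * C ^ 2 with hA
  have hS0 : 0 ≤ S := by positivity
  have hbig : 0 ≤ 28 * N * P * C ^ 2 := by positivity
  have hwlap : ∀ y, ‖y - z‖ < R / 20 → |lap w y| ≤ A * ‖y - z‖ := fun y hy => by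
    have hn := norm_nonneg (y - z)
    rcases le_or_gt (c.F y) 0 with hFy | hFy
    · rcases (hw y (hmem hy)).2.2.1 hFy with h | h
      · rw [h]
        refine (hlapu y (by linarith) hFy).trans ?_
        gcongr
        linarith
      · rw [h, abs_zero]
        positivity
    · have hr := hrefl y hy
      have hrF := hreflF y hy hFy
      have hr4 : ‖y - c.β y • c.e - z‖ < R / 4 := by linarith
      have hyR : y ∈ ball z R := hball (by linarith) hy
      rw [(hw y (hmem hy)).2.2.2 hFy, abs_neg]
      have h1 := abs_lap_comp_reflect_sub_le huC (c.contDiffAt_β y hyR) c.norm_e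
        (c.norm_fderiv_β_sub_le y hyR) (hD2u _ (hball (by linarith) hr4) hrF) (hDu _ hr4 hrF)
        (c.norm_fderiv_fderiv_β_le y hyR)
      have h2 := hlapu _ hr4 hrF
      have h3 : S * ‖y - c.β y • c.e - z‖ ≤ S * (5 * ‖y - z‖) := by gcongr
      have h4 : N * (P * (2 * (C * ‖y - z‖) + (C * ‖y - z‖) ^ 2)
          + 5 * P * ‖y - c.β y • c.e - z‖ * C) ≤
          N * (P * (2 * (C ^ 2 * ‖y - z‖) + C ^ 2 * ‖y - z‖)
          + 5 * P * (5 * ‖y - z‖) * C ^ 2) := by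
        have hCC : C ≤ C ^ 2 := by nlinarith
        gcongr
        rw [mul_pow]
        gcongr
        nlinarith
      have h5 : |lap (fun y => u (y - c.β y • c.e)) y| ≤ |lap (fun y => u (y - c.β y • c.e)) y
          - lap u (y - c.β y • c.e)| + |lap u (y - c.β y • c.e)| := by
        refine le_trans (le_of_eq ?_) (abs_add_le _ _)
        rw [sub_add_cancel]
      refine h5.trans ((add_le_add (h1.trans h4) (h2.trans h3)).trans (le_of_eq ?_))
      rw [hA]
      ring
  have hwM : ∀ y, ‖y - z‖ < R / 20 → |w y| ≤ 24 * C ^ 2 * K := fun y hy => by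
    rcases le_or_gt (c.F y) 0 with hFy | hFy
    · rw [(hw y (hmem hy)).1 hFy]
      exact huM y (by linarith) hFy
    · rw [(hw y (hmem hy)).2.1 hFy, abs_neg]
      exact huM _ (by linarith [hrefl y hy]) (hreflF y hy hFy)
  have hwo : ∀ h : Euc N, (fun t : ℝ => w (z + t • h) - 0) =o[𝓝[>] 0] fun t => t ^ 2 := by
    intro h
    rw [isLittleO_iff]
    intro ε hε
    set ε' := ε / (25 * (‖h‖ ^ 2 + 1)) with hε'
    have hε'0 : 0 < ε' := by positivity
    obtain ⟨δ, hδ, hT⟩ := eventually_abs_sub_taylor2_le huC z hε'0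
    have hT' : ∀ k : Euc N, ‖k‖ < δ → |u (z + k)| ≤ ε' * ‖k‖ ^ 2 := fun k hk => by
      have := hT k hk
      rwa [taylor2, hu0 z hzR c.F_center, huz1, hu2, sub_apply, sub_apply, hτ2, zero_apply, sub_self,
        mul_zero, add_zero, add_zero, sub_zero] at this
    have hev : ∀ᶠ t : ℝ in 𝓝[>] 0, ‖t • h‖ < min (δ / 5) (R / 20) := by
      have : Tendsto (fun t : ℝ => ‖t • h‖) (𝓝 0) (𝓝 ‖(0 : ℝ) • h‖) :=
        (show Continuous fun t : ℝ => ‖t • h‖ by fun_prop).tendsto 0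
      rw [zero_smul, norm_zero] at this
      exact (this.eventually_lt_const (by positivity)).filter_mono nhdsWithin_le_nhds
    filter_upwards [hev] with t ht
    rw [sub_zero, Real.norm_eq_abs, Real.norm_eq_abs, abs_of_nonneg (sq_nonneg t)]
    have ht1 := ht.trans_le (min_le_left _ _)
    have ht2 := ht.trans_le (min_le_right _ _)
    have hthn : ‖z + t • h - z‖ = ‖t • h‖ := by rw [add_sub_cancel_left]
    have hfin : ε' * (5 * ‖t • h‖) ^ 2 ≤ ε * t ^ 2 := by
      rw [norm_smul, Real.norm_eq_abs, mul_pow, mul_pow, sq_abs, hε']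
      have : ε / (25 * (‖h‖ ^ 2 + 1)) * (5 ^ 2 * (t ^ 2 * ‖h‖ ^ 2)) =
          ε * t ^ 2 * (‖h‖ ^ 2 / (‖h‖ ^ 2 + 1)) := by
        field_simp
        ring
      rw [this]
      refine mul_le_of_le_one_right (by positivity) ?_
      rw [div_le_one (by positivity)]
      linarith
    refine le_trans ?_ hfin
    have hmem' : z + t • h ∈ ball z (R / 20) := hmem (by rwa [hthn])
    rcases le_or_gt (c.F (z + t • h)) 0 with hFy | hFy
    · rw [(hw _ hmem').1 hFy]
      refine (hT' _ (by linarith)).trans ?_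
      gcongr
      linarith [norm_nonneg (t • h)]
    · rw [(hw _ hmem').2.1 hFy, abs_neg]
      have hr := hrefl (z + t • h) (by rwa [hthn])
      rw [hthn] at hr
      have := hT' (z + t • h - c.β (z + t • h) • c.e - z) (by linarith)
      rw [add_sub_cancel] at this
      refine this.trans ?_
      gcongr
  have hn1 : ‖x - z‖ ≤ 1 := by linarith
  have hsq : ∀ {s : ℝ}, 0 ≤ s → s ≤ 1 → s ≤ √s := fun h0 h1 => by
    refine Real.le_sqrt_of_sq_le ?_
    nlinarith
  have hA0 : 0 ≤ A := by positivity
  have hmain := hS w (fun _ => 0) z R' A (24 * C ^ 2 * K) hwd hwL hR'0 hA0 (by positivity)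
    (fun y hy => (hwlap y hy).trans (by
      gcongr
      exact hsq (norm_nonneg _) (by linarith))) hwM dyadicDiff_zero hwo x (by linarith)
  have hxF : c.F x ≤ 0 := ((c.mem_iff x (hball (r := R / 20) (by linarith) (by linarith))).1 hx).le
  rw [sub_zero, (hw x (hmem (by linarith))).1 hxF] at hmain
  have hτx := hτT x (by linarith)
  rw [hTeq] at hτx
  set s := ‖x - z‖ with hs
  have hs0 : 0 ≤ s := norm_nonneg _
  have hcube : s ^ 3 ≤ s ^ 2 * √s := by
    rw [pow_succ]
    gcongr
    exact hsq hs0 hn1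
  have hsplit : |ψ x - taylor2 ψ z (x - z)| ≤ |u x| + |τ x - taylor2 ψ z (x - z)| := by
    refine le_trans (le_of_eq ?_) (abs_add_le _ _)
    rw [hu]
    congr 1
    ring
  have hAb : A ≤ (424 * N * C ^ 4 + 5) * (K + Λ) := by
    rw [hA, hSdef, hP]
    have h1 : 60 * N * C ^ 2 * K ≤ 60 * N * C ^ 4 * K := by
      have : C ^ 2 ≤ C ^ 4 := pow_le_pow_right₀ hC (by norm_num)
      gcongr
    have h2 : 0 ≤ 424 * N * C ^ 4 * Λ := by positivity
    linarith
  have hMb : 24 * C ^ 2 * K / (R' ^ 2 * √R') ≤ 24 * C ^ 2 / (R' ^ 2 * √R') * (K + Λ) := by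
    rw [mul_div_right_comm]
    gcongr
    linarith
  calc |ψ x - taylor2 ψ z (x - z)|
      ≤ C₀ * (A + 24 * C ^ 2 * K / (R' ^ 2 * √R')) * (s ^ 2 * √s) + 12 * C ^ 2 * K * s ^ 3 :=
        hsplit.trans (add_le_add hmain hτx)
    _ ≤ C₀ * ((424 * N * C ^ 4 + 5) * (K + Λ) + 24 * C ^ 2 / (R' ^ 2 * √R') * (K + Λ))
          * (s ^ 2 * √s) + 12 * C ^ 2 * (K + Λ) * (s ^ 2 * √s) := by
        gcongr
        linarith
    _ = _ := by ring

/-- Second derivatives in one variable of a jointly `C²` function are locally bounded, uniformly in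
the other variable. -/
theorem exists_norm_fderiv_fderiv_param_le {N : ℕ} {B : Euc N × Euc N → ℝ} {p : Euc N × Euc N}
    (hB : ContDiffAt ℝ 2 B p) :
    ∃ M, ∃ ρ > 0, ∀ e ∈ ball p.1 ρ, ∀ x ∈ ball p.2 ρ, ContDiffAt ℝ 2 (fun y => B (e, y)) x ∧
      ‖fderiv ℝ (fderiv ℝ fun y => B (e, y)) x‖ ≤ M := by
  have h1 : ContDiffAt ℝ 1 (fderiv ℝ B) p := hB.fderiv_right (by norm_num)
  have h2 : ContDiffAt ℝ 0 (fderiv ℝ (fderiv ℝ B)) p := h1.fderiv_right (by norm_num)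
  have h3 := h2.continuousAt.norm.eventually_lt_const
    (lt_add_one ‖fderiv ℝ (fderiv ℝ B) p‖)
  obtain ⟨ρ, hρ, h⟩ := Metric.eventually_nhds_iff.1
    (h3.and (hB.eventually (by simp)))
  refine ⟨‖fderiv ℝ (fderiv ℝ B) p‖ + 1, ρ, hρ, fun e he => ?_⟩
  have hmem : ∀ x ∈ ball p.2 ρ, dist (e, x) p < ρ := fun x hx => by
    rw [Prod.dist_eq]
    exact max_lt he hx
  have hι : ∀ x : Euc N, HasFDerivAt (fun y : Euc N => (e, y))
      (ContinuousLinearMap.inr ℝ (Euc N) (Euc N)) x := fun x =>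
    hasFDerivAt_prodMk_right e x
  have hd1 : ∀ x ∈ ball p.2 ρ, fderiv ℝ (fun y => B (e, y)) x =
      (fderiv ℝ B (e, x)).comp (ContinuousLinearMap.inr ℝ (Euc N) (Euc N)) := fun x hx =>
    (((h (hmem x hx)).2.differentiableAt (by simp)).hasFDerivAt.comp x (hι x)).fderiv
  intro x hx
  refine ⟨(h (hmem x hx)).2.comp x (contDiffAt_const.prodMk contDiffAt_id), ?_⟩
  have hB1 : DifferentiableAt ℝ (fderiv ℝ B) (e, x) :=
    ((h (hmem x hx)).2.fderiv_right (m := 1) (by norm_num)).differentiableAt (by simp)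
  have hd2 : fderiv ℝ (fderiv ℝ fun y => B (e, y)) x = fderiv ℝ (fun y =>
      (fderiv ℝ B (e, y)).comp (ContinuousLinearMap.inr ℝ (Euc N) (Euc N))) x := by
    apply Filter.EventuallyEq.fderiv_eq
    filter_upwards [isOpen_ball.mem_nhds hx] with y hy using hd1 y hy
  have hd3 := (hB1.hasFDerivAt.comp x (hι x)).clm_comp
    (hasFDerivAt_const (ContinuousLinearMap.inr ℝ (Euc N) (Euc N)) x)
  have hlt := (h (hmem x hx)).1.le
  rw [hd2]
  refine ContinuousLinearMap.opNorm_le_bound₂ _ ((norm_nonneg _).trans hlt) fun v k => ?_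
  have hd4 : fderiv ℝ (fun y =>
      (fderiv ℝ B (e, y)).comp (ContinuousLinearMap.inr ℝ (Euc N) (Euc N))) x v k
      = fderiv ℝ (fderiv ℝ B) (e, x) (0, v) (0, k) := by
    erw [hd3.fderiv]
    simp
  rw [hd4]
  refine (ContinuousLinearMap.le_opNorm₂ _ _ _).trans ?_
  have e1 : ∀ v : Euc N, ‖((0 : Euc N), v)‖ = ‖v‖ := fun v => by simp [Prod.norm_def]
  rw [e1, e1]
  gcongr

theorem BoundaryChart.mono {N : ℕ} {Ω : Set (Euc N)} {z : Euc N} {R R' C C' : ℝ}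
    (c : BoundaryChart Ω z R C) (hR : R' ≤ R) (hC : C ≤ C') : Nonempty (BoundaryChart Ω z R' C') := by
  have hb : ∀ x ∈ ball z R', x ∈ ball z R := fun x hx => ball_subset_ball hR hx
  exact ⟨{
    F := c.F
    β := c.β
    e := c.e
    contDiff_F := c.contDiff_F
    norm_e := c.norm_e
    F_center := c.F_center
    fderiv_center := c.fderiv_center
    le_fderiv_e := fun x hx => c.le_fderiv_e x (hb x hx)
    norm_fderiv_le := fun x hx => c.norm_fderiv_le x (hb x hx)
    norm_fderiv_fderiv_le := fun x hx => (c.norm_fderiv_fderiv_le x (hb x hx)).trans hC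
    norm_fderiv_fderiv_sub_le := fun x hx => (c.norm_fderiv_fderiv_sub_le x (hb x hx)).trans
      (mul_le_mul_of_nonneg_right hC (norm_nonneg _))
    mem_iff := fun x hx => c.mem_iff x (hb x hx)
    contDiffAt_β := fun x hx => c.contDiffAt_β x (hb x hx)
    β_mul := fun x hx => c.β_mul x (hb x hx)
    norm_fderiv_β_sub_le := fun x hx => (c.norm_fderiv_β_sub_le x (hb x hx)).trans
      (mul_le_mul_of_nonneg_right hC (norm_nonneg _))
    norm_fderiv_fderiv_β_le := fun x hx => (c.norm_fderiv_fderiv_β_le x (hb x hx)).trans hC }⟩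

theorem eq_zero_of_mem_frontier {N : ℕ} {Ω U : Set (Euc N)} {f : Euc N → ℝ} (hΩ : IsOpen Ω)
    (hU : IsOpen U) (hf : Continuous f) (hΩU : Ω ∩ U = {y ∈ U | f y < 0}) {z : Euc N} (hzU : z ∈ U)
    (hz : z ∈ frontier Ω) : f z = 0 := by
  rw [hΩ.frontier_eq] at hz
  apply le_antisymm
  · by_contra hcon
    rw [not_le] at hcon
    have hUe : ∀ᶠ y in 𝓝 z, y ∈ U := hU.mem_nhds hzU
    have : ∀ᶠ y in 𝓝 z, y ∈ U ∧ 0 < f y :=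
      hUe.and (hf.continuousAt.eventually_const_lt hcon)
    obtain ⟨y, ⟨hyU, hy⟩, hyΩ⟩ := mem_closure_iff_nhds.1 hz.1 _ this
    have h2 : y ∈ {y ∈ U | f y < 0} := hΩU ▸ ⟨hyΩ, hyU⟩
    exact lt_asymm hy h2.2
  · by_contra hcon
    rw [not_le] at hcon
    have h2 : z ∈ Ω ∩ U := hΩU ▸ ⟨hzU, hcon⟩
    exact hz.2 h2.1

set_option maxHeartbeats 800000 in
/-- Near a boundary point, a domain of class `C³` admits charts of uniform size. -/
theorem exists_boundaryChart_near {N : ℕ} {Ω U : Set (Euc N)} {f : Euc N → ℝ} {z₀ : Euc N}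
    (hΩ : IsOpen Ω) (hU : IsOpen U) (hz₀ : z₀ ∈ U) (hf : ContDiff ℝ 3 f)
    (hf0 : fderiv ℝ f z₀ ≠ 0) (hΩU : Ω ∩ U = {y ∈ U | f y < 0}) :
    ∃ ρ > 0, ∃ C, ∀ z ∈ ball z₀ ρ, z ∈ frontier Ω → Nonempty (BoundaryChart Ω z ρ C) := by
  have hf1 : ContDiff ℝ 2 (fderiv ℝ f) := hf.fderiv_right (by norm_num)
  have hf2 : ContDiff ℝ 1 (fderiv ℝ (fderiv ℝ f)) := hf1.fderiv_right (by norm_num)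
  have hfd : Differentiable ℝ f := hf.differentiable (by simp)
  set G : Euc N → Euc N := fun z => (InnerProductSpace.toDual ℝ (Euc N)).symm (fderiv ℝ f z) with hG
  have hGin : ∀ z h, ⟪G z, h⟫_ℝ = fderiv ℝ f z h := fun z h =>
    InnerProductSpace.toDual_symm_apply
  have hGn : ∀ z, ‖G z‖ = ‖fderiv ℝ f z‖ := fun z => LinearIsometryEquiv.norm_map _ _
  have hGc : Continuous G := (LinearIsometryEquiv.continuous _).comp hf1.continuous
  set m := ‖fderiv ℝ f z₀‖ with hm
  have hm0 : 0 < m := norm_pos_iff.2 hf0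
  set e : Euc N → Euc N := fun z => ‖G z‖⁻¹ • G z with he
  have hGz₀ : ‖G z₀‖ ≠ 0 := by rw [hGn]; exact hm0.ne'
  have hec : ContinuousAt e z₀ := (hGc.continuousAt.norm.inv₀ hGz₀).smul hGc.continuousAt
  set B : Euc N × Euc N → ℝ := fun p => 2 * f p.2 / fderiv ℝ f p.2 p.1 with hBdef
  have hfe : ∀ z, fderiv ℝ f z (e z) = ‖fderiv ℝ f z‖ := fun z => by
    simp only [he]
    rw [← hGin, inner_smul_right, real_inner_self_eq_norm_sq, ← hGn]
    rcases eq_or_ne ‖G z‖ 0 with h | h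
    · simp [h]
    · field_simp
  have hB : ContDiffAt ℝ 2 B (e z₀, z₀) := by
    have h1 : ContDiff ℝ 2 fun p : Euc N × Euc N => 2 * f p.2 :=
      contDiff_const.mul ((hf.of_le (by norm_num)).comp contDiff_snd)
    have h2 : ContDiff ℝ 2 fun p : Euc N × Euc N => fderiv ℝ f p.2 p.1 :=
      (hf1.comp contDiff_snd).clm_apply contDiff_fst
    refine h1.contDiffAt.div h2.contDiffAt ?_
    simp only [hfe]
    exact hm0.ne'
  obtain ⟨M, ρ₁, hρ₁, hBM⟩ := exists_norm_fderiv_fderiv_param_le hB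
  obtain ⟨L, t, ht, hL⟩ := hf2.contDiffAt.exists_lipschitzOnWith (x := z₀)
  have hnear : ∀ᶠ x in 𝓝 z₀, x ∈ U ∧ dist (fderiv ℝ f x) (fderiv ℝ f z₀) < m / 16 ∧
      ‖fderiv ℝ (fderiv ℝ f) x‖ < ‖fderiv ℝ (fderiv ℝ f) z₀‖ + 1 ∧ x ∈ t ∧ x ∈ ball z₀ ρ₁ ∧
      e x ∈ ball (e z₀) ρ₁ := by
    have hUe : ∀ᶠ y in 𝓝 z₀, y ∈ U := hU.mem_nhds hz₀
    have hte : ∀ᶠ y in 𝓝 z₀, y ∈ t := ht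
    refine hUe.and (.and ?_ (.and ?_ (hte.and (.and ?_ ?_))))
    · exact hf1.continuous.continuousAt.eventually (ball_mem_nhds _ (by positivity))
    · exact hf2.continuous.continuousAt.norm.eventually_lt_const (lt_add_one _)
    · exact ball_mem_nhds _ hρ₁
    · exact hec.eventually (ball_mem_nhds _ hρ₁)
  obtain ⟨ρ, hρ, hn⟩ := Metric.eventually_nhds_iff.1 hnear
  set M₂ := ‖fderiv ℝ (fderiv ℝ f) z₀‖ + 1 with hM₂
  refine ⟨ρ / 2, by positivity, 2 / m * M₂ + 2 / m * L + M, fun z hz hzf => ?_⟩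
  have hM0 : 0 ≤ M := le_trans (ContinuousLinearMap.opNorm_nonneg _)
    (hBM _ (mem_ball_self hρ₁) _ (mem_ball_self hρ₁)).2
  have hM₂0 : 0 ≤ M₂ := by
    have := norm_nonneg (fderiv ℝ (fderiv ℝ f) z₀)
    rw [hM₂]
    linarith
  have hzn := hn (y := z) (lt_trans hz (by linarith))
  have hxn : ∀ x ∈ ball z (ρ / 2), dist x z₀ < ρ := fun x hx => by
    rw [mem_ball] at hx hz
    linarith [dist_triangle x z z₀]
  have hzz : z ∈ ball z (ρ / 2) := mem_ball_self (by positivity)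
  have hfz : f z = 0 := eq_zero_of_mem_frontier hΩ hU hf.continuous hΩU hzn.1 hzf
  set g := ‖fderiv ℝ f z‖ with hg
  have hgm : |g - m| ≤ m / 16 := by
    have := abs_norm_sub_norm_le (fderiv ℝ f z) (fderiv ℝ f z₀)
    rw [← dist_eq_norm] at this
    exact this.trans hzn.2.1.le
  have hg1 : 15 / 16 * m ≤ g := by
    have := (abs_le.1 hgm).1
    linarith
  have hg0 : 0 < g := by linarith
  have hginv : g⁻¹ ≤ 2 / m := by
    rw [inv_le_comm₀ hg0 (by positivity), inv_div]
    linarith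
  have hne : ‖e z‖ = 1 := by
    simp only [he]
    rw [norm_smul, norm_inv, norm_norm, inv_mul_cancel₀]
    rw [hGn]
    exact hg0.ne'
  have hdf : ∀ x ∈ ball z (ρ / 2), ‖fderiv ℝ f x - fderiv ℝ f z‖ ≤ m / 8 := fun x hx => by
    have h1 := (hn (hxn x hx)).2.1
    have h2 := hzn.2.1
    rw [← dist_eq_norm]
    linarith [dist_triangle_right (fderiv ℝ f x) (fderiv ℝ f z) (fderiv ℝ f z₀)]
  have hfxe : ∀ x ∈ ball z (ρ / 2), 3 / 4 * g ≤ fderiv ℝ f x (e z) := fun x hx => by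
    have h1 := abs_apply_le (hdf x hx) (e z)
    rw [hne, mul_one, sub_apply, hfe, ← hg] at h1
    linarith [(abs_le.1 h1).1]
  have hF1 : fderiv ℝ (fun x => g⁻¹ * f x) = fun x => g⁻¹ • fderiv ℝ f x := funext fun x =>
    fderiv_const_mul (hfd x) _
  have hF2 : ∀ x, fderiv ℝ (fderiv ℝ fun x => g⁻¹ * f x) x = g⁻¹ • fderiv ℝ (fderiv ℝ f) x :=
    fun x => by
      rw [hF1]
      exact fderiv_fun_const_smul (hf1.differentiable (by simp) x) _
  have hgC : ∀ {a b : ℝ}, 0 ≤ a → a ≤ b → g⁻¹ * a ≤ 2 / m * b := fun ha hab => by gcongr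
  have hL0 : 0 ≤ 2 / m * (L : ℝ) := by positivity
  have hM₂0' : 0 ≤ 2 / m * M₂ := by positivity
  have hβ : ∀ x ∈ ball z (ρ / 2), ContDiffAt ℝ 2 (fun x => B (e z, x)) x ∧
      ‖fderiv ℝ (fderiv ℝ fun x => B (e z, x)) x‖ ≤ M := fun x hx =>
    hBM _ hzn.2.2.2.2.2 _ (hn (hxn x hx)).2.2.2.2.1
  have hβm : ∀ x ∈ ball z (ρ / 2), B (e z, x) * fderiv ℝ f x (e z) = 2 * f x := fun x hx => by
    have := hfxe x hx
    have h2 : fderiv ℝ f x (e z) ≠ 0 := (lt_of_lt_of_le (by positivity) this).ne'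
    simp only [hBdef]
    field_simp
  have hβz : fderiv ℝ (fun x => B (e z, x)) z = (2 : ℝ) • innerSL ℝ (e z) := by
    have h1 : HasFDerivAt (fun y => fderiv ℝ f y (e z))
        ((fderiv ℝ (fderiv ℝ f) z).flip (e z)) z := by
      simpa using (hf1.differentiable (by simp) z).hasFDerivAt.clm_apply (hasFDerivAt_const (e z) z)
    have h2 := (((hβ z hzz).1.differentiableAt (by simp)).hasFDerivAt).mul h1
    have h3 := (hfd z).hasFDerivAt.const_mul 2
    have h4 := h2.unique (h3.congr_of_eventuallyEq (by
      filter_upwards [isOpen_ball.mem_nhds hzz] with y hy using hβm y hy))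
    ext h
    have h5 := congrArg (fun L : Euc N →L[ℝ] ℝ => L h) h4
    have h6 : B (e z, z) = 0 := by simp [hBdef, hfz]
    simp only [add_apply, smul_apply, smul_eq_mul, h6, zero_mul, zero_add, hfe] at h5
    have h7 : ⟪e z, h⟫_ℝ = g⁻¹ * fderiv ℝ f z h := by
      simp only [he]
      rw [inner_smul_left, hGin, hGn, ← hg]
      rfl
    rw [smul_apply, innerSL_apply_apply, smul_eq_mul, h7, mul_left_comm, ← h5, ← hg, ← mul_assoc,
      inv_mul_cancel₀ hg0.ne', one_mul]
  exact ⟨{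
    F := fun x => g⁻¹ * f x
    β := fun x => B (e z, x)
    e := e z
    contDiff_F := contDiff_const.mul (hf.of_le (by norm_num))
    norm_e := hne
    F_center := by rw [hfz, mul_zero]
    fderiv_center := fun h => by
      rw [hF1]
      simp only [he]
      rw [inner_smul_left, hGin, hGn]
      simp [hg]
    le_fderiv_e := fun x hx => by
      rw [hF1]
      simp only [smul_apply, smul_eq_mul]
      rw [inv_mul_eq_div, le_div_iff₀ hg0]
      exact hfxe x hx
    norm_fderiv_le := fun x hx => by
      rw [hF1]
      simp only [norm_smul, norm_inv, hg, norm_norm]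
      rw [← hg, inv_mul_eq_div, div_le_iff₀ hg0]
      have h1 := norm_sub_norm_le (fderiv ℝ f x) (fderiv ℝ f z)
      have h2 := hdf x hx
      linarith
    norm_fderiv_fderiv_le := fun x hx => by
      rw [hF2, norm_smul, norm_inv, Real.norm_of_nonneg hg0.le]
      have := hgC (ContinuousLinearMap.opNorm_nonneg _) (hn (hxn x hx)).2.2.1.le
      linarith
    norm_fderiv_fderiv_sub_le := fun x hx => by
      rw [hF2, hF2, ← smul_sub, norm_smul, norm_inv, Real.norm_of_nonneg hg0.le]
      have h1 := hL.norm_sub_le (hn (hxn x hx)).2.2.2.1 hzn.2.2.2.1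
      have h2 := hgC (ContinuousLinearMap.opNorm_nonneg _) h1
      refine h2.trans ?_
      rw [← mul_assoc]
      gcongr
      linarith
    mem_iff := fun x hx => by
      have hxU := (hn (hxn x hx)).1
      have h1 : x ∈ Ω ↔ f x < 0 := by
        have : x ∈ Ω ∩ U ↔ x ∈ {y ∈ U | f y < 0} := by rw [hΩU]
        simpa [hxU] using this
      rw [h1]
      constructor
      · exact fun h => mul_neg_of_pos_of_neg (inv_pos.2 hg0) h
      · exact fun h => (pos_iff_neg_of_mul_neg h).1 (inv_pos.2 hg0)
    contDiffAt_β := fun x hx => (hβ x hx).1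
    β_mul := fun x hx => by
      rw [hF1]
      simp only [smul_apply, smul_eq_mul]
      linear_combination g⁻¹ * hβm x hx
    norm_fderiv_β_sub_le := fun x hx => by
      rw [← hβz]
      refine ((convex_ball z (ρ / 2)).norm_image_sub_le_of_norm_fderiv_le (fun y hy =>
        ((hβ y hy).1.fderiv_right (m := 1) (by norm_num)).differentiableAt (by simp))
        (fun y hy => (hβ y hy).2) hzz hx).trans ?_
      gcongr
      linarith
    norm_fderiv_fderiv_β_le := fun x hx => (hβ x hx).2.trans (by linarith) }⟩

/-- Bounded domains of class `C³` have boundary charts of uniform size. -/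
theorem exists_boundaryChart {N : ℕ} {Ω : Set (Euc N)} (hΩ : IsOpen Ω)
    (hb : Bornology.IsBounded Ω)
    (h : ∀ x ∈ frontier Ω, ∃ (U : Set (Euc N)) (f : Euc N → ℝ), IsOpen U ∧ x ∈ U ∧ ContDiff ℝ 3 f ∧
      (∀ y ∈ U, fderiv ℝ f y ≠ 0) ∧ Ω ∩ U = {y ∈ U | f y < 0}) :
    ∃ R C, 0 < R ∧ R ≤ 1 ∧ 1 ≤ C ∧ ∀ z ∈ frontier Ω, Nonempty (BoundaryChart Ω z R C) := by
  have hcpt : IsCompact (frontier Ω) :=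
    Metric.isCompact_of_isClosed_isBounded isClosed_frontier (hb.closure.subset frontier_subset_closure)
  refine hcpt.induction_on
    (p := fun s => ∃ R C, 0 < R ∧ R ≤ 1 ∧ 1 ≤ C ∧ ∀ z ∈ s, Nonempty (BoundaryChart Ω z R C))
    ⟨1, 1, by norm_num, le_rfl, le_rfl, by simp⟩ ?_ ?_ ?_
  · rintro s t hst ⟨R, C, h1, h2, h3, h4⟩
    exact ⟨R, C, h1, h2, h3, fun z hz => h4 z (hst hz)⟩
  · rintro s t ⟨R, C, h1, h2, h3, h4⟩ ⟨R', C', h1', h2', h3', h4'⟩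
    refine ⟨min R R', max C C', lt_min h1 h1', (min_le_left _ _).trans h2,
      h3.trans (le_max_left _ _), fun z hz => ?_⟩
    rcases hz with hz | hz
    · obtain ⟨c⟩ := h4 z hz
      exact c.mono (min_le_left _ _) (le_max_left _ _)
    · obtain ⟨c⟩ := h4' z hz
      exact c.mono (min_le_right _ _) (le_max_right _ _)
  · intro x hx
    obtain ⟨U, f, hU, hxU, hf, hf0, hΩU⟩ := h x hx
    obtain ⟨ρ, hρ, C, hC⟩ := exists_boundaryChart_near hΩ hU hxU hf (hf0 x hxU) hΩU
    refine ⟨ball x ρ ∩ frontier Ω, inter_mem (mem_nhdsWithin_of_mem_nhds (ball_mem_nhds x hρ))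
      self_mem_nhdsWithin, min ρ 1, max C 1, lt_min hρ one_pos, min_le_right _ _,
      le_max_right _ _, fun z hz => ?_⟩
    obtain ⟨c⟩ := hC z hz.1 hz.2
    exact c.mono (min_le_left _ _) (le_max_left _ _)

/-- A polynomial of degree at most two. -/
def quad {N : ℕ} (a : ℝ) (ℓ : Euc N →L[ℝ] ℝ) (b : Euc N →L[ℝ] Euc N →L[ℝ] ℝ) (h : Euc N) : ℝ :=
  a + ℓ h + b h h

section quad

variable {N : ℕ} (a a' : ℝ) (ℓ ℓ' : Euc N →L[ℝ] ℝ) (b b' : Euc N →L[ℝ] Euc N →L[ℝ] ℝ)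

theorem taylor2_eq_quad (f : Euc N → ℝ) (x h : Euc N) :
    taylor2 f x h = quad (f x) (fderiv ℝ f x) ((1 / 2 : ℝ) • fderiv ℝ (fderiv ℝ f) x) h := by
  simp [taylor2, quad]

theorem quad_sub (h : Euc N) :
    quad a ℓ b h - quad a' ℓ' b' h = quad (a - a') (ℓ - ℓ') (b - b') h := by
  simp only [quad, sub_apply]
  ring

theorem quad_add (v h : Euc N) :
    quad a ℓ b (v + h) = quad (quad a ℓ b v) (ℓ + b v + b.flip v) b h := by
  simp only [quad, map_add, add_apply, ContinuousLinearMap.flip_apply]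
  ring

theorem dyadicDiff_quad (y : Euc N) : dyadicDiff (quad a ℓ b) y = 0 := by
  simp only [dyadicDiff, quad, map_smul, smul_apply, smul_eq_mul]
  ring

theorem contDiff_quad : ContDiff ℝ 2 (quad a ℓ b) := by
  unfold quad
  exact (contDiff_const.add ℓ.contDiff).add (b.contDiff.clm_apply contDiff_id)

theorem lap_quad (y : Euc N) : lap (quad a ℓ b) y =
    2 * ∑ i, b (EuclideanSpace.single i 1) (EuclideanSpace.single i 1) := by
  have h1 : fderiv ℝ (quad a ℓ b) = fun y => ℓ + (b y + b.flip y) := funext fun y => by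
    have h : HasFDerivAt (quad a ℓ b) _ y := ((hasFDerivAt_const a y).add ℓ.hasFDerivAt).add
      (b.hasFDerivAt.clm_apply (hasFDerivAt_id y))
    rw [h.fderiv]
    ext v
    simp
  have h2 : HasFDerivAt (fun y => ℓ + (b y + b.flip y)) _ y :=
    (b.hasFDerivAt.add b.flip.hasFDerivAt).const_add ℓ
  simp only [lap, h1, h2.fderiv, add_apply, ContinuousLinearMap.flip_apply]
  rw [Finset.sum_add_distrib]
  ring

/-- A quadratic polynomial grows at most quadratically. -/
theorem abs_quad_le {B ρ : ℝ} (hρ : 0 < ρ) (hB : ∀ h, ‖h‖ ≤ ρ → |quad a ℓ b h| ≤ B) {h : Euc N}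
    (hh : ρ ≤ ‖h‖) : |quad a ℓ b h| ≤ 4 * B * (‖h‖ ^ 2 / ρ ^ 2) := by
  have hh0 : 0 < ‖h‖ := hρ.trans_le hh
  set t := ρ / ‖h‖ with ht
  have ht0 : 0 < t := by positivity
  have ht1 : t ≤ 1 := (div_le_one hh0).2 hh
  have hth : ‖t • h‖ = ρ := by
    rw [norm_smul, Real.norm_of_nonneg ht0.le, ht, div_mul_cancel₀ _ hh0.ne']
  have h0 := hB 0 (by simpa using hρ.le)
  have h1 := hB (t • h) hth.le
  have h2 := hB (-(t • h)) (by rw [norm_neg, hth])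
  simp only [quad, map_neg, map_smul, map_zero, neg_apply, smul_apply, smul_eq_mul, add_zero] at h0 h1 h2
  have hB0 : 0 ≤ B := (abs_nonneg _).trans h0
  have h3 : ‖h‖ ^ 2 / ρ ^ 2 = 1 / t ^ 2 := by
    rw [ht]
    field_simp
  rw [h3, mul_one_div, le_div_iff₀ (by positivity), quad, ← abs_of_pos (pow_pos ht0 2), ← abs_mul]
  have h4 : |a * t ^ 2| ≤ B := by
    rw [abs_mul, abs_of_pos (pow_pos ht0 2)]
    exact (mul_le_of_le_one_right (abs_nonneg _) (pow_le_one₀ ht0.le ht1)).trans h0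
  have h5 : |t * ℓ h| ≤ B := by
    rw [abs_le] at *
    constructor <;> linarith
  have h6 : |t * ℓ h * t| ≤ B := by
    rw [abs_mul, abs_of_pos ht0]
    exact (mul_le_of_le_one_right (abs_nonneg _) ht1).trans h5
  rw [abs_le] at *
  constructor <;> linarith

end quad

theorem exists_bilin_eq_norm_sq (N : ℕ) :
    ∃ b : Euc N →L[ℝ] Euc N →L[ℝ] ℝ, ∀ h, b h h = ‖h‖ ^ 2 := by
  refine ⟨∑ i, (EuclideanSpace.proj i : Euc N →L[ℝ] ℝ).smulRight
    (EuclideanSpace.proj i : Euc N →L[ℝ] ℝ), fun h => ?_⟩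
  simp only [sum_apply, ContinuousLinearMap.smulRight_apply, smul_apply, smul_eq_mul,
    EuclideanSpace.real_norm_sq_eq]
  exact Finset.sum_congr rfl fun i _ => (sq _).symm

set_option maxHeartbeats 800000 in
/-- A `C²` function which is close to some quadratic polynomial in a ball is close to its Taylor
polynomial at the center. -/
theorem interior_estimate (N : ℕ) [NeZero N] : ∃ C, 0 ≤ C ∧ ∀ (ψ : Euc N → ℝ) (x : Euc N)
    (r Λ B a : ℝ) (ℓ : Euc N →L[ℝ] ℝ) (b : Euc N →L[ℝ] Euc N →L[ℝ] ℝ), ContDiff ℝ 2 ψ → 0 < r →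
    r ≤ 1 → 0 ≤ Λ → 0 ≤ B → (∀ y, ‖y - x‖ < r → |lap ψ y - lap ψ x| ≤ Λ * ‖y - x‖) →
    |lap ψ x - lap (quad a ℓ b) 0| ≤ Λ * r →
    (∀ y, ‖y - x‖ < r → |ψ y - quad a ℓ b (y - x)| ≤ B * (r ^ 2 * √r)) →
    ∀ y, ‖y - x‖ ≤ r / 2 →
      |ψ y - taylor2 ψ x (y - x)| ≤ C * (Λ + B) * (‖y - x‖ ^ 2 * √‖y - x‖) := by
  obtain ⟨C, hC, hS⟩ := pointwise_schauder_at N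
  refine ⟨2 * C, by positivity, ?_⟩
  intro ψ x r Λ B a ℓ b hψ hr hr1 hΛ hB hlap hlapx hψq y hy
  have hN : (0 : ℝ) < N := by exact_mod_cast Nat.pos_of_ne_zero (NeZero.ne N)
  have hN1 : (1 : ℝ) ≤ N := by exact_mod_cast Nat.one_le_iff_ne_zero.2 (NeZero.ne N)
  set c := lap ψ x - lap (quad a ℓ b) 0 with hc
  obtain ⟨b₀, hb₀⟩ := exists_bilin_eq_norm_sq N
  set b' := b + (c / (2 * N)) • b₀ with hb'
  have hq' : ∀ h, quad a ℓ b' h = quad a ℓ b h + c / (2 * N) * ‖h‖ ^ 2 := fun h => by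
    simp only [quad, hb', add_apply, smul_apply, smul_eq_mul, hb₀]
    ring
  have hlapq : ∀ h, lap (quad a ℓ b') h = lap ψ x := fun h => by
    have h1 : lap (quad a ℓ b') h = lap (quad a ℓ b) 0 + c := by
      rw [lap_quad, lap_quad]
      simp only [hb', add_apply, smul_apply, smul_eq_mul, hb₀, Finset.sum_add_distrib]
      simp
      field_simp
    rw [h1, hc]
    ring
  have hrs : r ≤ √r := Real.le_sqrt_of_sq_le (by nlinarith)
  let χ : ContDiffBump x := ⟨1, 2, one_pos, one_lt_two⟩
  set v : Euc N → ℝ := fun y => ψ y - quad a ℓ b' (y - x) with hv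
  have hqC : ContDiff ℝ 2 fun y => quad a ℓ b' (y - x) :=
    (contDiff_quad a ℓ b').comp (contDiff_id.sub contDiff_const)
  have hvC : ContDiff ℝ 2 v := hψ.sub hqC
  set w : Euc N → ℝ := fun y => χ y * v y with hw
  have hwC : ContDiff ℝ 2 w := χ.contDiff.mul hvC
  have hwc : HasCompactSupport w := χ.hasCompactSupport.mul_right
  have hχ1 : ∀ y, ‖y - x‖ < r → χ =ᶠ[𝓝 y] 1 := fun y hy => χ.eventuallyEq_one_of_mem_ball (by
    rw [mem_ball, dist_eq_norm]
    exact hy.trans_le hr1)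
  have hwv : ∀ y, ‖y - x‖ < r → w =ᶠ[𝓝 y] v := fun y hy => by
    filter_upwards [hχ1 y hy] with p hp
    rw [hw]
    simp only [hp, Pi.one_apply, one_mul]
  have hwlap : ∀ y, ‖y - x‖ < r → |lap w y| ≤ Λ * √‖y - x‖ := fun y hy => by
    rw [lap_congr (hwv y hy)]
    have h1 : lap (fun y => quad a ℓ b' (y - x)) y = lap ψ x := by
      have := lap_comp_const_add (quad a ℓ b') (-x) y
      simp only [neg_add_eq_sub] at this
      rw [this, hlapq]
    rw [hv, lap_sub hψ hqC, h1]
    refine (hlap y hy).trans ?_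
    gcongr
    refine Real.le_sqrt_of_sq_le ?_
    nlinarith [norm_nonneg (y - x)]
  have hwM : ∀ y, ‖y - x‖ < r → |w y| ≤ (Λ + B) * (r ^ 2 * √r) := fun y hy => by
    rw [(hwv y hy).eq_of_nhds, hv]
    simp only [hq']
    have h1 := hψq y hy
    have h2 : |c / (2 * N) * ‖y - x‖ ^ 2| ≤ Λ * (r ^ 2 * √r) := by
      rw [abs_mul, abs_div, abs_of_pos (by positivity : (0 : ℝ) < 2 * N),
        abs_of_nonneg (sq_nonneg ‖y - x‖)]
      have h3 : |c| / (2 * N) ≤ |c| := div_le_self (abs_nonneg _) (by linarith)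
      calc |c| / (2 * N) * ‖y - x‖ ^ 2 ≤ Λ * √r * r ^ 2 := by
            have h4 : |c| / (2 * N) ≤ Λ * √r := h3.trans (hlapx.trans (by gcongr))
            gcongr
        _ = _ := by ring
    rw [abs_le] at *
    constructor <;> linarith
  set T : Euc N → ℝ := fun h => taylor2 ψ x h - quad a ℓ b' h with hT
  have hTd : ∀ y, dyadicDiff T y = 0 := fun y => by
    have : T = quad (ψ x - a) (fderiv ℝ ψ x - ℓ)
        ((1 / 2 : ℝ) • fderiv ℝ (fderiv ℝ ψ) x - b') := funext fun h => by
      rw [hT]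
      simp only [taylor2_eq_quad, quad_sub]
    rw [this, dyadicDiff_quad]
  have hwT : ∀ h, ‖h‖ < r → w (x + h) - T h = ψ (x + h) - taylor2 ψ x h := fun h hh => by
    rw [(hwv (x + h) (by rwa [add_sub_cancel_left])).eq_of_nhds, hv, hT]
    simp only [add_sub_cancel_left]
    ring
  have hwo : ∀ h : Euc N, (fun t : ℝ => w (x + t • h) - T (t • h)) =o[𝓝[>] 0] fun t => t ^ 2 := by
    intro h
    rw [isLittleO_iff]
    intro ε hε
    set ε' := ε / (‖h‖ ^ 2 + 1) with hε'
    have hε'0 : 0 < ε' := by positivity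
    obtain ⟨δ, hδ, hT⟩ := eventually_abs_sub_taylor2_le hψ x hε'0
    have hev : ∀ᶠ t : ℝ in 𝓝[>] 0, ‖t • h‖ < min δ r := by
      have : Tendsto (fun t : ℝ => ‖t • h‖) (𝓝 0) (𝓝 ‖(0 : ℝ) • h‖) :=
        (show Continuous fun t : ℝ => ‖t • h‖ by fun_prop).tendsto 0
      rw [zero_smul, norm_zero] at this
      exact (this.eventually_lt_const (by positivity)).filter_mono nhdsWithin_le_nhds
    filter_upwards [hev] with t ht
    rw [hwT _ (ht.trans_le (min_le_right _ _)), Real.norm_eq_abs, Real.norm_eq_abs,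
      abs_of_nonneg (sq_nonneg t)]
    refine (hT _ (ht.trans_le (min_le_left _ _))).trans ?_
    rw [norm_smul, Real.norm_eq_abs, mul_pow, sq_abs, hε']
    have : ε / (‖h‖ ^ 2 + 1) * (t ^ 2 * ‖h‖ ^ 2) =
        ε * t ^ 2 * (‖h‖ ^ 2 / (‖h‖ ^ 2 + 1)) := by
      field_simp
    rw [this]
    refine mul_le_of_le_one_right (by positivity) ?_
    rw [div_le_one (by positivity)]
    linarith
  have hmain := hS w T x r Λ ((Λ + B) * (r ^ 2 * √r)) (hwC.differentiable (by simp))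
    (exists_lipschitzWith_fderiv hwC hwc) hr hΛ (by positivity) hwlap hwM hTd hwo y hy
  have h1 := hwT (y - x) (by linarith)
  rw [add_sub_cancel] at h1
  rw [h1] at hmain
  refine hmain.trans (mul_le_mul_of_nonneg_right ?_ (by positivity))
  rw [mul_div_cancel_right₀ _ (by positivity)]
  nlinarith

/-- `ψ` vanishes on the boundary, its first two derivatives are bounded by `K`, and its Laplacian
is Lipschitz along short paths, with constant `Λ`. -/
structure HasBounds {N : ℕ} (Ω : Set (Euc N)) (R : ℝ) (ψ : Euc N → ℝ) (K Λ : ℝ) : Prop where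
  contDiff : ContDiff ℝ 2 ψ
  eq_zero : ∀ x ∈ frontier Ω, ψ x = 0
  nonneg : 0 ≤ Λ
  norm_fderiv_le : ∀ x ∈ closure Ω, ‖fderiv ℝ ψ x‖ ≤ K
  norm_fderiv_fderiv_le : ∀ x ∈ closure Ω, ‖fderiv ℝ (fderiv ℝ ψ) x‖ ≤ K
  abs_lap_sub_le_frontier : ∀ z ∈ frontier Ω, ∀ x ∈ closure Ω, ‖x - z‖ < R / 4 →
    |lap ψ x - lap ψ z| ≤ Λ * ‖x - z‖
  abs_lap_sub_le_ball : ∀ x r, ball x r ⊆ Ω → ∀ y ∈ ball x r, |lap ψ y - lap ψ x| ≤ Λ * ‖y - x‖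

/-- A nearest boundary point. -/
theorem exists_frontier_ball_subset {N : ℕ} [NeZero N] {Ω : Set (Euc N)} (hΩ : IsOpen Ω)
    (hb : Bornology.IsBounded Ω) {x : Euc N} (hx : x ∈ Ω) :
    ∃ z ∈ frontier Ω, ball x ‖x - z‖ ⊆ Ω ∧ 0 < ‖x - z‖ := by
  have hne : Ωᶜ.Nonempty := by
    rw [nonempty_compl]
    rintro rfl
    exact NormedSpace.unbounded_univ ℝ (Euc N) hb
  obtain ⟨z, hz, hd⟩ := hΩ.isClosed_compl.exists_infDist_eq_dist hne x
  rw [dist_eq_norm] at hd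
  have hsub : ball x ‖x - z‖ ⊆ Ω := by
    rw [← hd, ← disjoint_compl_right_iff_subset]
    exact disjoint_ball_infDist
  have hpos : 0 < ‖x - z‖ := norm_pos_iff.2 (sub_ne_zero.2 fun h => hz (h ▸ hx))
  refine ⟨z, ?_, hsub, hpos⟩
  rw [hΩ.frontier_eq]
  refine ⟨closure_mono hsub ?_, hz⟩
  rw [closure_ball x hpos.ne', mem_closedBall, dist_comm, dist_eq_norm]

set_option maxHeartbeats 800000 in
/-- A `C²` function with the given bounds is approximated by its Taylor polynomials to order
`5 / 2`, uniformly up to the boundary. -/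
theorem taylor_estimate (N : ℕ) [NeZero N] {Ω : Set (Euc N)} (hΩ : IsOpen Ω)
    (hb : Bornology.IsBounded Ω) {R C : ℝ} (hR : 0 < R) (hR1 : R ≤ 1) (hC : 1 ≤ C)
    (hc : ∀ z ∈ frontier Ω, Nonempty (BoundaryChart Ω z R C)) :
    ∃ C₁, 0 ≤ C₁ ∧ ∀ (ψ : Euc N → ℝ) (K Λ : ℝ), HasBounds Ω R ψ K Λ →
      ∀ x ∈ closure Ω, ∀ y ∈ Ω, ‖y - x‖ ≤ R / 160 →
        |ψ y - taylor2 ψ x (y - x)| ≤ C₁ * (K + Λ) * (‖y - x‖ ^ 2 * √‖y - x‖) := by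
  obtain ⟨C₁, hC₁, hbd⟩ := boundary_estimate N hR hR1 hC
  obtain ⟨C₂, hC₂, hin⟩ := interior_estimate N
  set R₀ := R / 80 with hR₀
  have hR₀0 : 0 < R₀ := by positivity
  set Ca := C₂ * (1 + 2 / √R₀) with hCa
  set Cb := C₂ * (1 + 8 * C₁) with hCb
  have hCa0 : 0 ≤ Ca := by positivity
  have hCb0 : 0 ≤ Cb := by positivity
  refine ⟨C₁ + Ca + Cb + (18 * C₁ + 32 * (8 * C₁ + Cb)), by positivity, ?_⟩
  intro ψ K Λ hψ x hx y hy hyx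
  have hK0 : 0 ≤ K := (norm_nonneg _).trans (hψ.norm_fderiv_le x hx)
  have hΛ := hψ.nonneg
  set S := K + Λ with hS
  have hS0 : 0 ≤ S := by positivity
  suffices h : |ψ y - taylor2 ψ x (y - x)| ≤ C₁ * S * (‖y - x‖ ^ 2 * √‖y - x‖) ∨
      |ψ y - taylor2 ψ x (y - x)| ≤ Ca * S * (‖y - x‖ ^ 2 * √‖y - x‖) ∨
      |ψ y - taylor2 ψ x (y - x)| ≤ Cb * S * (‖y - x‖ ^ 2 * √‖y - x‖) ∨
      |ψ y - taylor2 ψ x (y - x)| ≤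
        (18 * C₁ + 32 * (8 * C₁ + Cb)) * S * (‖y - x‖ ^ 2 * √‖y - x‖) by
    rcases h with h | h | h | h
    all_goals
      refine h.trans (mul_le_mul_of_nonneg_right (mul_le_mul_of_nonneg_right ?_ hS0) (by positivity))
      linarith
  have hfr : ∀ z ∈ frontier Ω, ∀ y ∈ Ω, ‖y - z‖ ≤ R / 40 →
      |ψ y - taylor2 ψ z (y - z)| ≤ C₁ * S * (‖y - z‖ ^ 2 * √‖y - z‖) := fun z hz y hy hyz => by
    obtain ⟨c⟩ := hc z hz
    exact hbd Ω z c ψ K Λ hΩ hψ.contDiff hψ.eq_zero hΛ hψ.norm_fderiv_le hψ.norm_fderiv_fderiv_le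
      (hψ.abs_lap_sub_le_frontier z hz) y hy hyz
  by_cases hxΩ : x ∈ Ω
  swap
  · exact .inl (hfr x (hΩ.frontier_eq ▸ ⟨hx, hxΩ⟩) y hy (by linarith))
  obtain ⟨z, hz, hsub, hd0⟩ := exists_frontier_ball_subset hΩ hb hxΩ
  set d := ‖x - z‖ with hd
  have hlapT : ∀ z, lap (quad (ψ z) (fderiv ℝ ψ z) ((1 / 2 : ℝ) • fderiv ℝ (fderiv ℝ ψ) z)) 0 =
      lap ψ z := fun z => by
    rw [lap_quad]
    simp only [smul_apply, smul_eq_mul, ← Finset.mul_sum]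
    rw [lap]
    ring
  rcases le_or_gt R₀ d with hdR | hdR
  · refine .inr (.inl ?_)
    have hsub' : ball x R₀ ⊆ Ω := (ball_subset_ball hdR).trans hsub
    have := hin ψ x R₀ Λ (2 * K / √R₀) (ψ x) (fderiv ℝ ψ x)
      ((1 / 2 : ℝ) • fderiv ℝ (fderiv ℝ ψ) x) hψ.contDiff hR₀0 (by linarith) hΛ (by positivity)
      (fun y hy => hψ.abs_lap_sub_le_ball x R₀ hsub' y (by rwa [mem_ball, dist_eq_norm]))
      (by rw [hlapT, sub_self, abs_zero]; positivity)
      (fun y hy => by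
        rw [← taylor2_eq_quad]
        have h1 := abs_sub_taylor2_le hψ.contDiff (a := x) (h := y - x) (ε := 2 * K) fun s hs => by
          have h2 : x + s • (y - x) ∈ Ω := hsub' (by
            rw [mem_ball, dist_eq_norm, add_sub_cancel_left, norm_smul, Real.norm_of_nonneg hs.1]
            exact (mul_le_of_le_one_left (norm_nonneg _) hs.2).trans_lt hy)
          have h3 := hψ.norm_fderiv_fderiv_le _ (subset_closure h2)
          have h4 := hψ.norm_fderiv_fderiv_le x hx
          exact (norm_sub_le _ _).trans (by linarith)
        rw [add_sub_cancel] at h1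
        refine h1.trans ?_
        have : 2 * K / √R₀ * (R₀ ^ 2 * √R₀) = 2 * K * R₀ ^ 2 := by
          field_simp
        rw [this]
        gcongr) y (by linarith)
    refine this.trans (mul_le_mul_of_nonneg_right ?_ (by positivity))
    rw [hCa, mul_assoc]
    refine mul_le_mul_of_nonneg_left ?_ hC₂
    rw [hS]
    have : 0 ≤ 2 / √R₀ * Λ := by positivity
    have : 2 * K / √R₀ = 2 / √R₀ * K := by ring
    linarith
  · have hd1 : d ≤ 1 := by linarith
    have hsqd : √(2 * d) ≤ 2 * √d := by
      rw [Real.sqrt_le_left (by positivity), mul_pow, Real.sq_sqrt hd0.le]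
      linarith
    have hyz : ∀ y, ‖y - x‖ < d → |ψ y - taylor2 ψ z (y - z)| ≤ 8 * C₁ * S * (d ^ 2 * √d) :=
      fun y hy => by
      have h1 : ‖y - z‖ ≤ 2 * d := by
        have := norm_sub_le_norm_sub_add_norm_sub y x z
        linarith
      refine (hfr z hz y (hsub (by rwa [mem_ball, dist_eq_norm])) (by linarith)).trans ?_
      calc C₁ * S * (‖y - z‖ ^ 2 * √‖y - z‖) ≤ C₁ * S * ((2 * d) ^ 2 * (2 * √d)) := by
            gcongr
            exact (Real.sqrt_le_sqrt h1).trans hsqd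
        _ = _ := by ring
    obtain ⟨a, ℓ, b, hab, hlab⟩ : ∃ a ℓ b, (∀ h, quad a ℓ b h = taylor2 ψ z (x - z + h)) ∧
        lap (quad a ℓ b) 0 = lap ψ z := by
      set b : Euc N →L[ℝ] Euc N →L[ℝ] ℝ := (1 / 2 : ℝ) • fderiv ℝ (fderiv ℝ ψ) z with hb
      refine ⟨quad (ψ z) (fderiv ℝ ψ z) b (x - z), fderiv ℝ ψ z + b (x - z) + b.flip (x - z), b,
        fun h => ?_, ?_⟩
      · rw [taylor2_eq_quad, quad_add]
      · rw [← hlapT z, lap_quad, lap_quad]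
    have hxz : ∀ y, x - z + (y - x) = y - z := fun y => by abel
    have hnear := hin ψ x d Λ (8 * C₁ * S) a ℓ b hψ.contDiff hd0 hd1 hΛ (by positivity)
      (fun y hy => hψ.abs_lap_sub_le_ball x d hsub y (by rwa [mem_ball, dist_eq_norm]))
      (by
        rw [hlab]
        exact hψ.abs_lap_sub_le_frontier z hz x hx (by linarith))
      (fun y hy => by
        rw [hab, hxz]
        exact hyz y hy)
    have hnear' : ∀ y, ‖y - x‖ ≤ d / 2 →
        |ψ y - taylor2 ψ x (y - x)| ≤ Cb * S * (‖y - x‖ ^ 2 * √‖y - x‖) := fun y hy => by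
      refine (hnear y hy).trans (mul_le_mul_of_nonneg_right ?_ (by positivity))
      have h1 : Λ + 8 * C₁ * S ≤ (1 + 8 * C₁) * S := by linarith
      rw [hCb, mul_assoc C₂]
      exact mul_le_mul_of_nonneg_left h1 hC₂
    rcases le_or_gt ‖y - x‖ (d / 2) with hyd | hyd
    · exact .inr (.inr (.inl (hnear' y hyd)))
    · refine .inr (.inr (.inr ?_))
      set n := ‖y - x‖ with hn
      have hn0 : 0 < n := by linarith
      have hsqn : √(3 * n) ≤ 2 * √n := by
        rw [Real.sqrt_le_left (by positivity), mul_pow, Real.sq_sqrt hn0.le]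
        linarith
      have hsqdn : √d ≤ 2 * √n := by
        rw [Real.sqrt_le_left (by positivity), mul_pow, Real.sq_sqrt hn0.le]
        linarith
      have hq : ∀ h, taylor2 ψ z (x - z + h) - taylor2 ψ x h = quad (a - ψ x) (ℓ - fderiv ℝ ψ x)
          (b - (1 / 2 : ℝ) • fderiv ℝ (fderiv ℝ ψ) x) h := fun h => by
        rw [← hab, taylor2_eq_quad, quad_sub]
      have hg := abs_quad_le (a - ψ x) (ℓ - fderiv ℝ ψ x)
        (b - (1 / 2 : ℝ) • fderiv ℝ (fderiv ℝ ψ) x) (B := (8 * C₁ + Cb) * S * (d ^ 2 * √d))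
        (ρ := d / 2) (by positivity) (fun h hh => by
          rw [← hq]
          have h1 := hyz (x + h) (by rw [add_sub_cancel_left]; linarith)
          have h2 := hnear' (x + h) (by rwa [add_sub_cancel_left])
          rw [add_sub_cancel_left] at h2
          have h3 : Cb * S * (‖h‖ ^ 2 * √‖h‖) ≤ Cb * S * (d ^ 2 * √d) := by
            have : ‖h‖ ≤ d := by linarith
            gcongr
          have h4 : x + h - z = x - z + h := by abel
          rw [h4] at h1
          rw [abs_le] at *
          constructor <;> linarith) (h := y - x) hyd.le
      rw [← hq, hxz, ← hn] at hg
      have hyz' : ‖y - z‖ ≤ 3 * n := by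
        have := norm_sub_le_norm_sub_add_norm_sub y x z
        linarith
      have h1 := hfr z hz y hy (by
        have := norm_sub_le_norm_sub_add_norm_sub y x z
        linarith)
      have h2 : C₁ * S * (‖y - z‖ ^ 2 * √‖y - z‖) ≤ C₁ * S * ((3 * n) ^ 2 * (2 * √n)) := by
        gcongr
        exact (Real.sqrt_le_sqrt hyz').trans hsqn
      have h3 : 4 * ((8 * C₁ + Cb) * S * (d ^ 2 * √d)) * (n ^ 2 / (d / 2) ^ 2) =
          16 * (8 * C₁ + Cb) * S * n ^ 2 * √d := by
        field_simp
        ring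
      have h4 : 16 * (8 * C₁ + Cb) * S * n ^ 2 * √d ≤
          16 * (8 * C₁ + Cb) * S * n ^ 2 * (2 * √n) := by gcongr
      rw [h3] at hg
      have h5 : |ψ y - taylor2 ψ x (y - x)| ≤ |ψ y - taylor2 ψ z (y - z)| +
          |taylor2 ψ z (y - z) - taylor2 ψ x (y - x)| := abs_sub_le _ _ _
      refine h5.trans ((add_le_add (h1.trans h2) (hg.trans h4)).trans (le_of_eq ?_))
      ring

theorem BoundaryChart.F_nonpos {N : ℕ} {Ω : Set (Euc N)} {z : Euc N} {R C : ℝ}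
    (c : BoundaryChart Ω z R C) {x : Euc N} (hx : x ∈ closure Ω) (hxR : x ∈ ball z R) :
    c.F x ≤ 0 := by
  by_contra! hcon
  have h1 : ∀ᶠ y in 𝓝 x, y ∈ ball z R := isOpen_ball.mem_nhds hxR
  have h2 := h1.and (c.contDiff_F.continuous.continuousAt.eventually_const_lt hcon)
  obtain ⟨y, ⟨hyR, hy⟩, hyΩ⟩ := mem_closure_iff_nhds.1 hx _ h2
  exact lt_asymm hy ((c.mem_iff y hyR).1 hyΩ)

/-- Every point of the closure is close to a ball of comparable size inside the domain. -/
theorem exists_ball_subset {N : ℕ} [NeZero N] {Ω : Set (Euc N)} (hΩ : IsOpen Ω)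
    (hb : Bornology.IsBounded Ω) {R C : ℝ}
    (hc : ∀ z ∈ frontier Ω, Nonempty (BoundaryChart Ω z R C)) {x : Euc N} (hx : x ∈ closure Ω)
    {s : ℝ} (hs : 0 < s) (hsR : 2 * s ≤ R) : ∃ v, ‖v‖ ≤ 2 * s ∧ ball (x + v) (s / 2) ⊆ Ω := by
  have key : ∀ z ∈ frontier Ω, ‖x - z‖ ≤ s → ∃ v, ‖v‖ ≤ 2 * s ∧ ball (x + v) (s / 2) ⊆ Ω := by
    intro z hz hxz
    obtain ⟨c⟩ := hc z hz
    refine ⟨z - s • c.e - x, ?_, fun y hy => ?_⟩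
    · rw [sub_right_comm]
      refine (norm_sub_le _ _).trans ?_
      rw [norm_smul, c.norm_e, Real.norm_of_nonneg hs.le, norm_sub_rev]
      linarith
    · rw [add_sub_cancel, mem_ball, dist_eq_norm] at hy
      have h1 : z - s • c.e ∈ ball z R := by
        rw [mem_ball, dist_eq_norm, sub_sub_cancel_left, norm_neg, norm_smul, c.norm_e,
          Real.norm_of_nonneg hs.le]
        linarith
      have h2 : y ∈ ball z R := by
        rw [mem_ball, dist_eq_norm]
        refine (norm_sub_le_norm_sub_add_norm_sub y (z - s • c.e) z).trans_lt ?_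
        rw [sub_sub_cancel_left, norm_neg, norm_smul, c.norm_e, Real.norm_of_nonneg hs.le]
        linarith
      have hzR : z ∈ ball z R := mem_ball_self (by linarith)
      have h3 := c.add_le_F hs.le h1 (by rwa [sub_add_cancel])
      rw [sub_add_cancel, c.F_center] at h3
      have h4 := (abs_le.1 (c.abs_F_sub_le h2 h1)).2
      exact (c.mem_iff y h2).2 (by linarith)
  by_cases hxΩ : x ∈ Ω
  swap
  · exact key x (hΩ.frontier_eq ▸ ⟨hx, hxΩ⟩) (by simpa using hs.le)
  obtain ⟨z, hz, hsub, hd0⟩ := exists_frontier_ball_subset hΩ hb hxΩ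
  rcases le_total ‖x - z‖ s with h | h
  · exact key z hz h
  · refine ⟨0, by simpa using hs.le, (ball_subset_ball ?_).trans (by simpa using hsub)⟩
    linarith

theorem norm_le_of_abs_apply_self_le {E : Type*} [NormedAddCommGroup E] [InnerProductSpace ℝ E]
    {b : E →L[ℝ] E →L[ℝ] ℝ} (hb : ∀ h k, b h k = b k h) {A : ℝ}
    (hA0 : 0 ≤ A) (hA : ∀ h, |b h h| ≤ A * ‖h‖ ^ 2) : ‖b‖ ≤ A := by
  refine ContinuousLinearMap.opNorm_le_bound₂ _ hA0 fun h k => ?_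
  have h1 : ∀ h k, 4 * |b h k| ≤ 2 * A * (‖h‖ ^ 2 + ‖k‖ ^ 2) := fun h k => by
    have h2 := hA (h + k)
    have h3 := hA (h - k)
    have h4 : 4 * b h k = b (h + k) (h + k) - b (h - k) (h - k) := by
      simp only [map_add, map_sub, add_apply, sub_apply, hb k h]
      ring
    have h5 : 4 * |b h k| = |4 * b h k| := by rw [abs_mul, abs_of_pos (by norm_num : (0 : ℝ) < 4)]
    have h6 := parallelogram_law_with_norm ℝ h k
    rw [h5, h4]
    refine (abs_sub _ _).trans ?_
    nlinarith
  rcases eq_or_ne h 0 with rfl | hh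
  · simp
  rcases eq_or_ne k 0 with rfl | hk
  · simp
  have h2 := h1 (‖k‖ • h) (‖h‖ • k)
  have hh' := norm_pos_iff.2 hh
  have hk' := norm_pos_iff.2 hk
  simp only [map_smul, smul_apply, smul_eq_mul, norm_smul, norm_norm, abs_mul, abs_norm] at h2
  rw [Real.norm_eq_abs]
  have h3 : 0 < ‖h‖ * ‖k‖ := by positivity
  nlinarith

/-- Bounds for the coefficients of a quadratic polynomial in terms of its size on a ball. -/
theorem norm_quad_le {N : ℕ} {a : ℝ} {ℓ : Euc N →L[ℝ] ℝ} {b : Euc N →L[ℝ] Euc N →L[ℝ] ℝ}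
    (hb : ∀ h k, b h k = b k h) {v : Euc N} {ρ B : ℝ} (hρ : 0 < ρ)
    (hB : ∀ k, ‖k‖ ≤ ρ → |quad a ℓ b (v + k)| ≤ B) :
    ‖b‖ ≤ 2 * B / ρ ^ 2 ∧ ‖ℓ‖ ≤ B / ρ + 2 * ‖b‖ * ‖v‖ := by
  have hB0 : 0 ≤ B := (abs_nonneg _).trans (hB 0 (by simpa using hρ.le))
  have hscale : ∀ k : Euc N, k ≠ 0 → ‖(ρ / ‖k‖) • k‖ = ρ := fun k hk => by
    rw [norm_smul, norm_div, norm_norm, Real.norm_of_nonneg hρ.le,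
      div_mul_cancel₀ _ (norm_ne_zero_iff.2 hk)]
  constructor
  · refine norm_le_of_abs_apply_self_le hb (by positivity) fun k => ?_
    rcases eq_or_ne k 0 with rfl | hk
    · simp
    have hk' := norm_pos_iff.2 hk
    have h0 := hB 0 (by simpa using hρ.le)
    have h1 := hB _ (hscale k hk).le
    have h2 := hB (-((ρ / ‖k‖) • k)) (by rw [norm_neg, hscale k hk])
    simp only [quad, map_add, map_neg, map_smul, add_apply, neg_apply, smul_apply,
      smul_eq_mul, add_zero] at h0 h1 h2
    have h3 : |(ρ / ‖k‖) ^ 2 * b k k| ≤ 2 * B := by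
      rw [abs_le] at *
      constructor <;> linarith
    rw [abs_mul, abs_of_pos (by positivity : 0 < (ρ / ‖k‖) ^ 2), div_pow, div_mul_eq_mul_div,
      div_le_iff₀ (by positivity)] at h3
    rw [div_mul_eq_mul_div, le_div_iff₀ (by positivity)]
    linarith
  · refine ContinuousLinearMap.opNorm_le_bound _ (by positivity) fun k => ?_
    rcases eq_or_ne k 0 with rfl | hk
    · simp
    have hk' := norm_pos_iff.2 hk
    have h1 := hB _ (hscale k hk).le
    have h2 := hB (-((ρ / ‖k‖) • k)) (by rw [norm_neg, hscale k hk])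
    simp only [quad, map_add, map_neg, map_smul, add_apply, neg_apply, smul_apply,
      smul_eq_mul, hb k v] at h1 h2
    have h3 : |ρ / ‖k‖ * (ℓ k + 2 * b v k)| ≤ B := by
      rw [abs_le] at *
      constructor <;> linarith
    rw [abs_mul, abs_of_pos (by positivity : 0 < ρ / ‖k‖), div_mul_eq_mul_div,
      div_le_iff₀ hk', ← le_div_iff₀' hρ] at h3
    have h4 := abs_apply_apply_le (le_refl ‖b‖) v k
    rw [Real.norm_eq_abs]
    have h5 : B * ‖k‖ / ρ = B / ρ * ‖k‖ := by ring
    rw [h5] at h3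
    rw [abs_le] at *
    constructor <;> linarith

theorem fderiv_fderiv_symm {N : ℕ} {ψ : Euc N → ℝ} (hψ : ContDiff ℝ 2 ψ) (x h k : Euc N) :
    fderiv ℝ (fderiv ℝ ψ) x h k = fderiv ℝ (fderiv ℝ ψ) x k h :=
  (hψ.contDiffAt.isSymmSndFDerivAt (by simp)) h k

theorem hasBounds_of_abs_lap_sub_le {N : ℕ} {Ω : Set (Euc N)} {R C : ℝ} (hR : 0 < R)
    (hc : ∀ z ∈ frontier Ω, Nonempty (BoundaryChart Ω z R C)) {ψ : Euc N → ℝ} {K L : ℝ}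
    (hψ : ContDiff ℝ 2 ψ) (h0 : ∀ x ∈ frontier Ω, ψ x = 0) (hL : 0 ≤ L) (hK : 0 ≤ K)
    (hK₁ : ∀ x ∈ closure Ω, ‖fderiv ℝ ψ x‖ ≤ K)
    (hK₂ : ∀ x ∈ closure Ω, ‖fderiv ℝ (fderiv ℝ ψ) x‖ ≤ K)
    (hlap : ∀ x ∈ closure Ω, ∀ y ∈ closure Ω, |lap ψ x - lap ψ y| ≤ L * |ψ x - ψ y|) :
    HasBounds Ω R ψ K (5 * L * K) where
  contDiff := hψ
  eq_zero := h0
  nonneg := by positivity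
  norm_fderiv_le := hK₁
  norm_fderiv_fderiv_le := hK₂
  abs_lap_sub_le_frontier z hz x hx hxz := by
    obtain ⟨c⟩ := hc z hz
    have h1 := c.norm_sub_center_le (hψ.differentiable (by simp))
      (fun y hy hFy => hK₁ y (c.mem_closure hy hFy)) hxz
      (c.F_nonpos hx (by rw [mem_ball, dist_eq_norm]; linarith))
    rw [Real.norm_eq_abs] at h1
    refine (hlap x hx z (frontier_subset_closure hz)).trans ?_
    calc L * |ψ x - ψ z| ≤ L * (5 * K * ‖x - z‖) := by gcongr
      _ = _ := by ring
  abs_lap_sub_le_ball x r hsub y hy := by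
    have hx : x ∈ ball x r := mem_ball_self (dist_nonneg.trans_lt hy)
    have h1 := (convex_ball x r).norm_image_sub_le_of_norm_fderiv_le
      (fun y _ => hψ.differentiable (by simp) y) (fun y hy => hK₁ y (subset_closure (hsub hy))) hx hy
    rw [Real.norm_eq_abs] at h1
    refine (hlap y (subset_closure (hsub hy)) x (subset_closure (hsub hx))).trans ?_
    calc L * |ψ y - ψ x| ≤ L * (K * ‖y - x‖) := by gcongr
      _ ≤ 5 * L * K * ‖y - x‖ := by
        have : 0 ≤ L * K * ‖y - x‖ := by positivity
        linarith

set_option maxHeartbeats 800000 in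
/-- Global Schauder estimate: a `C²` function vanishing on the boundary whose Laplacian is a
Lipschitz function of its values is bounded in `C^{2,1/2}` in terms of its supremum. -/
theorem schauder_estimate (N : ℕ) [NeZero N] {Ω : Set (Euc N)} (hΩ : IsOpen Ω)
    (hb : Bornology.IsBounded Ω) {R C : ℝ} (hR : 0 < R) (hR1 : R ≤ 1) (hC : 1 ≤ C)
    (hc : ∀ z ∈ frontier Ω, Nonempty (BoundaryChart Ω z R C)) {M L : ℝ} (hM : 0 ≤ M) (hL : 0 ≤ L) :
    ∃ C', ∀ (ψ : Euc N → ℝ), ContDiff ℝ 2 ψ → (∀ x ∈ frontier Ω, ψ x = 0) →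
      (∀ x ∈ closure Ω, |ψ x| ≤ M) →
      (∀ x ∈ closure Ω, ∀ y ∈ closure Ω, |lap ψ x - lap ψ y| ≤ L * |ψ x - ψ y|) →
      ∀ x ∈ closure Ω, ‖fderiv ℝ ψ x‖ ≤ C' ∧ ‖fderiv ℝ (fderiv ℝ ψ) x‖ ≤ C' ∧
        ∀ y ∈ closure Ω,
          ‖fderiv ℝ (fderiv ℝ ψ) x - fderiv ℝ (fderiv ℝ ψ) y‖ ≤ C' * √‖x - y‖ := by
  obtain ⟨C₁, hC₁, hT⟩ := taylor_estimate N hΩ hb hR hR1 hC hc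
  set Q := C₁ * (1 + 5 * L) with hQ
  have hQ0 : 0 ≤ Q := by positivity
  set s := min (R / 1000) (1 / (3 * (2376 * Q + 1) ^ 2)) with hs
  have hs0 : 0 < s := by positivity
  have hsR : s ≤ R / 1000 := min_le_left _ _
  have hs3 : √(3 * s) ≤ 1 / (2376 * Q + 1) := by
    rw [Real.sqrt_le_left (by positivity)]
    have : s ≤ 1 / (3 * (2376 * Q + 1) ^ 2) := min_le_right _ _
    calc 3 * s ≤ 3 * (1 / (3 * (2376 * Q + 1) ^ 2)) := by gcongr
      _ = _ := by field_simp
  set K₀ := 264 * M / s ^ 2 with hK₀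
  have hK₀0 : 0 ≤ K₀ := by positivity
  refine ⟨K₀ + 4096 * Q * K₀ + 2 * K₀ / √(R / 1000), fun ψ hψ h0 hψM hlap => ?_⟩
  have hψ1 : ContDiff ℝ 1 (fderiv ℝ ψ) := hψ.fderiv_right (by norm_num)
  have hcont : Continuous fun x => max ‖fderiv ℝ ψ x‖ ‖fderiv ℝ (fderiv ℝ ψ) x‖ :=
    (hψ.continuous_fderiv (by simp)).norm.max (hψ1.continuous_fderiv (by simp)).norm
  have hcpt : IsCompact (closure Ω) := hb.isCompact_closure
  have hquad : ∀ x ∈ closure Ω, ∀ t, 0 < t → t ≤ R / 1000 → ∃ v, ‖v‖ ≤ 2 * t ∧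
      ∀ k, ‖k‖ ≤ t / 4 → x + (v + k) ∈ Ω ∧ ‖v + k‖ ≤ 3 * t := fun x hx t ht htR => by
    obtain ⟨v, hv, hsub⟩ := exists_ball_subset hΩ hb hc hx ht (by linarith)
    refine ⟨v, hv, fun k hk => ⟨hsub ?_, ?_⟩⟩
    · rw [← add_assoc, mem_ball, dist_eq_norm, add_sub_cancel_left]
      linarith
    · refine (norm_add_le _ _).trans ?_
      linarith
  have hK : ∀ x ∈ closure Ω, ‖fderiv ℝ ψ x‖ ≤ K₀ ∧ ‖fderiv ℝ (fderiv ℝ ψ) x‖ ≤ K₀ := by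
    intro x₁ hx₁
    obtain ⟨x, hx, hmax⟩ := hcpt.exists_isMaxOn ⟨x₁, hx₁⟩ hcont.continuousOn
    set K := max ‖fderiv ℝ ψ x‖ ‖fderiv ℝ (fderiv ℝ ψ) x‖ with hKdef
    have hK0 : 0 ≤ K := (norm_nonneg _).trans (le_max_left _ _)
    have hB := hasBounds_of_abs_lap_sub_le hR hc hψ h0 hL hK0
      (fun y hy => (le_max_left _ _).trans (hmax hy))
      (fun y hy => (le_max_right _ _).trans (hmax hy)) hlap
    obtain ⟨v, hv, hk⟩ := hquad x hx s hs0 hsR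
    set B := M + Q * K * ((3 * s) ^ 2 * √(3 * s)) with hBdef
    have hB0 : 0 ≤ B := by positivity
    have hq : ∀ k, ‖k‖ ≤ s / 4 → |quad (ψ x) (fderiv ℝ ψ x)
        ((1 / 2 : ℝ) • fderiv ℝ (fderiv ℝ ψ) x) (v + k)| ≤ B := fun k hks => by
      obtain ⟨h1, h2⟩ := hk k hks
      have h3 := hT ψ K (5 * L * K) hB x hx _ h1 (by rw [add_sub_cancel_left]; linarith)
      rw [add_sub_cancel_left, taylor2_eq_quad] at h3
      have h4 : C₁ * (K + 5 * L * K) * (‖v + k‖ ^ 2 * √‖v + k‖) ≤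
          Q * K * ((3 * s) ^ 2 * √(3 * s)) := by
        have : C₁ * (K + 5 * L * K) = Q * K := by rw [hQ]; ring
        rw [this]
        gcongr
      have h5 := hψM _ (subset_closure h1)
      rw [abs_le] at *
      constructor <;> linarith
    obtain ⟨hb1, hl1⟩ := norm_quad_le (fun h k => by
      simp only [smul_apply, fderiv_fderiv_symm hψ x h k]) (by positivity : 0 < s / 4) hq
    have hb2 : ‖(1 / 2 : ℝ) • fderiv ℝ (fderiv ℝ ψ) x‖ = 1 / 2 * ‖fderiv ℝ (fderiv ℝ ψ) x‖ := by
      rw [norm_smul, Real.norm_of_nonneg (by norm_num)]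
    rw [hb2] at hb1 hl1
    have e1 : 2 * B / (s / 4) ^ 2 = 32 * (B / s ^ 2) := by
      field_simp
      ring
    have hBs : 0 ≤ B / s ^ 2 := by positivity
    have hs1 : s ≤ 1 := by linarith
    rw [e1] at hb1
    have hD2 : ‖fderiv ℝ (fderiv ℝ ψ) x‖ ≤ 132 * (B / s ^ 2) := by linarith
    have hD1 : ‖fderiv ℝ ψ x‖ ≤ 132 * (B / s ^ 2) := by
      have h1 : B / (s / 4) ≤ 4 * (B / s ^ 2) := by
        have : B / (s / 4) = 4 * (B / s ^ 2) * s := by field_simp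
        rw [this]
        exact mul_le_of_le_one_right (by positivity) hs1
      have h2 : 2 * (1 / 2 * ‖fderiv ℝ (fderiv ℝ ψ) x‖) * ‖v‖ ≤ 64 * (B / s ^ 2) * 2 := by
        have hv2 : ‖v‖ ≤ 2 := by linarith
        have e : 2 * (1 / 2 * ‖fderiv ℝ (fderiv ℝ ψ) x‖) ≤ 64 * (B / s ^ 2) := by linarith
        exact mul_le_mul e hv2 (norm_nonneg _) (by positivity)
      linarith
    have hKB : K ≤ 132 * (B / s ^ 2) := max_le hD1 hD2
    have e2 : 132 * (B / s ^ 2) = 132 * M / s ^ 2 + 1188 * Q * K * √(3 * s) := by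
      rw [hBdef]
      field_simp
      ring
    have e3 : 1188 * Q * K * √(3 * s) ≤ K / 2 := by
      have : 1188 * Q * √(3 * s) ≤ 1 / 2 := by
        calc 1188 * Q * √(3 * s) ≤ 1188 * Q * (1 / (2376 * Q + 1)) := by gcongr
          _ ≤ 1 / 2 := by
            rw [mul_one_div, div_le_div_iff₀ (by positivity) (by norm_num)]
            linarith
      nlinarith
    have hKK : K ≤ K₀ := by
      have : K₀ = 2 * (132 * M / s ^ 2) := by rw [hK₀]; ring
      linarith
    exact ⟨((le_max_left _ _).trans (hmax hx₁)).trans hKK,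
      ((le_max_right _ _).trans (hmax hx₁)).trans hKK⟩
  have hbd := hasBounds_of_abs_lap_sub_le hR hc hψ h0 hL hK₀0 (fun y hy => (hK y hy).1)
    (fun y hy => (hK y hy).2) hlap
  have hc1 : 0 ≤ 4096 * Q * K₀ := by positivity
  have hc2 : 0 ≤ 2 * K₀ / √(R / 1000) := by positivity
  intro x hx
  refine ⟨by linarith [(hK x hx).1], by linarith [(hK x hx).2], fun y hy => ?_⟩
  set t := ‖x - y‖ with ht
  have ht0 : 0 ≤ t := norm_nonneg _
  rcases ht0.eq_or_lt with ht00 | ht00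
  · have : x = y := sub_eq_zero.1 (norm_eq_zero.1 (by rw [← ht, ← ht00]))
    rw [this, sub_self, norm_zero]
    positivity
  rcases le_or_gt t (R / 1000) with htR | htR
  · suffices h : ‖fderiv ℝ (fderiv ℝ ψ) x - fderiv ℝ (fderiv ℝ ψ) y‖ ≤ 4096 * Q * K₀ * √t by
      refine h.trans ?_
      gcongr
      linarith
    obtain ⟨v, hv, hk⟩ := hquad x hx t ht00 htR
    set b : Euc N →L[ℝ] Euc N →L[ℝ] ℝ := (1 / 2 : ℝ) • fderiv ℝ (fderiv ℝ ψ) y with hbdef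
    have hq : ∀ k, ‖k‖ ≤ t / 4 → |quad (ψ x - quad (ψ y) (fderiv ℝ ψ y) b (x - y))
        (fderiv ℝ ψ x - (fderiv ℝ ψ y + b (x - y) + b.flip (x - y)))
        ((1 / 2 : ℝ) • fderiv ℝ (fderiv ℝ ψ) x - b) (v + k)| ≤ 64 * Q * K₀ * (t ^ 2 * √t) := by
      intro k hkt
      obtain ⟨h1, h2⟩ := hk k hkt
      rw [← quad_sub, ← quad_add, ← taylor2_eq_quad, ← taylor2_eq_quad]
      have e : x + (v + k) - y = x - y + (v + k) := by abel
      have h3 : ‖x + (v + k) - y‖ ≤ 4 * t := by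
        rw [e]
        refine (norm_add_le _ _).trans ?_
        linarith
      have h4 := hT ψ K₀ _ hbd x hx _ h1 (by rw [add_sub_cancel_left]; linarith)
      have h5 := hT ψ K₀ _ hbd y hy _ h1 (by linarith)
      rw [add_sub_cancel_left] at h4
      have hQK : C₁ * (K₀ + 5 * L * K₀) = Q * K₀ := by rw [hQ]; ring
      have hsq : √(4 * t) = 2 * √t := by
        rw [Real.sqrt_mul (by norm_num), show (4 : ℝ) = 2 ^ 2 by norm_num,
          Real.sqrt_sq (by norm_num)]
      have h6 : ∀ n : ℝ, 0 ≤ n → n ≤ 4 * t → C₁ * (K₀ + 5 * L * K₀) * (n ^ 2 * √n) ≤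
          32 * Q * K₀ * (t ^ 2 * √t) := fun n hn0 hn => by
        rw [hQK]
        calc Q * K₀ * (n ^ 2 * √n) ≤ Q * K₀ * ((4 * t) ^ 2 * √(4 * t)) := by gcongr
          _ = _ := by rw [hsq]; ring
      have h7 := h4.trans (h6 _ (norm_nonneg _) (by linarith))
      have h8 := h5.trans (h6 _ (norm_nonneg _) h3)
      rw [e] at h8
      rw [abs_le] at *
      constructor <;> linarith
    obtain ⟨hb1, -⟩ := norm_quad_le (fun h k => by
      simp only [hbdef, sub_apply, smul_apply, fderiv_fderiv_symm hψ x h k,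
        fderiv_fderiv_symm hψ y h k]) (by positivity : 0 < t / 4) hq
    rw [hbdef, ← smul_sub, norm_smul, Real.norm_of_nonneg (by norm_num)] at hb1
    have e1 : 2 * (64 * Q * K₀ * (t ^ 2 * √t)) / (t / 4) ^ 2 = 1 / 2 * (4096 * Q * K₀ * √t) := by
      field_simp
      ring
    rw [e1] at hb1
    linarith
  · have h1 := (norm_sub_le (fderiv ℝ (fderiv ℝ ψ) x) (fderiv ℝ (fderiv ℝ ψ) y)).trans
      (add_le_add (hK x hx).2 (hK y hy).2)
    have h2 : 2 * K₀ ≤ 2 * K₀ / √(R / 1000) * √t := by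
      rw [div_mul_eq_mul_div, le_div_iff₀ (by positivity)]
      gcongr
    have h3 : 2 * K₀ / √(R / 1000) * √t ≤
        (K₀ + 4096 * Q * K₀ + 2 * K₀ / √(R / 1000)) * √t := by
      gcongr
      linarith
    linarith

theorem integral_comp_sub_smul {N : ℕ} (G : Euc N → ℝ) (x : Euc N) {t : ℝ} (ht : 0 < t) :
    ∫ y, G (x - t • y) = (t ^ N)⁻¹ * ∫ y, G y := by
  have h := Measure.integral_comp_smul volume (fun y => G (x - y)) t
  rw [integral_sub_left_eq_self G volume x, finrank_euclideanSpace, Fintype.card_fin,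
    abs_of_pos (by positivity), smul_eq_mul] at h
  exact h

theorem integrable_comp_sub_smul {N : ℕ} {G : Euc N → ℝ} (hG : Integrable G) (x : Euc N) {t : ℝ}
    (ht : 0 < t) : Integrable fun y => G (x - t • y) :=
  Integrable.comp_smul (f := fun y => G (x - y)) (hG.comp_sub_left x) ht.ne'

theorem integrable_comp_sub_smul_mul {N : ℕ} {G m : Euc N → ℝ} {c : ℝ} (hG : Integrable G)
    (hm : Continuous m) (hmc : ∀ y, |m y| ≤ c) (x : Euc N) {t : ℝ} (ht : 0 < t) :
    Integrable fun y => G (x - t • y) * m y :=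
  (integrable_comp_sub_smul hG x ht).mul_bdd hm.aestronglyMeasurable (.of_forall hmc)

theorem integral_comp_sub_smul_mul_le {N : ℕ} {G m : Euc N → ℝ} {c : ℝ} (hG : Integrable G)
    (hG0 : ∀ y, 0 ≤ G y) (hm : Continuous m) (hmc : ∀ y, |m y| ≤ c) (x : Euc N) {t : ℝ}
    (ht : 0 < t) : ∫ y, G (x - t • y) * m y ≤ c * ((t ^ N)⁻¹ * ∫ y, G y) := by
  rw [← integral_comp_sub_smul G x ht, ← integral_const_mul]
  refine integral_mono (integrable_comp_sub_smul_mul hG hm hmc x ht)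
    ((integrable_comp_sub_smul hG x ht).const_mul c) fun y => ?_
  rw [mul_comm c]
  exact mul_le_mul_of_nonneg_left ((le_abs_self _).trans (hmc y)) (hG0 _)

set_option maxHeartbeats 600000 in
/-- An upper bound for nonnegative functions at points where they dominate their mean, in terms of
the supremum and the integral of the negative of the Laplacian. -/
theorem le_of_neg_lap_le (N : ℕ) [NeZero N] {σ : ℝ} (hσ : 0 < σ) (hσN : (N : ℝ) - 2 ≤ σ) :
    ∃ A, 0 ≤ A ∧ ∀ (v F : Euc N → ℝ) (b I ρ : ℝ) (x : Euc N), ContDiff ℝ 2 v →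
      HasCompactSupport v → (∀ y, 0 ≤ v y) → ∫ y, v y ≤ v x → (∀ y, -lap v y ≤ F y) →
      (∀ y, 0 ≤ F y) → (∀ y, F y ≤ b) → Integrable F → ∫ y, F y ≤ I → 0 < ρ → ρ ≤ 1 →
      v x ≤ A * (b * ρ ^ 2 + I * ρ ^ (-σ)) := by
  obtain ⟨k⟩ := nonempty_radialKernel N
  obtain ⟨c₁, hc₁⟩ := k.contDiff_K.continuous.bounded_above_of_compact_support k.hasCompactSupport_K
  obtain ⟨c₂, hc₂⟩ := k.contDiff_η.continuous.bounded_above_of_compact_support k.hasCompactSupport_η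
  have hc₁0 : 0 ≤ c₁ := (norm_nonneg _).trans (hc₁ 0)
  have hc₂0 : 0 ≤ c₂ := (norm_nonneg _).trans (hc₂ 0)
  set κ := ∫ y, k.K y with hκ
  have hκ0 : 0 ≤ κ := integral_nonneg k.K_nonneg
  set H : ℝ := 1 + 2 * c₂ with hH
  have hH1 : 1 ≤ H := by linarith
  have hH0 : 0 < H := by linarith
  set q : ℝ := c₁ * H ^ (2 - N + σ) with hq
  have hq0 : 0 ≤ q := by positivity
  refine ⟨κ + 2 * (q / σ), by positivity, fun v F b I ρ x hv hvc hv0 hvi hF hF0 hFb hFi hFI hρ hρ1 =>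
    ?_⟩
  have hI0 : 0 ≤ I := (integral_nonneg hF0).trans hFI
  have hb0 : 0 ≤ b := (hF0 0).trans (hFb 0)
  obtain ⟨L, hL⟩ := exists_lipschitzWith_fderiv hv hvc
  have hvd : Differentiable ℝ v := hv.differentiable (by simp)
  set D : ℝ → ℝ := fun t => ∫ y, v (x - t • y) * k.η y with hD
  have hD0 : D 0 = v x := by
    simp only [hD, zero_smul, sub_zero, integral_const_mul, k.integral_η, mul_one]
  have hDc : Continuous D := continuous_iff_continuousAt.2 fun t =>
    (k.hasDerivAt_integral hvd hL x t).continuousAt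
  have hD' : ∀ t : ℝ, 0 < t → HasDerivAt (fun t => -D t) (t * ∫ y, -lap v (x - t • y) * k.K y) t := by
    intro t ht
    have := (k.hasDerivAt_mollify hvd hL x ht.ne').neg
    simp only [neg_mul, integral_neg, mul_neg]
    exact this
  have hvint : Integrable v := hv.continuous.integrable_of_hasCompactSupport hvc
  have hlapK : ∀ t : ℝ, 0 < t → ∫ y, -lap v (x - t • y) * k.K y ≤ ∫ y, F (x - t • y) * k.K y := by
    intro t ht
    have e1 : Integrable fun y => -lap v (x - t • y) * k.K y := by
      simp only [neg_mul]
      exact (integrable_lap_mul hL k.integrable_K x t).neg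
    have e2 := integrable_comp_sub_smul_mul hFi k.contDiff_K.continuous hc₁ x ht
    have e3 : ∀ y, -lap v (x - t • y) * k.K y ≤ F (x - t • y) * k.K y := fun y =>
      mul_le_mul_of_nonneg_right (hF (x - t • y)) (k.K_nonneg y)
    exact integral_mono e1 e2 e3
  have h1 : D 0 - D ρ ≤ b * κ * ρ ^ 2 / 2 := by
    have := sub_le_sub_of_deriv_le (f := fun t => -D t) (g := fun t => b * κ * t ^ 2 / 2)
      (g' := fun t => b * κ * t) hρ.le hDc.neg.continuousOn (by fun_prop)
      (fun t ht => hD' t ht.1) (fun t _ => by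
        have := ((hasDerivAt_pow 2 t).const_mul (b * κ)).div_const 2
        exact this.congr_deriv (by push_cast; ring)) fun t ht => by
        have : ∫ y, F (x - t • y) * k.K y ≤ b * κ := by
          rw [hκ, ← integral_const_mul]
          have e3 : ∀ y, F (x - t • y) * k.K y ≤ b * k.K y := fun y =>
            mul_le_mul_of_nonneg_right (hFb (x - t • y)) (k.K_nonneg y)
          exact integral_mono
            (integrable_comp_sub_smul_mul hFi k.contDiff_K.continuous hc₁ x ht.1)
            (k.integrable_K.const_mul b) e3
        rw [mul_comm (b * κ)]
        exact mul_le_mul_of_nonneg_left ((hlapK t ht.1).trans this) ht.1.le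
    linarith
  have h2 : D ρ - D H ≤ I * (q / σ) * ρ ^ (-σ) := by
    have := sub_le_sub_of_deriv_le (f := fun t => -D t) (g := fun t => -(I * (q / σ)) * t ^ (-σ))
      (g' := fun t => I * q * t ^ (-σ - 1)) (hρ1.trans hH1) hDc.neg.continuousOn
      (continuousOn_const.mul (continuousOn_id.rpow_const fun t ht => .inl (hρ.trans_le ht.1).ne'))
      (fun t ht => hD' t (hρ.trans ht.1)) (fun t ht => by
        have := (Real.hasDerivAt_rpow_const (p := -σ) (.inl (hρ.trans ht.1).ne')).const_mul
          (-(I * (q / σ)))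
        exact this.congr_deriv (by field_simp)) fun t ht => by
        have ht0 : 0 < t := hρ.trans ht.1
        have e1 : ∫ y, F (x - t • y) * k.K y ≤ c₁ * ((t ^ N)⁻¹ * I) :=
          (integral_comp_sub_smul_mul_le hFi hF0 k.contDiff_K.continuous hc₁ x ht0).trans
            (by gcongr)
        have e2 : t * (t ^ N)⁻¹ ≤ H ^ (2 - N + σ) * t ^ (-σ - 1) := by
          have : t * (t ^ N)⁻¹ = t ^ (2 - N + σ) * t ^ (-σ - 1) := by
            rw [← Real.rpow_natCast, ← Real.rpow_neg ht0.le, ← Real.rpow_add ht0]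
            nth_rewrite 1 [← Real.rpow_one t]
            rw [← Real.rpow_add ht0]
            congr 1
            ring
          rw [this]
          refine mul_le_mul_of_nonneg_right ?_ (by positivity)
          exact Real.rpow_le_rpow ht0.le ht.2.le (by linarith)
        calc t * ∫ y, -lap v (x - t • y) * k.K y ≤ t * (c₁ * ((t ^ N)⁻¹ * I)) :=
              mul_le_mul_of_nonneg_left ((hlapK t ht0).trans e1) ht0.le
          _ = I * c₁ * (t * (t ^ N)⁻¹) := by ring
          _ ≤ I * c₁ * (H ^ (2 - N + σ) * t ^ (-σ - 1)) := by gcongr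
          _ = I * q * t ^ (-σ - 1) := by rw [hq]; ring
    have h3 : 0 ≤ I * (q / σ) * H ^ (-σ) := by positivity
    linarith
  have h3 : D H ≤ v x / 2 := by
    have e1 := integral_comp_sub_smul_mul_le hvint hv0 k.contDiff_η.continuous hc₂ x hH0
    have e2 : H ≤ H ^ N := le_self_pow₀ hH1 (NeZero.ne N)
    have e3 : c₂ * (H ^ N)⁻¹ ≤ 1 / 2 := by
      rw [← div_eq_mul_inv, div_le_div_iff₀ (by positivity) (by norm_num)]
      linarith
    calc D H ≤ c₂ * ((H ^ N)⁻¹ * ∫ y, v y) := e1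
      _ = (c₂ * (H ^ N)⁻¹) * ∫ y, v y := by ring
      _ ≤ 1 / 2 * v x := mul_le_mul e3 hvi (integral_nonneg hv0) (by norm_num)
      _ = v x / 2 := by ring
  have h4 : 0 ≤ I * κ * ρ ^ (-σ) := by positivity
  have h5 : 0 ≤ b * (q / σ) * ρ ^ 2 := by positivity
  rw [hD0] at h1
  nlinarith

/-- The function `s ↦ s₊ ^ (n + 2)` is differentiable. -/
theorem hasDerivAt_max_pow (n : ℕ) (s : ℝ) :
    HasDerivAt (fun s : ℝ => max s 0 ^ (n + 2)) ((n + 2) * max s 0 ^ (n + 1)) s := by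
  rcases lt_trichotomy s 0 with hs | rfl | hs
  · rw [max_eq_right hs.le, zero_pow (by omega), mul_zero]
    refine (hasDerivAt_const s (0 : ℝ)).congr_of_eventuallyEq ?_
    filter_upwards [Iio_mem_nhds hs] with t ht
    rw [max_eq_right (le_of_lt ht), zero_pow (by omega)]
  · rw [max_self, zero_pow (by omega), mul_zero, hasDerivAt_iff_isLittleO_nhds_zero]
    have h1 : (fun h : ℝ => max (0 + h) 0 ^ (n + 2) - max 0 0 ^ (n + 2) - h • (0 : ℝ)) =O[𝓝 0]
        fun h : ℝ => h ^ (n + 2) := by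
      refine IsBigO.of_bound 1 (.of_forall fun h => ?_)
      have : |max h 0| ≤ |h| := by
        rw [abs_of_nonneg (le_max_right _ _)]
        exact max_le (le_abs_self h) (abs_nonneg h)
      simp only [zero_add, max_self, ne_eq, Nat.add_eq_zero_iff, OfNat.ofNat_ne_zero, and_false,
        not_false_eq_true, zero_pow, sub_zero, smul_eq_mul, mul_zero, norm_pow, Real.norm_eq_abs,
        one_mul]
      gcongr
    refine h1.trans_isLittleO ?_
    simpa using isLittleO_pow_pow (𝕜 := ℝ) (m := 1) (n := n + 2) (by omega)
  · rw [max_eq_left hs.le]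
    have := hasDerivAt_pow (n + 2) s
    push_cast at this
    refine this.congr_of_eventuallyEq ?_
    filter_upwards [Ioi_mem_nhds hs] with t ht
    rw [max_eq_left (le_of_lt ht)]

theorem contDiff_max_pow_three : ContDiff ℝ 2 fun s : ℝ => max s 0 ^ 3 := by
  have h3 : deriv (fun s : ℝ => max s 0 ^ 3) = fun s => 3 * max s 0 ^ 2 := by
    funext s
    rw [(hasDerivAt_max_pow 1 s).deriv]
    norm_num
  have h2 : deriv (fun s : ℝ => max s 0 ^ 2) = fun s => 2 * max s 0 := by
    funext s
    rw [(hasDerivAt_max_pow 0 s).deriv]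
    norm_num
  have hc2 : ContDiff ℝ 1 fun s : ℝ => max s 0 ^ 2 := by
    rw [contDiff_one_iff_deriv, h2]
    exact ⟨fun s => (hasDerivAt_max_pow 0 s).differentiableAt, by fun_prop⟩
  rw [show (2 : ℕ∞ω) = 1 + 1 from rfl, contDiff_succ_iff_deriv, h3]
  exact ⟨fun s => (hasDerivAt_max_pow 1 s).differentiableAt, by simp, contDiff_const.mul hc2⟩

theorem neg_lap_max_pow_three_le {N : ℕ} {u : Euc N → ℝ} (hu : ContDiff ℝ 2 u) (ε : ℝ) (x : Euc N) :
    -lap (fun y => max (u y - ε) 0 ^ 3) x ≤ 3 * max (u x - ε) 0 ^ 2 * -lap u x := by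
  have hud : Differentiable ℝ u := hu.differentiable (by simp)
  have hud' : Differentiable ℝ (fderiv ℝ u) :=
    (hu.fderiv_right (m := 1) (by norm_num)).differentiable (by simp)
  have hue : ∀ y, HasFDerivAt (fun y => u y - ε) (fderiv ℝ u y) y := fun y =>
    (hud y).hasFDerivAt.sub_const ε
  have h1 : fderiv ℝ (fun y => max (u y - ε) 0 ^ 3) =
      fun y => (3 * max (u y - ε) 0 ^ 2) • fderiv ℝ u y := by
    funext y
    have := (hasDerivAt_max_pow 1 (u y - ε)).comp_hasFDerivAt y (hue y)
    refine (this.fderiv).trans ?_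
    norm_num
  have h2 : ∀ e, fderiv ℝ (fderiv ℝ (fun y => max (u y - ε) 0 ^ 3)) x e e =
      3 * max (u x - ε) 0 ^ 2 * fderiv ℝ (fderiv ℝ u) x e e +
        6 * max (u x - ε) 0 * (fderiv ℝ u x e) ^ 2 := by
    intro e
    have h3 := ((hasDerivAt_max_pow 0 (u x - ε)).comp_hasFDerivAt x (hue x)).const_mul 3
    have h4 := h3.smul (hud' x).hasFDerivAt
    rw [h1]
    have h5 : fderiv ℝ (fun y => (3 * max (u y - ε) 0 ^ 2) • fderiv ℝ u y) x = _ := h4.fderiv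
    rw [h5]
    simp
    ring
  simp only [lap, h2, Finset.sum_add_distrib, ← Finset.mul_sum]
  have : 0 ≤ 6 * max (u x - ε) 0 * ∑ i, (fderiv ℝ u x (EuclideanSpace.single i 1)) ^ 2 := by
    have : 0 ≤ max (u x - ε) 0 := le_max_right _ _
    have : 0 ≤ ∑ i, (fderiv ℝ u x (EuclideanSpace.single i 1)) ^ 2 :=
      Finset.sum_nonneg fun i _ => sq_nonneg _
    positivity
  linarith

/-- Truncating a function that vanishes on the boundary at a positive level and extending by zero
yields a function vanishing near the complement. -/
theorem indicator_max_pow_eventuallyEq {N : ℕ} {Ω : Set (Euc N)} {u : Euc N → ℝ}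
    (hu : Continuous u) (h0 : ∀ y ∈ frontier Ω, u y = 0) {ε : ℝ} (hε : 0 < ε) (hΩ : IsOpen Ω)
    {y : Euc N} (hy : y ∉ Ω) : Ω.indicator (fun y => max (u y - ε) 0 ^ 3) =ᶠ[𝓝 y] 0 := by
  by_cases hc : y ∈ closure Ω
  · have hf : y ∈ frontier Ω := by
      rw [hΩ.frontier_eq]
      exact ⟨hc, hy⟩
    filter_upwards [hu.continuousAt.eventually_lt_const (by rw [h0 y hf]; exact hε : u y < ε)]
      with z hz
    by_cases hzΩ : z ∈ Ω
    · simp [indicator_of_mem hzΩ, max_eq_right (by linarith : u z - ε ≤ 0)]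
    · simp [indicator_of_notMem hzΩ]
  · filter_upwards [isClosed_closure.isOpen_compl.mem_nhds hc] with z hz
    exact indicator_of_notMem (fun h => hz (subset_closure h)) _

/-- A bound for the maximum of a function vanishing on the boundary of a domain of unit volume, in
terms of the supremum and the integral of an upper bound of the negative of its Laplacian. -/
theorem max_le_of_neg_lap_le (N : ℕ) [NeZero N] {σ : ℝ} (hσ : 0 < σ) (hσN : (N : ℝ) - 2 ≤ σ) :
    ∃ A, 0 ≤ A ∧ ∀ (Ω : Set (Euc N)) (u f : Euc N → ℝ) (b I ρ : ℝ) (x : Euc N), IsOpen Ω →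
      Bornology.IsBounded Ω → volume Ω = 1 → ContDiff ℝ 2 u → (∀ y ∈ frontier Ω, u y = 0) →
      x ∈ Ω → (∀ y ∈ Ω, u y ≤ u x) → 0 < u x → (∀ y ∈ Ω, -lap u y ≤ f y) → (∀ y ∈ Ω, 0 ≤ f y) →
      (∀ y ∈ Ω, f y ≤ b) → IntegrableOn f Ω → ∫ y in Ω, f y ≤ I → 0 < ρ → ρ ≤ 1 →
      u x ≤ A * (b * ρ ^ 2 + I * ρ ^ (-σ)) := by
  obtain ⟨A, hA0, hA⟩ := le_of_neg_lap_le N hσ hσN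
  refine ⟨6 * A, by positivity, fun Ω u f b I ρ x hΩ hb hvol hu h0 hx hux hux0 hf hf0 hfb hfi hfI
    hρ hρ1 => ?_⟩
  set ε := u x / 2 with hε
  have hε0 : 0 < ε := by positivity
  set w : Euc N → ℝ := fun y => max (u y - ε) 0 ^ 3 with hw
  have hwC : ContDiff ℝ 2 w := contDiff_max_pow_three.comp (hu.sub contDiff_const)
  have hle : ∀ y ∈ Ω, max (u y - ε) 0 ≤ ε := fun y hy => max_le (by linarith [hux y hy]) hε0.le
  have hge : ∀ y, 0 ≤ max (u y - ε) 0 := fun y => le_max_right _ _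
  set v := Ω.indicator w with hv
  set F := Ω.indicator (fun y => 3 * ε ^ 2 * f y) with hF
  have hvw : ∀ y ∈ Ω, v =ᶠ[𝓝 y] w := fun y hy => by
    filter_upwards [hΩ.mem_nhds hy] with z hz
    exact indicator_of_mem hz _
  have hv0 : ∀ y ∉ Ω, v =ᶠ[𝓝 y] 0 := fun y hy =>
    indicator_max_pow_eventuallyEq hu.continuous h0 hε0 hΩ hy
  have hvC : ContDiff ℝ 2 v := contDiff_iff_contDiffAt.2 fun y => by
    by_cases hy : y ∈ Ω
    · exact hwC.contDiffAt.congr_of_eventuallyEq (hvw y hy)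
    · exact contDiffAt_const.congr_of_eventuallyEq (hv0 y hy)
  have hvc : HasCompactSupport v := HasCompactSupport.intro hb.isCompact_closure fun y hy =>
    indicator_of_notMem (fun h => hy (subset_closure h)) _
  have hvx : v x = ε ^ 3 := by
    rw [hv, indicator_of_mem hx, hw]
    simp only [hε]
    rw [max_eq_left (by linarith)]
    ring
  have hvn : ∀ y, 0 ≤ v y := indicator_nonneg fun y _ => pow_nonneg (hge y) 3
  have hvi : ∫ y, v y ≤ v x := by
    have hfin : volume Ω ≠ ⊤ := by simp [hvol]
    have e1 : IntegrableOn w Ω :=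
      (hwC.continuous.continuousOn.integrableOn_compact hb.isCompact_closure).mono_set
        subset_closure
    have e2 : ∫ y in Ω, w y ≤ ∫ _ in Ω, ε ^ 3 :=
      setIntegral_mono_on e1 (integrableOn_const hfin) hΩ.measurableSet
        fun y hy => pow_le_pow_left₀ (hge y) (hle y hy) 3
    rw [setIntegral_const, Measure.real, hvol, ENNReal.toReal_one, one_smul] at e2
    rwa [hv, integral_indicator hΩ.measurableSet, ← hv, hvx]
  have hlap : ∀ y, -lap v y ≤ F y := fun y => by
    by_cases hy : y ∈ Ω
    · rw [lap_congr (hvw y hy), hF, indicator_of_mem hy]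
      refine (neg_lap_max_pow_three_le hu ε y).trans ?_
      have e1 : 3 * max (u y - ε) 0 ^ 2 * -lap u y ≤ 3 * max (u y - ε) 0 ^ 2 * f y :=
        mul_le_mul_of_nonneg_left (hf y hy) (by positivity)
      have e2 : max (u y - ε) 0 ^ 2 ≤ ε ^ 2 := pow_le_pow_left₀ (hge y) (hle y hy) 2
      exact e1.trans (mul_le_mul_of_nonneg_right (by linarith) (hf0 y hy))
    · rw [lap_congr (hv0 y hy), hF, indicator_of_notMem hy]
      simp [lap]
  have hFI : ∫ y, F y ≤ 3 * ε ^ 2 * I := by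
    rw [hF, integral_indicator hΩ.measurableSet, integral_const_mul]
    gcongr
  have hb0 : 0 ≤ b := (hf0 x hx).trans (hfb x hx)
  have key := hA v F (3 * ε ^ 2 * b) (3 * ε ^ 2 * I) ρ x hvC hvc hvn hvi hlap
    (indicator_nonneg fun y hy => by have := hf0 y hy; positivity)
    (fun y => by
      by_cases hy : y ∈ Ω
      · rw [hF, indicator_of_mem hy]
        exact mul_le_mul_of_nonneg_left (hfb y hy) (by positivity)
      · rw [hF, indicator_of_notMem hy]
        positivity)
    ((integrable_indicator_iff hΩ.measurableSet).2 (hfi.const_mul _)) hFI hρ hρ1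
  rw [hvx] at key
  have e1 : ε ^ 2 * ε ≤ ε ^ 2 * (3 * A * (b * ρ ^ 2 + I * ρ ^ (-σ))) := by
    calc ε ^ 2 * ε = ε ^ 3 := by ring
      _ ≤ _ := key
      _ = _ := by ring
  have e2 := le_of_mul_le_mul_left e1 (by positivity)
  linarith

/-- Functions vanishing on the boundary whose Laplacian is nonnegative are nonpositive. -/
theorem nonpos_of_lap_nonneg {N : ℕ} [NeZero N] {Ω : Set (Euc N)} {u : Euc N → ℝ} (hΩ : IsOpen Ω)
    (hb : Bornology.IsBounded Ω) (hvol : volume Ω = 1) (hu : ContDiff ℝ 2 u)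
    (h0 : ∀ y ∈ frontier Ω, u y = 0) (hlap : ∀ y ∈ Ω, 0 ≤ lap u y) :
    ∀ x ∈ closure Ω, u x ≤ 0 := by
  intro x hx
  obtain ⟨z, hz, hmax⟩ := hb.isCompact_closure.exists_isMaxOn ⟨x, hx⟩ hu.continuous.continuousOn
  refine (hmax hx).trans ?_
  by_contra! hpos
  have hzΩ : z ∈ Ω := by
    by_contra hn
    have := h0 z (by rw [hΩ.frontier_eq]; exact ⟨hz, hn⟩)
    linarith
  obtain ⟨A, -, hA⟩ := max_le_of_neg_lap_le N (σ := N) (by exact_mod_cast NeZero.pos N) (by linarith)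
  have := hA Ω u 0 0 0 1 z hΩ hb hvol hu h0 hzΩ (fun y hy => hmax (subset_closure hy)) hpos
    (fun y hy => by simpa using hlap y hy) (fun _ _ => le_rfl) (fun _ _ => le_rfl)
    integrableOn_zero (by simp) one_pos le_rfl
  simp at this
  linarith

theorem le_of_le_mul_rpow {lbar A θ M : ℝ} (hl : 0 < lbar) (_ : 0 ≤ A) (hθ0 : 0 ≤ θ) (hθ : θ < 1)
    (hM : 0 ≤ M) (h : M ≤ A * (1 + lbar * M) ^ θ) :
    M ≤ (1 + lbar * A) ^ (1 / (1 - θ)) / lbar := by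
  set X := 1 + lbar * M with hX
  have hX1 : 1 ≤ X := by
    have : 0 ≤ lbar * M := by positivity
    linarith
  have hX0 : 0 < X := by linarith
  have h1 : 1 ≤ X ^ θ := Real.one_le_rpow hX1 hθ0
  have h2 : X ≤ (1 + lbar * A) * X ^ θ := by
    have : lbar * M ≤ lbar * (A * X ^ θ) := mul_le_mul_of_nonneg_left h hl.le
    linarith
  have h3 : X ^ (1 - θ) ≤ 1 + lbar * A := by
    rw [Real.rpow_sub hX0, Real.rpow_one, div_le_iff₀ (by positivity)]
    exact h2
  have h4 : X ≤ (1 + lbar * A) ^ (1 / (1 - θ)) := by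
    have := Real.rpow_le_rpow (by positivity) h3 (by
      have : 0 < 1 - θ := by linarith
      positivity : 0 ≤ 1 / (1 - θ))
    rwa [← Real.rpow_mul hX0.le, mul_one_div_cancel (by linarith), Real.rpow_one] at this
  rw [le_div_iff₀ hl]
  linarith

/-- The a priori bound for solutions of the plasma problem. -/
theorem sup_estimate (N : ℕ) (hN : 2 ≤ N) {p lbar : ℝ} (hp : 1 ≤ p)
    (hpN : N = 2 ∨ p < (N : ℝ) / ((N : ℝ) - 2)) (hl : 0 < lbar) :
    ∃ M, 0 ≤ M ∧ ∀ (Ω : Set (Euc N)) (lam α : ℝ) (ψ : Euc N → ℝ), IsOpen Ω →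
      Bornology.IsBounded Ω → volume Ω = 1 → 0 ≤ lam → lam ≤ lbar → ContDiff ℝ 2 ψ →
      (∀ y ∈ frontier Ω, ψ y = 0) → (∀ y ∈ Ω, -lap ψ y = max (α + lam * ψ y) 0 ^ p) →
      ∫ y in Ω, max (α + lam * ψ y) 0 ^ p = 1 →
      α ≤ 1 ∧ ∀ x ∈ closure Ω, 0 ≤ ψ x ∧ ψ x ≤ M := by
  have hN0 : NeZero N := ⟨by omega⟩
  have hNpos : (0 : ℝ) < N := by exact_mod_cast NeZero.pos N
  have hp0 : 0 < p := by linarith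
  obtain ⟨σ, hσ, hσN, hσp⟩ : ∃ σ : ℝ, 0 < σ ∧ (N : ℝ) - 2 ≤ σ ∧ p * σ / N < 1 := by
    rcases eq_or_lt_of_le hN with h2 | h3
    · refine ⟨1 / p, by positivity, ?_, ?_⟩
      · rw [← h2]
        norm_num
        linarith
      · rw [mul_one_div_cancel hp0.ne', ← h2]
        norm_num
    · have h3' : (2 : ℝ) < N := by exact_mod_cast h3
      refine ⟨N - 2, by linarith, le_rfl, ?_⟩
      rw [div_lt_one hNpos]
      have := hpN.resolve_left (by omega)
      rwa [lt_div_iff₀ (by linarith)] at this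
  obtain ⟨A, hA0, hA⟩ := max_le_of_neg_lap_le N hσ hσN
  set θ := p * σ / N with hθ
  have hθ0 : 0 ≤ θ := by positivity
  refine ⟨(1 + lbar * (2 * A)) ^ (1 / (1 - θ)) / lbar, by positivity,
    fun Ω lam α ψ hΩ hb hvol hlam hlam' hψ h0 heq hmass => ?_⟩
  have hψ0 : ∀ x ∈ closure Ω, 0 ≤ ψ x := by
    have := nonpos_of_lap_nonneg (u := fun y => -ψ y) hΩ hb hvol hψ.neg
      (fun y hy => by simp [h0 y hy]) fun y hy => by
      have e : lap (fun y => -ψ y) y = -lap ψ y := by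
        have e1 : fderiv ℝ (fun y => -ψ y) = fun y => -fderiv ℝ ψ y :=
          funext fun _ => fderiv_fun_neg
        have e2 : fderiv ℝ (fun y => -fderiv ℝ ψ y) y = -fderiv ℝ (fderiv ℝ ψ) y := fderiv_fun_neg
        simp [lap, e1, e2]
      rw [e, heq y hy]
      positivity
    exact fun x hx => by simpa using this x hx
  set f : Euc N → ℝ := fun y => max (α + lam * ψ y) 0 ^ p with hf
  have hfc : Continuous f := by
    have := hψ.continuous
    exact Continuous.rpow_const (by fun_prop) fun _ => .inr hp0.le
  have hfi : IntegrableOn f Ω :=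
    (hfc.continuousOn.integrableOn_compact hb.isCompact_closure).mono_set subset_closure
  have hα : α ≤ 1 := by
    by_contra! h1
    have hfin : volume Ω ≠ ⊤ := by simp [hvol]
    have e2 : ∫ _ in Ω, α ^ p ≤ ∫ y in Ω, f y :=
      setIntegral_mono_on (integrableOn_const hfin) hfi hΩ.measurableSet
        fun y hy => Real.rpow_le_rpow (by linarith) (le_max_of_le_left (by
          have := mul_nonneg hlam (hψ0 y (subset_closure hy))
          linarith)) hp0.le
    rw [setIntegral_const, Measure.real, hvol, ENNReal.toReal_one, one_smul, hmass] at e2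
    exact absurd e2 (not_le.2 (Real.one_lt_rpow h1 hp0))
  refine ⟨hα, fun x hx => ⟨hψ0 x hx, ?_⟩⟩
  obtain ⟨z, hz, hmax⟩ := hb.isCompact_closure.exists_isMaxOn ⟨x, hx⟩ hψ.continuous.continuousOn
  refine (hmax hx).trans ?_
  rcases (hψ0 z hz).eq_or_lt with hz0 | hz0
  · simp only [← hz0]
    positivity
  have hzΩ : z ∈ Ω := by
    by_contra hn
    have := h0 z (by rw [hΩ.frontier_eq]; exact ⟨hz, hn⟩)
    linarith
  set X := 1 + lbar * ψ z with hX
  have hX1 : 1 ≤ X := by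
    have : 0 ≤ lbar * ψ z := by positivity
    linarith
  have hX0 : 0 < X := by linarith
  set ρ := X ^ (-p / N) with hρ
  have hρ0 : 0 < ρ := by positivity
  have hρ1 : ρ ≤ 1 := Real.rpow_le_one_of_one_le_of_nonpos hX1 (by
    rw [neg_div]
    have : 0 ≤ p / N := by positivity
    linarith)
  have key := hA Ω ψ f (X ^ p) 1 ρ z hΩ hb hvol hψ h0 hzΩ (fun y hy => hmax (subset_closure hy)) hz0
    (fun y hy => (heq y hy).le) (fun y _ => by positivity)
    (fun y hy => Real.rpow_le_rpow (le_max_right _ _) (max_le (by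
      have e1 : ψ y ≤ ψ z := hmax (subset_closure hy)
      have e2 : lam * ψ y ≤ lbar * ψ z :=
        mul_le_mul hlam' e1 (hψ0 y (subset_closure hy)) hl.le
      linarith) hX0.le) hp0.le) hfi hmass.le hρ0 hρ1
  have e1 : ρ ^ (-σ) = X ^ θ := by
    rw [hρ, ← Real.rpow_mul hX0.le, hθ]
    congr 1
    field_simp
  have e2 : X ^ p * ρ ^ 2 ≤ ρ ^ (-σ) := by
    have : X ^ p = ρ ^ (-(N : ℝ)) := by
      rw [hρ, ← Real.rpow_mul hX0.le]
      congr 1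
      field_simp
    rw [this, ← Real.rpow_natCast, ← Real.rpow_add hρ0]
    refine Real.rpow_le_rpow_of_exponent_ge hρ0 hρ1 ?_
    push_cast
    linarith
  refine le_of_le_mul_rpow hl (by positivity) hθ0 hσp hz0.le ?_
  rw [one_mul] at key
  calc ψ z ≤ A * (X ^ p * ρ ^ 2 + ρ ^ (-σ)) := key
    _ ≤ A * (ρ ^ (-σ) + ρ ^ (-σ)) := by gcongr
    _ = 2 * A * X ^ θ := by rw [e1]; ring

theorem lapl_eq_lap {N : ℕ} {ψ : Euc N → ℝ} (hψ : ContDiff ℝ 2 ψ) (x : Euc N) :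
    lapl ψ x = lap ψ x := by
  have hd : Differentiable ℝ (fderiv ℝ ψ) :=
    (hψ.fderiv_right (m := 1) (by norm_num)).differentiable (by simp)
  refine Finset.sum_congr rfl fun i _ => ?_
  rw [fderiv_clm_apply (hd x) (differentiableAt_const _)]
  simp

theorem continuous_lap {N : ℕ} {ψ : Euc N → ℝ} (hψ : ContDiff ℝ 2 ψ) : Continuous (lap ψ) := by
  have hc : Continuous (fderiv ℝ (fderiv ℝ ψ)) :=
    (hψ.fderiv_right (m := 1) (by norm_num)).continuous_fderiv (by simp)
  unfold lap
  fun_prop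

theorem norm_iteratedFDeriv_two_le {E : Type*} [NormedAddCommGroup E] [NormedSpace ℝ E]
    (ψ : E → ℝ) (x : E) : ‖iteratedFDeriv ℝ 2 ψ x‖ ≤ ‖fderiv ℝ (fderiv ℝ ψ) x‖ := by
  refine ContinuousMultilinearMap.opNorm_le_bound (norm_nonneg _) fun m => ?_
  rw [iteratedFDeriv_two_apply, Fin.prod_univ_two, ← mul_assoc]
  exact ContinuousLinearMap.le_opNorm₂ _ _ _

theorem norm_iteratedFDeriv_two_sub_le {E : Type*} [NormedAddCommGroup E] [NormedSpace ℝ E]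
    (ψ : E → ℝ) (x y : E) : ‖iteratedFDeriv ℝ 2 ψ x - iteratedFDeriv ℝ 2 ψ y‖ ≤
      ‖fderiv ℝ (fderiv ℝ ψ) x - fderiv ℝ (fderiv ℝ ψ) y‖ := by
  refine ContinuousMultilinearMap.opNorm_le_bound (norm_nonneg _) fun m => ?_
  rw [sub_apply, iteratedFDeriv_two_apply, iteratedFDeriv_two_apply, Fin.prod_univ_two,
    ← mul_assoc, ← sub_apply, ← sub_apply]
  exact ContinuousLinearMap.le_opNorm₂ _ _ _

theorem abs_rpow_sub_rpow_le {p B : ℝ} (hp : 1 ≤ p) {a b : ℝ} (ha : a ∈ Icc 0 B)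
    (hb : b ∈ Icc 0 B) : |a ^ p - b ^ p| ≤ p * B ^ (p - 1) * |a - b| := by
  refine Convex.norm_image_sub_le_of_norm_hasDerivWithin_le
    (fun x _ => (Real.hasDerivAt_rpow_const (.inr hp)).hasDerivWithinAt) (fun x hx => ?_)
    (convex_Icc 0 B) hb ha
  have : 0 ≤ x ^ (p - 1) := Real.rpow_nonneg hx.1 _
  rw [Real.norm_of_nonneg (by positivity)]
  exact mul_le_mul_of_nonneg_left (Real.rpow_le_rpow hx.1 hx.2 (by linarith)) (by linarith)

end PlasmaRegularity

open PlasmaRegularity in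
theorem stmt11 (N : ℕ) (hN : 2 ≤ N) (Ω : Set (EuclideanSpace ℝ (Fin N)))
    (hΩ : IsC3Domain Ω) (hvol : volume Ω = 1) (p : ℝ) (hp1 : 1 ≤ p)
    (hpN : N = 2 ∨ p < (N : ℝ) / ((N : ℝ) - 2))
    (lbar : ℝ) (hlbar : 0 < lbar) :
    ∃ r ∈ Set.Ioo (0 : ℝ) 1, ∃ abar C : ℝ,
      ∀ (lam α : ℝ) (ψ : EuclideanSpace ℝ (Fin N) → ℝ),
        0 ≤ lam → lam ≤ lbar → IsSol Ω p lam α ψ →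
        abar ≤ α ∧
        ∀ x ∈ closure Ω, ∀ y ∈ closure Ω,
          |ψ x| ≤ C ∧ ‖fderiv ℝ ψ x‖ ≤ C ∧ ‖iteratedFDeriv ℝ 2 ψ x‖ ≤ C ∧
          ‖iteratedFDeriv ℝ 2 ψ x - iteratedFDeriv ℝ 2 ψ y‖ ≤ C * ‖x - y‖ ^ r := by
  obtain ⟨hΩo, -, hb, hchart⟩ := hΩ
  have hN0 : NeZero N := ⟨by omega⟩
  have hp0 : 0 < p := by linarith
  obtain ⟨R, C, hR, hR1, hC, hc⟩ := exists_boundaryChart hΩo hb hchart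
  obtain ⟨M, hM, hsup⟩ := sup_estimate N hN hp1 hpN hlbar
  set B := 1 + lbar * M with hB
  have hB0 : 0 ≤ B := by positivity
  set L := p * B ^ (p - 1) * lbar with hL
  have hL0 : 0 ≤ L := by positivity
  obtain ⟨C', hC'⟩ := schauder_estimate N hΩo hb hR hR1 hC hc hM hL0
  refine ⟨1 / 2, by norm_num, -(lbar * M), max M C', fun lam α ψ hlam hlam' hsol => ?_⟩
  obtain ⟨hψ, heq, h0, hmass⟩ := hsol
  simp only [lapl_eq_lap hψ] at heq
  obtain ⟨hα, hψM⟩ := hsup Ω lam α ψ hΩo hb hvol hlam hlam' hψ h0 heq hmass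
  have hlamψ : ∀ x ∈ closure Ω, lam * ψ x ≤ lbar * M := fun x hx =>
    mul_le_mul hlam' (hψM x hx).2 (hψM x hx).1 hlbar.le
  have hmem : ∀ x ∈ Ω, max (α + lam * ψ x) 0 ∈ Icc 0 B := fun x hx =>
    ⟨le_max_right _ _, max_le (by linarith [hlamψ x (subset_closure hx)]) hB0⟩
  constructor
  · by_contra! hlt
    rw [setIntegral_congr_fun (g := fun _ => (0 : ℝ)) hΩo.measurableSet] at hmass
    · simp at hmass
    · intro x hx
      have := hlamψ x (subset_closure hx)
      simp only
      rw [max_eq_right (by linarith), Real.zero_rpow hp0.ne']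
  have hlapΩ : ∀ x ∈ Ω, ∀ y ∈ Ω, |lap ψ x - lap ψ y| ≤ L * |ψ x - ψ y| := by
    intro x hx y hy
    have e1 : lap ψ x - lap ψ y =
        -(max (α + lam * ψ x) 0 ^ p - max (α + lam * ψ y) 0 ^ p) := by
      linarith [heq x hx, heq y hy]
    rw [e1, abs_neg]
    refine (abs_rpow_sub_rpow_le hp1 (hmem x hx) (hmem y hy)).trans ?_
    rw [hL, mul_assoc _ lbar]
    refine mul_le_mul_of_nonneg_left ?_ (by positivity)
    refine (abs_max_sub_max_le_abs _ _ _).trans ?_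
    rw [add_sub_add_left_eq_sub, ← mul_sub, abs_mul, abs_of_nonneg hlam]
    gcongr
  have hlap : ∀ x ∈ closure Ω, ∀ y ∈ closure Ω, |lap ψ x - lap ψ y| ≤ L * |ψ x - ψ y| := by
    have hlc := continuous_lap hψ
    have hψc := hψ.continuous
    have hcl : IsClosed {q : Euc N × Euc N | |lap ψ q.1 - lap ψ q.2| ≤ L * |ψ q.1 - ψ q.2|} :=
      isClosed_le (by fun_prop) (by fun_prop)
    have hsub : closure (Ω ×ˢ Ω) ⊆ _ := hcl.closure_subset_iff.2 fun q hq => hlapΩ _ hq.1 _ hq.2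
    intro x hx y hy
    rw [closure_prod_eq] at hsub
    exact hsub (mk_mem_prod hx hy)
  intro x hx y hy
  obtain ⟨h1, h2, h3⟩ := hC' ψ hψ h0 (fun x hx => abs_le.2
    ⟨by linarith [(hψM x hx).1], (hψM x hx).2⟩) hlap x hx
  refine ⟨?_, h1.trans (le_max_right _ _),
    ((norm_iteratedFDeriv_two_le ψ x).trans h2).trans (le_max_right _ _),
    (norm_iteratedFDeriv_two_sub_le ψ x y).trans ((h3 y hy).trans ?_)⟩
  · rw [abs_of_nonneg (hψM x hx).1]
    exact (hψM x hx).2.trans (le_max_left _ _)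
  · rw [Real.sqrt_eq_rpow]
    gcongr
    exact le_max_right _ _

end
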